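/- Let D = 2d with d ≥ 1, let U ⊆ ℝ^D be open, and let I : U → Matrix (Fin D) (Fin D) ℝ be a C^∞ map with I(x)·I(x) = -1 (minus the identity matrix) for every x ∈ U. Then the Nijenhuis tensor of I vanishes identically on U if and only if every point x₀ ∈ U has an open neighborhood V ⊆ U on which there exist C^∞ functions z^1, …, z^d : V → ℂ, each satisfying the complex-coordinate equations for I, such that at every point of V the real Jacobian matrix of the map (Re z^1, Im z^1, …, Re z^d, Im z^d) : V → ℝ^{2d} is invertible. -/

import Mathlib

open scoped BigOperators

/-- Partial derivative in the `P`-th coordinate direction of a real-valued function on `ℝ^D`. -/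
noncomputable def pd {D : ℕ} (f : (Fin D → ℝ) → ℝ) (P : Fin D) (x : Fin D → ℝ) : ℝ :=
  fderiv ℝ f x (Pi.single P 1)

/-- Partial derivative in the `P`-th coordinate direction of a complex-valued function on `ℝ^D`. -/
noncomputable def pdC {D : ℕ} (f : (Fin D → ℝ) → ℂ) (P : Fin D) (x : Fin D → ℝ) : ℂ :=
  fderiv ℝ f x (Pi.single P 1)

/-- The Nijenhuis tensor `N_{MN}{}^K` of a matrix field `I` on `ℝ^D`. -/
noncomputable def nijenhuis {D : ℕ} (I : (Fin D → ℝ) → Matrix (Fin D) (Fin D) ℝ)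
    (x : Fin D → ℝ) (M N K : Fin D) : ℝ :=
  (pd (fun y => I y N K) M x - pd (fun y => I y M K) N x)
    - ∑ P, ∑ Q, I x M P * I x N Q *
        (pd (fun y => I y Q K) P x - pd (fun y => I y P K) Q x)

/-- `z` satisfies the complex-coordinate equations `∂_M z - i I_M{}^N ∂_N z = 0` for `I` at `x`. -/
def ComplexCoordEq {D : ℕ} (I : (Fin D → ℝ) → Matrix (Fin D) (Fin D) ℝ)
    (z : (Fin D → ℝ) → ℂ) (x : Fin D → ℝ) : Prop :=
  ∀ M : Fin D, pdC z M x - Complex.I * ∑ N, (I x M N : ℂ) * pdC z N x = 0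


/-- The real Jacobian matrix of the map `(Re z^1, Im z^1, …, Re z^d, Im z^d) : ℝ^{2d} → ℝ^{2d}`
at a point `x`, written as a square matrix indexed by `Fin d × Fin 2`. -/
noncomputable def realJacobian {d : ℕ} (z : Fin d → ((Fin (2 * d) → ℝ) → ℂ))
    (x : Fin (2 * d) → ℝ) : Matrix (Fin d × Fin 2) (Fin d × Fin 2) ℝ :=
  Matrix.of fun p q : Fin d × Fin 2 =>
    pd (fun y => if p.2 = 0 then (z p.1 y).re else (z p.1 y).im)
      ((finProdFinEquiv.trans (finCongr (by ring : d * 2 = 2 * d))) q) x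

namespace NN
open scoped BigOperators Topology ContDiff

/-- A parametrised fixed point equation `y = N (p, y)` whose right side has vanishing `y`-derivative
has a unique small solution, depending differentiably on the parameter. -/
theorem exists_fixedPoint {𝕜 P Y : Type*} [RCLike 𝕜]
    [NormedAddCommGroup P] [NormedSpace 𝕜 P] [CompleteSpace P]
    [NormedAddCommGroup Y] [NormedSpace 𝕜 Y] [CompleteSpace Y]
    (N : P × Y → Y) (hN : ContDiffAt 𝕜 1 N 0) (h0 : N 0 = 0)
    (hd : ∀ y, fderiv 𝕜 N 0 (0, y) = 0) :
    ∃ φ : P → Y, ContDiffAt 𝕜 1 φ 0 ∧ φ 0 = 0 ∧ (∀ᶠ p in 𝓝 0, N (p, φ p) = φ p) ∧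
      ∀ᶠ q in 𝓝 (0 : P × Y), N q = q.2 → q.2 = φ q.1 := by
  have hF : ContDiffAt 𝕜 1 (fun q : P × Y => q.2 - N q) 0 := contDiffAt_snd.sub hN
  have hder : fderiv 𝕜 (fun q : P × Y => q.2 - N q) 0 ∘L .inr 𝕜 P Y =
      ContinuousLinearMap.id 𝕜 Y := by
    ext y
    have := (hasFDerivAt_snd (𝕜 := 𝕜) (p := (0 : P × Y))).fun_sub
      (hN.differentiableAt (by norm_num)).hasFDerivAt
    rw [HasFDerivAt.fderiv this]
    simp [hd]
  have hinv : (fderiv 𝕜 (fun q : P × Y => q.2 - N q) 0 ∘L .inr 𝕜 P Y).IsInvertible := by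
    rw [hder]; exact ⟨ContinuousLinearEquiv.refl 𝕜 Y, rfl⟩
  refine ⟨hF.implicitFunction one_ne_zero hinv, hF.contDiffAt_implicitFunction one_ne_zero hinv,
    hF.implicitFunction_apply_self one_ne_zero hinv, ?_, ?_⟩
  · filter_upwards [hF.eventually_apply_implicitFunction one_ne_zero hinv] with p hp
    simp only [h0, Prod.snd_zero, sub_zero] at hp
    exact (sub_eq_zero.1 hp).symm
  · filter_upwards [hF.eventually_apply_eq_iff_implicitFunction one_ne_zero hinv] with q hq h
    refine (hq.1 ?_).symm
    simp [h0, h]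

/-- `f` is continuously differentiable at the origin and vanishes there. -/
def VanishOne (𝕜 : Type*) [RCLike 𝕜] {V A : Type*} [NormedAddCommGroup V] [NormedSpace 𝕜 V]
    [NormedAddCommGroup A] [NormedSpace 𝕜 A] (f : V → A) : Prop :=
  ContDiffAt 𝕜 1 f 0 ∧ f 0 = 0

/-- `f` is continuously differentiable at the origin and vanishes there to second order. -/
def VanishTwo (𝕜 : Type*) [RCLike 𝕜] {V A : Type*} [NormedAddCommGroup V] [NormedSpace 𝕜 V]
    [NormedAddCommGroup A] [NormedSpace 𝕜 A] (f : V → A) : Prop :=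
  ContDiffAt 𝕜 1 f 0 ∧ f 0 = 0 ∧ fderiv 𝕜 f 0 = 0

section Vanish
variable {𝕜 : Type*} [RCLike 𝕜] {V A : Type*} [NormedAddCommGroup V] [NormedSpace 𝕜 V]
    [NormedCommRing A] [NormedAlgebra 𝕜 A] {f g : V → A}
    {W : Type*} [NormedAddCommGroup W] [NormedSpace 𝕜 W]

theorem VanishTwo.one (hf : VanishTwo 𝕜 f) : VanishOne 𝕜 f := ⟨hf.1, hf.2.1⟩

theorem VanishTwo.hasFDerivAt (hf : VanishTwo 𝕜 f) : HasFDerivAt f (0 : V →L[𝕜] A) 0 := by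
  have := (hf.1.differentiableAt (by norm_num)).hasFDerivAt
  rwa [hf.2.2] at this

theorem VanishOne.add (hf : VanishOne 𝕜 f) (hg : VanishOne 𝕜 g) :
    VanishOne 𝕜 (fun v => f v + g v) := ⟨hf.1.add hg.1, by simp [hf.2, hg.2]⟩

theorem VanishOne.sub (hf : VanishOne 𝕜 f) (hg : VanishOne 𝕜 g) :
    VanishOne 𝕜 (fun v => f v - g v) := ⟨hf.1.sub hg.1, by simp [hf.2, hg.2]⟩

theorem VanishOne.neg (hf : VanishOne 𝕜 f) :
    VanishOne 𝕜 (fun v => - f v) := ⟨hf.1.neg, by simp [hf.2]⟩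

theorem VanishOne.sum {ι : Type*} {s : Finset ι} {f : ι → V → A}
    (hf : ∀ i ∈ s, VanishOne 𝕜 (f i)) : VanishOne 𝕜 (fun v => ∑ i ∈ s, f i v) :=
  ⟨ContDiffAt.sum fun i hi => (hf i hi).1, Finset.sum_eq_zero fun i hi => (hf i hi).2⟩

theorem VanishOne.mul_left (hf : ContDiffAt 𝕜 1 f 0) (hg : VanishOne 𝕜 g) :
    VanishOne 𝕜 (fun v => f v * g v) := ⟨hf.mul hg.1, by simp [hg.2]⟩

theorem VanishOne.mul_right (hf : VanishOne 𝕜 f) (hg : ContDiffAt 𝕜 1 g 0) :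
    VanishOne 𝕜 (fun v => f v * g v) := ⟨hf.1.mul hg, by simp [hf.2]⟩

theorem VanishOne.clm {B : Type*} [NormedAddCommGroup B] [NormedSpace 𝕜 B] {f : V → B}
    (L : B →L[𝕜] A) (hf : VanishOne 𝕜 f) : VanishOne 𝕜 (fun v => L (f v)) :=
  ⟨L.contDiff.contDiffAt.comp _ hf.1, by simp [hf.2]⟩

theorem VanishTwo.add (hf : VanishTwo 𝕜 f) (hg : VanishTwo 𝕜 g) :
    VanishTwo 𝕜 (fun v => f v + g v) :=
  ⟨hf.1.add hg.1, by simp [hf.2, hg.2], by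
    simpa using (hf.hasFDerivAt.fun_add hg.hasFDerivAt).fderiv⟩

theorem VanishTwo.sub (hf : VanishTwo 𝕜 f) (hg : VanishTwo 𝕜 g) :
    VanishTwo 𝕜 (fun v => f v - g v) :=
  ⟨hf.1.sub hg.1, by simp [hf.2, hg.2], by
    simpa using (hf.hasFDerivAt.fun_sub hg.hasFDerivAt).fderiv⟩

theorem VanishTwo.neg (hf : VanishTwo 𝕜 f) :
    VanishTwo 𝕜 (fun v => - f v) :=
  ⟨hf.1.neg, by simp [hf.2], by simpa using (hf.hasFDerivAt.fun_neg).fderiv⟩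

theorem VanishTwo.sum {ι : Type*} {s : Finset ι} {f : ι → V → A}
    (hf : ∀ i ∈ s, VanishTwo 𝕜 (f i)) : VanishTwo 𝕜 (fun v => ∑ i ∈ s, f i v) :=
  ⟨ContDiffAt.sum fun i hi => (hf i hi).1, Finset.sum_eq_zero fun i hi => (hf i hi).2.1, by
    simpa using (HasFDerivAt.fun_sum fun i hi => (hf i hi).hasFDerivAt).fderiv⟩

theorem VanishOne.mul (hf : VanishOne 𝕜 f) (hg : VanishOne 𝕜 g) :
    VanishTwo 𝕜 (fun v => f v * g v) :=
  ⟨hf.1.mul hg.1, by simp [hf.2], by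
    have := ((hf.1.differentiableAt (by norm_num)).hasFDerivAt.fun_mul
      (hg.1.differentiableAt (by norm_num)).hasFDerivAt).fderiv
    rw [this]
    ext v
    simp [hf.2, hg.2]⟩

theorem VanishTwo.mul_left (hf : ContDiffAt 𝕜 1 f 0) (hg : VanishTwo 𝕜 g) :
    VanishTwo 𝕜 (fun v => f v * g v) :=
  ⟨hf.mul hg.1, by simp [hg.2], by
    have := ((hf.differentiableAt (by norm_num)).hasFDerivAt.fun_mul hg.hasFDerivAt).fderiv
    rw [this]
    ext v
    simp [hg.2.1]⟩

theorem vanishTwo_pi {ι : Type*} [Fintype ι] {A : Type*} [NormedAddCommGroup A] [NormedSpace 𝕜 A]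
    {f : V → ι → A}
    (hf : ∀ i, VanishTwo 𝕜 (fun v => f v i)) : VanishTwo 𝕜 f :=
  ⟨contDiffAt_pi.2 fun i => (hf i).1, funext fun i => (hf i).2.1, by
    have : HasFDerivAt f (0 : V →L[𝕜] (ι → A)) 0 := by
      rw [hasFDerivAt_pi']
      intro i
      have := ((hf i).1.differentiableAt (by norm_num)).hasFDerivAt
      rw [(hf i).2.2] at this
      simpa using this
    exact this.fderiv⟩

end Vanish
end NN

namespace NN
open scoped BigOperators Topology ContDiff

/-- The polynomial weight `(1 + ‖k‖) ^ s` on the integer lattice. -/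
noncomputable def wt {ι : Type*} [Fintype ι] (s : ℕ) (k : ι → ℤ) : ℝ := (1 + ‖k‖) ^ s

section wt
variable {ι : Type*} [Fintype ι] (s : ℕ)

theorem wt_pos (k : ι → ℤ) : 0 < wt s k := by unfold wt; positivity

theorem wt_zero : wt s (0 : ι → ℤ) = 1 := by simp [wt]

theorem wt_neg (k : ι → ℤ) : wt s (-k) = wt s k := by simp [wt]

theorem one_le_wt (k : ι → ℤ) : 1 ≤ wt s k :=
  one_le_pow₀ (by linarith [norm_nonneg k])

theorem wt_add_le (k l : ι → ℤ) : wt s (k + l) ≤ wt s k * wt s l := by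
  unfold wt
  rw [← mul_pow]
  gcongr
  nlinarith [norm_add_le k l, norm_nonneg k, norm_nonneg l,
    mul_nonneg (norm_nonneg k) (norm_nonneg l)]

theorem wt_ne (k : ι → ℤ) : ((wt s k : ℝ) : ℂ) ≠ 0 := by
  exact_mod_cast (wt_pos s k).ne'

end wt

/-- The weighted Wiener algebra of absolutely convergent Fourier series on the torus, normalised
so that the underlying space is the unweighted `ℓ¹`. -/
def Wiener (ι : Type*) [Fintype ι] (_s : ℕ) : Type _ := lp (fun _ : ι → ℤ => ℂ) 1

namespace Wiener
variable {ι : Type*} [Fintype ι] {s : ℕ}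

noncomputable instance : NormedAddCommGroup (Wiener ι s) :=
  inferInstanceAs (NormedAddCommGroup (lp (fun _ : ι → ℤ => ℂ) 1))
noncomputable instance : NormedSpace ℂ (Wiener ι s) :=
  inferInstanceAs (NormedSpace ℂ (lp (fun _ : ι → ℤ => ℂ) 1))
instance : CompleteSpace (Wiener ι s) :=
  inferInstanceAs (CompleteSpace (lp (fun _ : ι → ℤ => ℂ) 1))

/-- The normalised entries of an element of the Wiener algebra. -/
def entry (a : Wiener ι s) (k : ι → ℤ) : ℂ := (show lp (fun _ : ι → ℤ => ℂ) 1 from a) k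

theorem ext_entry {a b : Wiener ι s} (h : ∀ k, entry a k = entry b k) : a = b :=
  lp.ext (funext h)

theorem entry_add (a b : Wiener ι s) (k) : entry (a + b) k = entry a k + entry b k := rfl
theorem entry_smul (c : ℂ) (a : Wiener ι s) (k) : entry (c • a) k = c * entry a k := rfl

theorem hasSum_norm_entry (a : Wiener ι s) : HasSum (fun k => ‖entry a k‖) ‖a‖ := by
  have := lp.hasSum_norm (p := 1) (by norm_num) (show lp (fun _ : ι → ℤ => ℂ) 1 from a)
  simp only [ENNReal.toReal_one, Real.rpow_one] at this
  exact this

theorem norm_entry_le (a : Wiener ι s) (k) : ‖entry a k‖ ≤ ‖a‖ := by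
  have := lp.norm_apply_le_norm (p := 1) (by norm_num) (show lp (fun _ : ι → ℤ => ℂ) 1 from a) k
  exact this

/-- The normalised exponential of frequency `k`. -/
noncomputable def unit (k : ι → ℤ) : Wiener ι s := by
  classical exact (lp.single 1 k (1 : ℂ) : lp (fun _ : ι → ℤ => ℂ) 1)

theorem entry_unit (k l : ι → ℤ) [Decidable (l = k)] :
    entry (unit k : Wiener ι s) l = if l = k then 1 else 0 := by
  classical
  unfold unit
  refine (lp.single_apply (E := fun _ : ι → ℤ => ℂ) 1 k (1 : ℂ) l).trans ?_
  rw [Pi.single_apply]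
  congr

theorem norm_unit (k : ι → ℤ) : ‖(unit k : Wiener ι s)‖ = 1 := by
  classical
  have := lp.norm_single (E := fun _ : ι → ℤ => ℂ) (p := 1) (by norm_num) k (1 : ℂ)
  rw [norm_one] at this
  exact this

theorem hasSum_unit (a : Wiener ι s) : HasSum (fun k => entry a k • (unit k : Wiener ι s)) a := by
  classical
  have h := lp.hasSum_single (p := 1) (by norm_num) (show lp (fun _ : ι → ℤ => ℂ) 1 from a)
  have h' : (fun k => entry a k • (unit k : Wiener ι s)) =
      fun k => (lp.single (E := fun _ : ι → ℤ => ℂ) 1 k (entry a k)) := ?_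
  · rw [h']; exact h
  funext k
  refine ext_entry fun l => ?_
  rw [entry_smul, entry_unit]
  change _ = (lp.single (E := fun _ : ι → ℤ => ℂ) 1 k (entry a k)) l
  rw [lp.single_apply, Pi.single_apply, mul_ite, mul_one, mul_zero]

theorem eq_of_unit {F : Type*} [AddCommGroup F] [TopologicalSpace F] [T2Space F]
    (f g : Wiener ι s →+ F) (hf : Continuous f) (hg : Continuous g)
    (h : ∀ k (c : ℂ), f (c • unit k) = g (c • unit k)) (a : Wiener ι s) : f a = g a := by
  have h1 := (hasSum_unit a).map f hf
  have h2 := (hasSum_unit a).map g hg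
  refine h1.unique ?_
  convert h2 using 1
  funext k
  exact h k _

theorem clm_eq_of_unit {F : Type*} [NormedAddCommGroup F] [NormedSpace ℂ F]
    (f g : Wiener ι s →L[ℂ] F) (h : ∀ k, f (unit k) = g (unit k)) (a : Wiener ι s) :
    f a = g a :=
  eq_of_unit (f : Wiener ι s →+ F) (g : Wiener ι s →+ F) f.continuous g.continuous
    (fun k c => by
      change f (c • unit k) = g (c • unit k)
      rw [map_smul, map_smul, h]) a

section lift
variable {F : Type*} [NormedAddCommGroup F] [NormedSpace ℂ F] [CompleteSpace F]

/-- A bounded family of vectors extends to a continuous linear map. -/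
noncomputable def lift (v : (ι → ℤ) → F) (C : ℝ) (hv : ∀ k, ‖v k‖ ≤ C) : Wiener ι s →L[ℂ] F :=
  have hs : ∀ a : Wiener ι s, Summable fun k => entry a k • v k := fun a =>
    Summable.of_norm_bounded ((hasSum_norm_entry a).summable.mul_right C) fun k => by
      rw [norm_smul]; gcongr; exact hv k
  LinearMap.mkContinuous
    { toFun := fun a => ∑' k, entry a k • v k
      map_add' := fun a b => by
        rw [← (hs a).tsum_add (hs b)]
        simp only [entry_add, add_smul]
      map_smul' := fun c a => by
        rw [RingHom.id_apply, ← (hs a).tsum_const_smul]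
        simp only [entry_smul, mul_smul] } C (fun a => by
      have h := (hasSum_norm_entry a).mul_left C
      refine tsum_of_norm_bounded h fun k => ?_
      rw [norm_smul, mul_comm]
      gcongr
      exact hv k)

theorem hasSum_lift (v : (ι → ℤ) → F) (C : ℝ) (hv : ∀ k, ‖v k‖ ≤ C) (a : Wiener ι s) :
    HasSum (fun k => entry a k • v k) (lift v C hv a) :=
  (Summable.of_norm_bounded ((hasSum_norm_entry a).summable.mul_right C) fun k => by
      rw [norm_smul]; gcongr; exact hv k).hasSum

theorem lift_unit (v : (ι → ℤ) → F) (C : ℝ) (hv : ∀ k, ‖v k‖ ≤ C) (k) :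
    lift v C hv (unit k : Wiener ι s) = v k := by
  classical
  refine (hasSum_lift v C hv (unit k)).unique ?_
  convert hasSum_ite_eq k (v k) using 1
  funext l
  rw [entry_unit]
  split_ifs with h
  · rw [h, one_smul]
  · simp

theorem norm_lift_le (v : (ι → ℤ) → F) (C : ℝ) (hC : 0 ≤ C) (hv : ∀ k, ‖v k‖ ≤ C) :
    ‖(lift v C hv : Wiener ι s →L[ℂ] F)‖ ≤ C :=
  ContinuousLinearMap.opNorm_le_bound _ hC fun a => by
    have h := (hasSum_norm_entry a).mul_left C
    rw [← (hasSum_lift v C hv a).tsum_eq]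
    refine tsum_of_norm_bounded h fun k => ?_
    rw [norm_smul, mul_comm]
    gcongr
    exact hv k

end lift
end Wiener
end NN

namespace NN
open scoped BigOperators Topology ContDiff
namespace Wiener
variable {ι : Type*} [Fintype ι] {s : ℕ}

theorem norm_structure_le (k l : ι → ℤ) :
    ‖(((wt s (k + l) : ℝ) : ℂ) / (wt s k * wt s l)) • (unit (k + l) : Wiener ι s)‖ ≤ 1 := by
  rw [norm_smul, norm_unit, mul_one, norm_div, norm_mul]
  simp only [Complex.norm_real, Real.norm_eq_abs, abs_of_pos (wt_pos s _)]
  exact div_le_one_of_le₀ (wt_add_le s k l) (mul_nonneg (wt_pos s k).le (wt_pos s l).le)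

/-- Multiplication in the Wiener algebra as a continuous bilinear map. -/
noncomputable def mulL : Wiener ι s →L[ℂ] Wiener ι s →L[ℂ] Wiener ι s :=
  lift (fun k => lift (fun l => (((wt s (k + l) : ℝ) : ℂ) / (wt s k * wt s l)) • unit (k + l)) 1
    (norm_structure_le k)) 1 (fun _ => norm_lift_le _ _ zero_le_one _)

theorem mulL_unit (k l : ι → ℤ) : mulL (unit k : Wiener ι s) (unit l) =
    (((wt s (k + l) : ℝ) : ℂ) / (wt s k * wt s l)) • unit (k + l) := by
  rw [mulL, lift_unit, lift_unit]

theorem norm_mulL_le (a b : Wiener ι s) : ‖mulL a b‖ ≤ ‖a‖ * ‖b‖ := by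
  have h : ‖(mulL : Wiener ι s →L[ℂ] _)‖ ≤ 1 := norm_lift_le _ _ zero_le_one _
  calc ‖mulL a b‖ ≤ ‖mulL a‖ * ‖b‖ := (mulL a).le_opNorm b
    _ ≤ (1 * ‖a‖) * ‖b‖ := by gcongr; exact (mulL.le_opNorm a).trans (by gcongr)
    _ = _ := by rw [one_mul]

theorem mulL_comm (a b : Wiener ι s) : mulL a b = mulL b a := by
  refine clm_eq_of_unit (mulL.flip b) (mulL b) (fun k => ?_) a
  refine clm_eq_of_unit (mulL (unit k)) (mulL.flip (unit k)) (fun l => ?_) b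
  rw [ContinuousLinearMap.flip_apply, mulL_unit, mulL_unit, add_comm l k, mul_comm (wt s l : ℂ)]

theorem mulL_assoc (a b c : Wiener ι s) : mulL (mulL a b) c = mulL a (mulL b c) := by
  refine clm_eq_of_unit ((mulL.flip c).comp (mulL.flip b)) (mulL.flip (mulL b c)) (fun k => ?_) a
  refine clm_eq_of_unit ((mulL.flip c).comp (mulL (unit k))) ((mulL (unit k)).comp (mulL.flip c))
    (fun l => ?_) b
  refine clm_eq_of_unit (mulL (mulL (unit k) (unit l))) ((mulL (unit k)).comp (mulL (unit l)))
    (fun m => ?_) c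
  simp only [ContinuousLinearMap.comp_apply, mulL_unit, map_smul,
    _root_.smul_apply, smul_smul]
  rw [add_assoc]
  congr 1
  have h1 := wt_ne s (k + l)
  have h2 := wt_ne s (l + m)
  field_simp

theorem one_mulL (a : Wiener ι s) : mulL (unit 0) a = a := by
  refine clm_eq_of_unit (mulL (unit 0)) (.id ℂ _) (fun k => ?_) a
  rw [mulL_unit]
  simp [wt_zero, div_self (wt_ne s k)]

noncomputable instance : Mul (Wiener ι s) := ⟨fun a b => mulL a b⟩
noncomputable instance : One (Wiener ι s) := ⟨unit 0⟩

theorem one_def : (1 : Wiener ι s) = unit 0 := rfl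

noncomputable instance : NormedCommRing (Wiener ι s) :=
  { (inferInstance : NormedAddCommGroup (Wiener ι s)) with
    mul := (· * ·)
    one := 1
    left_distrib := fun a b c => map_add (mulL a) b c
    right_distrib := fun a b c => by
      change mulL (a + b) c = mulL a c + mulL b c
      rw [map_add, _root_.add_apply]
    zero_mul := fun a => by
      change mulL 0 a = 0
      rw [map_zero, _root_.zero_apply]
    mul_zero := fun a => map_zero (mulL a)
    mul_assoc := mulL_assoc
    one_mul := one_mulL
    mul_one := fun a => (mulL_comm _ _).trans (one_mulL a)
    mul_comm := mulL_comm
    norm_mul_le := norm_mulL_le }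

noncomputable instance : NormedAlgebra ℂ (Wiener ι s) :=
  { Algebra.ofModule (R := ℂ) (A := Wiener ι s)
      (fun c a b => by
        change mulL (c • a) b = c • mulL a b
        rw [map_smul, _root_.smul_apply])
      (fun c a b => map_smul (mulL a) c b) with
    norm_smul_le := norm_smul_le }


/-- The unnormalised Fourier coefficient. -/
noncomputable def coef (a : Wiener ι s) (k : ι → ℤ) : ℂ := entry a k / wt s k

theorem ext_coef {a b : Wiener ι s} (h : ∀ k, coef a k = coef b k) : a = b :=
  ext_entry fun k => by
    have := h k
    unfold coef at this
    exact (div_left_inj' (wt_ne s k)).1 this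

/-- Membership criterion for the Wiener algebra. -/
theorem exists_coef (c : (ι → ℤ) → ℂ) (hc : Summable fun k => wt s k * ‖c k‖) :
    ∃ a : Wiener ι s, (∀ k, coef a k = c k) ∧ ‖a‖ = ∑' k, wt s k * ‖c k‖ := by
  have hn : ∀ k, ‖((wt s k : ℝ) : ℂ) * c k‖ = wt s k * ‖c k‖ := fun k => by
    rw [norm_mul, Complex.norm_real, Real.norm_eq_abs, abs_of_pos (wt_pos s _)]
  have hm : Memℓp (E := fun _ : ι → ℤ => ℂ) (fun k => ((wt s k : ℝ) : ℂ) * c k) 1 := by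
    refine memℓp_gen ?_
    simp only [hn, ENNReal.toReal_one, Real.rpow_one]
    exact hc
  let a : Wiener ι s := (⟨_, hm⟩ : lp (fun _ : ι → ℤ => ℂ) 1)
  have ha : ∀ k, entry a k = wt s k * c k := fun k => rfl
  refine ⟨a, fun k => ?_, ?_⟩
  · rw [coef, ha, mul_div_cancel_left₀ _ (wt_ne s k)]
  · rw [← (hasSum_norm_entry a).tsum_eq]
    exact tsum_congr fun k => by rw [ha, hn]

/-- The Fourier multiplier with bounded symbol `m`. -/
noncomputable def mult (m : (ι → ℤ) → ℂ) (C : ℝ) (hm : ∀ k, ‖m k‖ ≤ C) :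
    Wiener ι s →L[ℂ] Wiener ι s :=
  lift (fun k => m k • unit k) C (fun k => by rw [norm_smul, norm_unit, mul_one]; exact hm k)

theorem mult_unit (m : (ι → ℤ) → ℂ) (C : ℝ) (hm : ∀ k, ‖m k‖ ≤ C) (k) :
    mult m C hm (unit k : Wiener ι s) = m k • unit k := lift_unit _ _ _ _

/-- Normalised coefficients as continuous linear functionals. -/
noncomputable def entryL (k : ι → ℤ) : Wiener ι s →L[ℂ] ℂ :=
  LinearMap.mkContinuous
    { toFun := fun a => entry a k
      map_add' := fun _ _ => rfl
      map_smul' := fun _ _ => rfl } 1 (fun a => by rw [one_mul]; exact norm_entry_le a k)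

theorem coef_mult (m : (ι → ℤ) → ℂ) (C : ℝ) (hm : ∀ k, ‖m k‖ ≤ C) (a : Wiener ι s) (k) :
    coef (mult m C hm a) k = m k * coef a k := by
  have : entry (mult m C hm a) k = m k * entry a k := by
    refine clm_eq_of_unit ((entryL k).comp (mult m C hm)) (m k • entryL k) (fun l => ?_) a
    classical
    rw [ContinuousLinearMap.comp_apply, mult_unit]
    change entry (m l • unit l : Wiener ι s) k = m k * entry (unit l : Wiener ι s) k
    rw [entry_smul, entry_unit]
    split_ifs with h
    · rw [h]
    · simp
  rw [coef, this, coef, mul_div_assoc]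

/-- The character of frequency `k` at `x`. -/
noncomputable def chr (k : ι → ℤ) (x : ι → ℝ) : ℂ :=
  Complex.exp (2 * Real.pi * Complex.I * ∑ j, (k j : ℂ) * x j)

theorem norm_chr (k : ι → ℤ) (x : ι → ℝ) : ‖chr k x‖ = 1 := by
  have : chr k x = Complex.exp (((2 * Real.pi * ∑ j, (k j : ℝ) * x j : ℝ) : ℂ) * Complex.I) := by
    unfold chr; push_cast; congr 1; ring
  rw [this, Complex.norm_exp_ofReal_mul_I]

theorem chr_add (k l : ι → ℤ) (x : ι → ℝ) : chr (k + l) x = chr k x * chr l x := by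
  unfold chr
  rw [← Complex.exp_add, ← mul_add, ← Finset.sum_add_distrib]
  congr 2
  refine Finset.sum_congr rfl fun j _ => ?_
  simp only [Pi.add_apply]; push_cast; ring

theorem chr_neg (k : ι → ℤ) (x : ι → ℝ) : chr (-k) x = star (chr k x) := by
  unfold chr
  rw [Complex.star_def, ← Complex.exp_conj]
  simp [Complex.conj_ofNat]

theorem norm_chr_div_le (k : ι → ℤ) (x : ι → ℝ) : ‖chr k x / (wt s k : ℂ)‖ ≤ 1 := by
  rw [norm_div, norm_chr, Complex.norm_real, Real.norm_eq_abs, abs_of_pos (wt_pos s _)]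
  exact div_le_one_of_le₀ (one_le_wt s k) (wt_pos s k).le

/-- Evaluation at a point, as a continuous linear functional. -/
noncomputable def evL (x : ι → ℝ) : Wiener ι s →L[ℂ] ℂ :=
  lift (fun k => chr k x / wt s k) 1 (fun k => norm_chr_div_le k x)

theorem evL_unit (x : ι → ℝ) (k) : evL x (unit k : Wiener ι s) = chr k x / wt s k :=
  lift_unit _ _ _ _

theorem hasSum_evL (x : ι → ℝ) (a : Wiener ι s) :
    HasSum (fun k => coef a k * chr k x) (evL x a) := by
  have h := hasSum_lift (fun k => chr k x / (wt s k : ℂ)) 1 (fun k => norm_chr_div_le k x) a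
  refine HasSum.congr_fun (f := fun k => entry a k • (chr k x / (wt s k : ℂ))) h fun k => ?_
  simp only [coef, smul_eq_mul]
  ring

theorem evL_mul (x : ι → ℝ) (a b : Wiener ι s) : evL x (a * b) = evL x a * evL x b := by
  change evL x (mulL a b) = _
  refine clm_eq_of_unit ((evL x).comp (mulL.flip b)) (evL x b • evL x) (fun k => ?_) a |>.trans
    (mul_comm _ _)
  refine clm_eq_of_unit ((evL x).comp (mulL (unit k))) (evL x (unit k) • evL x) (fun l => ?_) b
    |>.trans (mul_comm _ _)
  simp only [ContinuousLinearMap.comp_apply, mulL_unit, map_smul, evL_unit,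
    _root_.smul_apply, chr_add, smul_eq_mul]
  have h1 := wt_ne s (k + l)
  field_simp

theorem evL_one (x : ι → ℝ) : evL x (1 : Wiener ι s) = 1 := by
  rw [one_def, evL_unit]; simp [chr, wt_zero]

/-- Evaluation at a point, as an algebra homomorphism. -/
noncomputable def ev (x : ι → ℝ) : Wiener ι s →ₐ[ℂ] ℂ :=
  AlgHom.ofLinearMap (evL (s := s) x).toLinearMap (evL_one x) (evL_mul x)

end Wiener
end NN

namespace NN
open scoped BigOperators Topology ContDiff
namespace Wiener
variable {ι : Type*} [Fintype ι] {s : ℕ}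

/-- The squared Euclidean length of a frequency. -/
def nsq (k : ι → ℤ) : ℤ := ∑ j, k j ^ 2

theorem nsq_nonneg (k : ι → ℤ) : 0 ≤ nsq k := Finset.sum_nonneg fun _ _ => sq_nonneg _

theorem nsq_pos {k : ι → ℤ} (hk : k ≠ 0) : 1 ≤ nsq k := by
  obtain ⟨j, hj⟩ := Function.ne_iff.1 hk
  have h1 : k j ^ 2 ≤ nsq k :=
    Finset.single_le_sum (f := fun j => k j ^ 2) (fun _ _ => sq_nonneg _) (Finset.mem_univ j)
  have h2 : 0 < k j ^ 2 := by have : k j ≠ 0 := hj; positivity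
  omega

theorem abs_le_nsq (k : ι → ℤ) (j : ι) : |k j| ≤ nsq k := by
  have h1 : k j ^ 2 ≤ nsq k :=
    Finset.single_le_sum (f := fun j => k j ^ 2) (fun _ _ => sq_nonneg _) (Finset.mem_univ j)
  rw [← sq_abs] at h1
  nlinarith [abs_nonneg (k j), sq_nonneg (|k j| - 1), h1,
    (by by_cases h : |k j| = 0
        · rw [h]; norm_num
        · have := abs_nonneg (k j)
          have : 1 ≤ |k j| := by omega
          nlinarith : |k j| ≤ |k j| ^ 2)]

theorem abs_mul_le_nsq (k : ι → ℤ) (i j : ι) : |k i| * |k j| ≤ nsq k := by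
  have h1 : ∀ j, k j ^ 2 ≤ nsq k := fun j =>
    Finset.single_le_sum (f := fun j => k j ^ 2) (fun _ _ => sq_nonneg _) (Finset.mem_univ j)
  have hi := h1 i
  have hj := h1 j
  rw [← sq_abs] at hi hj
  nlinarith [sq_nonneg (|k i| - |k j|)]

/-- Symbol of the mean-free inverse Laplacian. -/
noncomputable def symR (k : ι → ℤ) : ℂ := -(1 / (4 * Real.pi ^ 2 * nsq k) : ℝ)

theorem norm_symR (k : ι → ℤ) : ‖symR k‖ = 1 / (4 * Real.pi ^ 2 * nsq k) := by
  have := nsq_nonneg k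
  have : (0 : ℝ) ≤ nsq k := by exact_mod_cast this
  rw [symR, norm_neg, Complex.norm_real, Real.norm_eq_abs, abs_of_nonneg (by positivity)]

theorem symR_zero : symR (0 : ι → ℤ) = 0 := by simp [symR, nsq]

theorem norm_symR_mul_le {k : ι → ℤ} {t C : ℝ} (ht : t ≤ C * nsq k) (hC' : C ≤ 4 * Real.pi ^ 2) : t * ‖symR k‖ ≤ 1 := by
  by_cases hk : k = 0
  · rw [hk, symR_zero]; simp
  · have h1 : (1 : ℝ) ≤ nsq k := by exact_mod_cast nsq_pos hk
    rw [norm_symR, mul_one_div]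
    apply div_le_one_of_le₀ _ (by positivity)
    calc t ≤ C * nsq k := ht
      _ ≤ _ := by gcongr

theorem two_pi_bounds : 1 ≤ 2 * Real.pi ∧ 2 * Real.pi ≤ 4 * Real.pi ^ 2 ∧ 1 ≤ 4 * Real.pi ^ 2 := by
  have := Real.pi_gt_three
  refine ⟨by linarith, by nlinarith, by nlinarith⟩

/-- Symbol of the derivative in direction `j`. -/
noncomputable def symD (k : ι → ℤ) (j : ι) : ℂ := 2 * Real.pi * Complex.I * k j

omit [Fintype ι] in
theorem norm_symD (k : ι → ℤ) (j : ι) : ‖symD k j‖ = 2 * Real.pi * |k j| := by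
  simp [symD, abs_of_pos Real.pi_pos]

theorem norm_symR_le (k : ι → ℤ) : ‖symR k‖ ≤ 1 := by
  by_cases hk : k = 0
  · rw [hk, symR_zero]; simp
  · have h1 : (1 : ℝ) ≤ nsq k := by exact_mod_cast nsq_pos hk
    have := norm_symR_mul_le (k := k) (t := 1) (C := 1) (by linarith) two_pi_bounds.2.2
    linarith

theorem norm_symR1_le (i : ι) (k : ι → ℤ) : ‖symD k i * symR k‖ ≤ 1 := by
  rw [norm_mul, norm_symD]
  refine norm_symR_mul_le (C := 2 * Real.pi) ?_ two_pi_bounds.2.1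
  gcongr
  exact_mod_cast abs_le_nsq k i

theorem norm_symR2_le (i j : ι) (k : ι → ℤ) : ‖symD k i * (symD k j * symR k)‖ ≤ 1 := by
  rw [← mul_assoc, norm_mul, norm_mul, norm_symD, norm_symD]
  refine norm_symR_mul_le (C := 4 * Real.pi ^ 2) ?_ le_rfl
  have : ((|k i| * |k j| : ℤ) : ℝ) ≤ nsq k := by exact_mod_cast abs_mul_le_nsq k i j
  push_cast at this ⊢
  calc 2 * Real.pi * |(k i : ℝ)| * (2 * Real.pi * |(k j : ℝ)|)
      = 4 * Real.pi ^ 2 * (|(k i : ℝ)| * |(k j : ℝ)|) := by ring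
    _ ≤ _ := by gcongr

/-- The mean-free inverse Laplacian on the torus. -/
noncomputable def R : Wiener ι s →L[ℂ] Wiener ι s := mult symR 1 norm_symR_le
/-- First derivatives of the inverse Laplacian. -/
noncomputable def R1 (i : ι) : Wiener ι s →L[ℂ] Wiener ι s :=
  mult (fun k => symD k i * symR k) 1 (norm_symR1_le i)
/-- Second derivatives of the inverse Laplacian. -/
noncomputable def R2 (i j : ι) : Wiener ι s →L[ℂ] Wiener ι s :=
  mult (fun k => symD k i * (symD k j * symR k)) 1 (norm_symR2_le i j)

open Classical in
theorem norm_symMean_le (k : ι → ℤ) : ‖(if k = 0 then 1 else 0 : ℂ)‖ ≤ 1 := by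
  split_ifs <;> simp

open Classical in
/-- The mean value. -/
noncomputable def mean : Wiener ι s →L[ℂ] Wiener ι s :=
  mult (fun k => if k = 0 then 1 else 0) 1 norm_symMean_le

theorem R2_comm (i j : ι) (a : Wiener ι s) : R2 i j a = R2 j i a :=
  ext_coef fun k => by rw [R2, R2, coef_mult, coef_mult]; ring

theorem coef_add (a b : Wiener ι s) (k) : coef (a + b) k = coef a k + coef b k := by
  simp only [coef, entry_add]; ring

theorem coef_smul (c : ℂ) (a : Wiener ι s) (k) : coef (c • a) k = c * coef a k := by
  simp only [coef, entry_smul]; ring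

theorem coef_sub (a b : Wiener ι s) (k) : coef (a - b) k = coef a k - coef b k := by
  rw [sub_eq_add_neg, ← neg_one_smul ℂ b, coef_add, coef_smul]; ring

theorem coef_zero (k) : coef (0 : Wiener ι s) k = 0 := by
  have := coef_sub (0 : Wiener ι s) 0 k
  rw [sub_zero] at this
  rw [this]; ring

theorem coef_sum {α : Type*} (t : Finset α) (f : α → Wiener ι s) (k) :
    coef (∑ i ∈ t, f i) k = ∑ i ∈ t, coef (f i) k := by
  classical
  induction t using Finset.induction_on with
  | empty => simp [coef_zero]
  | insert i t hi ih => rw [Finset.sum_insert hi, Finset.sum_insert hi, coef_add, ih]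

theorem sum_R2 (a : Wiener ι s) : ∑ i, R2 i i a = a - mean a := by
  classical
  refine ext_coef fun k => ?_
  rw [coef_sum, coef_sub, mean, coef_mult]
  simp only [R2, coef_mult]
  by_cases hk : k = 0
  · simp [hk, symR_zero]
  · have h1 : (nsq k : ℂ) ≠ 0 := by exact_mod_cast (zero_lt_one.trans_le (nsq_pos hk)).ne'
    have h2 : (Real.pi : ℂ) ≠ 0 := by exact_mod_cast Real.pi_ne_zero
    rw [if_neg hk, zero_mul, sub_zero, ← Finset.sum_mul]
    convert one_mul _
    simp only [symD, symR]
    have : ∀ i, 2 * (Real.pi : ℂ) * Complex.I * (k i) * (2 * Real.pi * Complex.I * (k i) *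
        (-((1 / (4 * Real.pi ^ 2 * nsq k) : ℝ) : ℂ))) = (k i : ℂ) ^ 2 / nsq k := fun i => by
      push_cast
      field_simp
      rw [Complex.I_sq]; ring
    simp only [this]
    rw [← Finset.sum_div]
    rw [div_eq_one_iff_eq h1, nsq]
    push_cast
    rfl

theorem evL_mean (x y : ι → ℝ) (a : Wiener ι s) : evL x (mean a) = evL y (mean a) := by
  have h : ∀ x, evL x (mean a) = coef a 0 := fun x => by
    classical
    refine (hasSum_evL x (mean a)).unique ?_
    convert hasSum_ite_eq (0 : ι → ℤ) (coef a 0) using 1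
    funext k
    rw [mean, coef_mult]
    split_ifs with hk
    · simp [hk, chr]
    · simp
  rw [h, h]

/-! ### Conjugation -/

theorem hasSum_norm_conj (a : Wiener ι s) : HasSum (fun k => ‖star (entry a (-k))‖) ‖a‖ := by
  simp only [norm_star]
  have := ((Equiv.neg (ι → ℤ)).hasSum_iff (f := fun k => ‖entry a k‖)).2 (hasSum_norm_entry a)
  exact this

theorem exists_conj (a : Wiener ι s) :
    ∃ b : Wiener ι s, (∀ k, entry b k = star (entry a (-k))) := by
  have hm : Memℓp (E := fun _ : ι → ℤ => ℂ) (fun k => star (entry a (-k))) 1 := by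
    refine memℓp_gen ?_
    simp only [ENNReal.toReal_one, Real.rpow_one]
    exact (hasSum_norm_conj a).summable
  exact ⟨(⟨_, hm⟩ : lp (fun _ : ι → ℤ => ℂ) 1), fun k => rfl⟩

/-- Pointwise complex conjugation of the represented function. -/
noncomputable def conjFun (a : Wiener ι s) : Wiener ι s := (exists_conj a).choose

theorem entry_conjFun (a : Wiener ι s) (k) : entry (conjFun a) k = star (entry a (-k)) :=
  (exists_conj a).choose_spec k

theorem norm_conjFun (a : Wiener ι s) : ‖conjFun a‖ = ‖a‖ := by
  refine (hasSum_norm_entry (conjFun a)).unique ?_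
  simp only [entry_conjFun]
  exact hasSum_norm_conj a

/-- Conjugation as an additive map. -/
noncomputable def conjAdd : Wiener ι s →+ Wiener ι s :=
  AddMonoidHom.mk' conjFun fun a b => ext_entry fun k => by
    simp only [entry_conjFun, entry_add, star_add]

theorem continuous_conjAdd : Continuous (conjAdd : Wiener ι s →+ Wiener ι s) :=
  AddMonoidHomClass.continuous_of_bound conjAdd 1 fun a => by
    rw [one_mul]; exact (norm_conjFun a).le

theorem conjAdd_smul_unit (c : ℂ) (k) :
    conjAdd (c • unit k : Wiener ι s) = star c • unit (-k) := by
  classical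
  refine ext_entry fun l => ?_
  change entry (conjFun _) l = _
  rw [entry_conjFun, entry_smul, entry_smul, entry_unit, entry_unit]
  simp only [neg_eq_iff_eq_neg]
  split_ifs <;> simp

theorem conjAdd_mul (a b : Wiener ι s) : conjAdd (a * b) = conjAdd a * conjAdd b := by
  refine eq_of_unit (conjAdd.comp (AddMonoidHom.mulRight b))
    ((AddMonoidHom.mulRight (conjAdd b)).comp conjAdd)
    (continuous_conjAdd.comp (continuous_mul_const b))
    ((continuous_mul_const _).comp continuous_conjAdd) (fun k c => ?_) a
  refine eq_of_unit (conjAdd.comp (AddMonoidHom.mulLeft (c • unit k)))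
    ((AddMonoidHom.mulLeft (conjAdd (c • unit k))).comp conjAdd)
    (continuous_conjAdd.comp (continuous_const_mul _))
    ((continuous_const_mul _).comp continuous_conjAdd) (fun l d => ?_) b
  simp only [AddMonoidHom.comp_apply, AddMonoidHom.coe_mulLeft, conjAdd_smul_unit,
    smul_mul_smul_comm]
  change conjAdd ((c * d) • mulL (unit k) (unit l)) = _ • mulL _ _
  rw [mulL_unit, mulL_unit, smul_smul, smul_smul, conjAdd_smul_unit, ← neg_add, wt_neg, wt_neg,
    wt_neg]
  congr 1
  simp

/-- Conjugation as a homomorphism of real algebras. -/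
noncomputable def conjA : Wiener ι s →ₐ[ℝ] Wiener ι s where
  toFun := conjFun
  map_one' := by
    have := conjAdd_smul_unit (s := s) 1 (0 : ι → ℤ)
    rw [one_smul, star_one, one_smul, neg_zero] at this
    exact this
  map_mul' := conjAdd_mul
  map_zero' := map_zero conjAdd
  map_add' := map_add conjAdd
  commutes' := fun r => by
    have := conjAdd_smul_unit (s := s) (r : ℂ) (0 : ι → ℤ)
    rw [neg_zero, Complex.star_def, Complex.conj_ofReal] at this
    exact this

theorem evL_conj (x : ι → ℝ) (a : Wiener ι s) : evL x (conjA a) = star (evL x a) := by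
  refine eq_of_unit ((evL x).toLinearMap.toAddMonoidHom.comp conjAdd)
    ((starAddEquiv (R := ℂ) : ℂ →+ ℂ).comp (evL x).toLinearMap.toAddMonoidHom)
    ((evL x).continuous.comp continuous_conjAdd)
    (continuous_star.comp (evL x).continuous) (fun k c => ?_) a
  simp only [AddMonoidHom.comp_apply, conjAdd_smul_unit]
  change evL x (star c • unit (-k)) = star (evL x (c • unit k))
  rw [map_smul, map_smul, evL_unit, evL_unit, chr_neg, wt_neg]
  simp

theorem mult_conj (m : (ι → ℤ) → ℂ) (C : ℝ) (hm : ∀ k, ‖m k‖ ≤ C)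
    (hr : ∀ k, m (-k) = star (m k)) (a : Wiener ι s) :
    mult m C hm (conjA a) = conjA (mult m C hm a) := by
  refine eq_of_unit ((mult m C hm).toLinearMap.toAddMonoidHom.comp conjAdd)
    (conjAdd.comp (mult m C hm).toLinearMap.toAddMonoidHom)
    ((mult m C hm).continuous.comp continuous_conjAdd)
    (continuous_conjAdd.comp (mult m C hm).continuous) (fun k c => ?_) a
  simp only [AddMonoidHom.comp_apply, conjAdd_smul_unit]
  change mult m C hm (star c • unit (-k)) = conjAdd (mult m C hm (c • unit k))
  rw [map_smul, map_smul, mult_unit, mult_unit, smul_smul, smul_smul, conjAdd_smul_unit, hr,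
    star_mul']

theorem nsq_neg (k : ι → ℤ) : nsq (-k) = nsq k := by simp [nsq]

theorem symR_neg (k : ι → ℤ) : symR (-k) = star (symR k) := by
  rw [symR, symR, nsq_neg, Complex.star_def, map_neg, Complex.conj_ofReal]

omit [Fintype ι] in
theorem symD_neg (k : ι → ℤ) (j : ι) : symD (-k) j = star (symD k j) := by
  simp [symD]

variable (ι s) in
/-- The real Wiener algebra: elements representing real-valued functions. -/
noncomputable def realSub : Subalgebra ℝ (Wiener ι s) :=
  AlgHom.equalizer conjA (AlgHom.id ℝ _)

theorem mem_realSub {a : Wiener ι s} : a ∈ realSub ι s ↔ conjA a = a := Iff.rfl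

theorem isClosed_realSub : IsClosed (realSub ι s : Set (Wiener ι s)) :=
  isClosed_eq continuous_conjAdd continuous_id

instance : CompleteSpace (realSub ι s) := isClosed_realSub.completeSpace_coe


/-- A bounded multiplier with Hermitian symbol, on the real Wiener algebra. -/
noncomputable def multReal (m : (ι → ℤ) → ℂ) (C : ℝ) (hm : ∀ k, ‖m k‖ ≤ C)
    (hr : ∀ k, m (-k) = star (m k)) : realSub ι s →L[ℝ] realSub ι s :=
  ((mult m C hm).restrictScalars ℝ |>.comp (realSub ι s).toSubmodule.subtypeL).codRestrict
    (realSub ι s).toSubmodule (fun a => by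
      rw [Subalgebra.mem_toSubmodule, mem_realSub]
      change conjA (mult m C hm (a : Wiener ι s)) = mult m C hm a
      rw [← mult_conj m C hm hr, mem_realSub.1 a.2])

/-- Evaluation on the real Wiener algebra. -/
noncomputable def evR (x : ι → ℝ) : realSub ι s →ₐ[ℝ] ℝ where
  toFun := fun a => (evL x (a : Wiener ι s)).re
  map_one' := by rw [OneMemClass.coe_one, evL_one, Complex.one_re]
  map_zero' := by simp
  map_add' := fun a b => by simp
  map_mul' := fun a b => by
    have h : ∀ a : realSub ι s, (evL x (a : Wiener ι s)).im = 0 := fun a => by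
      have := evL_conj x (a : Wiener ι s)
      rw [mem_realSub.1 a.2] at this
      exact Complex.conj_eq_iff_im.1 this.symm
    rw [MulMemClass.coe_mul, evL_mul, Complex.mul_re, h a, h b]; simp
  commutes' := fun r => by
    change (evL x ((r : ℂ) • (1 : Wiener ι s))).re = r
    rw [map_smul, evL_one]; simp

theorem continuous_evR (x : ι → ℝ) : Continuous (evR x : realSub ι s → ℝ) :=
  Complex.continuous_re.comp ((evL x).continuous.comp continuous_subtype_val)

end Wiener
end NN

namespace NN
open scoped BigOperators Topology ContDiff
namespace Wiener
variable {ι : Type*} [Fintype ι] {s : ℕ}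

/-- The phase of a character as a continuous linear functional. -/
noncomputable def phase (k : ι → ℤ) : (ι → ℝ) →L[ℝ] ℝ :=
  ∑ j, (2 * Real.pi * k j) • ContinuousLinearMap.proj (R := ℝ) (φ := fun _ : ι => ℝ) j

theorem chr_eq (k : ι → ℤ) (x : ι → ℝ) : chr k x = Complex.exp (phase k x * Complex.I) := by
  unfold chr phase
  congr 1
  simp only [_root_.sum_apply, _root_.smul_apply, ContinuousLinearMap.proj_apply, smul_eq_mul]
  push_cast
  rw [Finset.mul_sum, Finset.sum_mul]
  refine Finset.sum_congr rfl fun j _ => ?_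
  ring

theorem norm_phase_le (k : ι → ℤ) : ‖phase k‖ ≤ (2 * Real.pi * Fintype.card ι) * ‖k‖ := by
  refine ContinuousLinearMap.opNorm_le_bound _ (by positivity) fun x => ?_
  simp only [phase, _root_.sum_apply, _root_.smul_apply, ContinuousLinearMap.proj_apply]
  refine (norm_sum_le _ _).trans ?_
  calc ∑ j, ‖(2 * Real.pi * (k j : ℝ)) • x j‖ ≤ ∑ _j : ι, 2 * Real.pi * ‖k‖ * ‖x‖ := by
        refine Finset.sum_le_sum fun j _ => ?_
        rw [norm_smul, norm_mul, norm_mul, Real.norm_eq_abs Real.pi, abs_of_pos Real.pi_pos]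
        have h1 : ‖(k j : ℝ)‖ ≤ ‖k‖ := by
          have := norm_le_pi_norm k j
          rwa [← Int.norm_cast_real] at this
        have h2 := norm_le_pi_norm x j
        have h3 : ‖(2 : ℝ)‖ = 2 := by simp
        rw [h3]
        gcongr
    _ = _ := by rw [Finset.sum_const, Finset.card_univ, nsmul_eq_mul]; ring

theorem hasFDerivAt_chr (k : ι → ℤ) (x : ι → ℝ) :
    HasFDerivAt (chr k) (∑ j, (symD k j * chr k x) •
      (Complex.ofRealCLM.comp (ContinuousLinearMap.proj (R := ℝ) (φ := fun _ : ι => ℝ) j))) x := by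
  have h1 : HasFDerivAt (fun y => (phase k y : ℂ) * Complex.I)
      (Complex.I • Complex.ofRealCLM.comp (phase k)) x := by
    have := (Complex.ofRealCLM.comp (phase k)).hasFDerivAt (x := x)
    exact this.mul_const' Complex.I |>.congr_fderiv (by ext v; simp)
  have h2 := h1.cexp
  have h3 : chr k = fun y => Complex.exp (phase k y * Complex.I) := funext (chr_eq k)
  rw [← h3, ← chr_eq] at h2
  refine h2.congr_fderiv ?_
  ext v
  simp only [_root_.smul_apply, _root_.sum_apply, ContinuousLinearMap.comp_apply,
    ContinuousLinearMap.proj_apply, Complex.ofRealCLM_apply, phase, smul_eq_mul, symD]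
  push_cast
  simp only [Finset.mul_sum]
  refine Finset.sum_congr rfl fun j _ => ?_
  ring

theorem contDiff_chr (k : ι → ℤ) {n : WithTop ℕ∞} : ContDiff ℝ n (chr k) := by
  have h3 : chr k = fun y => Complex.exp (phase k y * Complex.I) := funext (chr_eq k)
  rw [h3]
  exact ((Complex.ofRealCLM.contDiff.comp (phase k).contDiff).mul contDiff_const).cexp

theorem norm_iteratedFDeriv_chr_le (k : ι → ℤ) (n : ℕ) (x : ι → ℝ) :
    ‖iteratedFDeriv ℝ n (chr k) x‖ ≤ (2 * Real.pi * Fintype.card ι) ^ n * ‖k‖ ^ n := by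
  let e : ℝ → ℂ := fun t => Complex.exp (t * Complex.I)
  have he : ContDiff ℝ ∞ e := (Complex.ofRealCLM.contDiff.mul contDiff_const).cexp
  have h3 : chr k = e ∘ phase k := funext (chr_eq k)
  have hd : ∀ n, iteratedDeriv n e = fun t => Complex.I ^ n * e t := by
    intro n
    induction n with
    | zero => simp
    | succ n ih =>
      rw [iteratedDeriv_succ, ih]
      funext t
      have h0 : HasDerivAt e (Complex.I * e t) t := by
        have := ((Complex.ofRealCLM.hasDerivAt (x := t)).mul_const Complex.I).cexp
        refine this.congr_deriv ?_
        rw [Complex.ofRealCLM_apply, Complex.ofRealCLM_apply, Complex.ofReal_one]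
        ring
      rw [(h0.const_mul _).deriv]
      ring
  rw [h3, ContinuousLinearMap.iteratedFDeriv_comp_right (phase k) he x (by exact_mod_cast le_top)]
  refine (ContinuousMultilinearMap.norm_compContinuousLinearMap_le _ _).trans ?_
  rw [norm_iteratedFDeriv_eq_norm_iteratedDeriv, hd, norm_mul, norm_pow, Complex.norm_I, one_pow,
    one_mul, Complex.norm_exp_ofReal_mul_I, one_mul, Finset.prod_const, Finset.card_univ,
    Fintype.card_fin, ← mul_pow]
  gcongr
  exact norm_phase_le k

theorem norm_coef_mul_wt (a : Wiener ι s) (k) : ‖coef a k‖ * wt s k = ‖entry a k‖ := by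
  rw [coef, norm_div, Complex.norm_real, Real.norm_eq_abs, abs_of_pos (wt_pos s k),
    div_mul_cancel₀ _ (wt_pos s k).ne']

theorem contDiff_evL (a : Wiener ι s) : ContDiff ℝ s (fun x => evL x a) := by
  have h : (fun x => evL x a) = fun x => ∑' k, coef a k * chr k x :=
    funext fun x => (hasSum_evL x a).tsum_eq.symm
  rw [h]
  refine contDiff_tsum (v := fun n k => (2 * Real.pi * Fintype.card ι) ^ n * ‖entry a k‖)
    (fun k => contDiff_const.mul (contDiff_chr k))
    (fun n _ => (hasSum_norm_entry a).summable.mul_left _) (fun n k x hn => ?_)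
  have hn' : n ≤ s := by exact_mod_cast hn
  have : iteratedFDeriv ℝ n (fun x => coef a k * chr k x) x
      = coef a k • iteratedFDeriv ℝ n (chr k) x :=
    iteratedFDeriv_const_smul_apply' (a := coef a k) (contDiff_chr k).contDiffAt
  rw [this, norm_smul, ← norm_coef_mul_wt]
  calc ‖coef a k‖ * ‖iteratedFDeriv ℝ n (chr k) x‖
      ≤ ‖coef a k‖ * ((2 * Real.pi * Fintype.card ι) ^ n * ‖k‖ ^ n) := by
        gcongr; exact norm_iteratedFDeriv_chr_le k n x
    _ ≤ ‖coef a k‖ * ((2 * Real.pi * Fintype.card ι) ^ n * wt s k) := by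
        gcongr
        calc ‖k‖ ^ n ≤ (1 + ‖k‖) ^ n := by gcongr; linarith
          _ ≤ (1 + ‖k‖) ^ s := pow_le_pow_right₀ (by linarith [norm_nonneg k]) hn'
    _ = _ := by ring

theorem continuous_evL (a : Wiener ι s) : Continuous (fun x => evL x a) :=
  (contDiff_evL a).continuous

/-- If multiplying the symbol `m` by the symbols of the first derivatives gives bounded symbols,
then the corresponding function is differentiable. -/
theorem hasFDerivAt_evL_mult (m : (ι → ℤ) → ℂ) (C : ℝ) (hm : ∀ k, ‖m k‖ ≤ C)
    (m' : ι → (ι → ℤ) → ℂ) (C' : ℝ) (hm' : ∀ i k, ‖m' i k‖ ≤ C')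
    (h : ∀ i k, m' i k = symD k i * m k) (a : Wiener ι s) (x : ι → ℝ) :
    HasFDerivAt (fun y => evL y (mult m C hm a))
      (∑ i, (evL x (mult (m' i) C' (hm' i) a)) •
      (Complex.ofRealCLM.comp (ContinuousLinearMap.proj (R := ℝ) (φ := fun _ : ι => ℝ) i))) x := by
  classical
  have h0 : (fun x => evL x (mult m C hm a)) = fun x => ∑' k, m k * coef a k * chr k x :=
    funext fun x => by
      rw [← (hasSum_evL x _).tsum_eq]
      simp only [coef_mult]
  have hC' : ∀ i : ι, 0 ≤ C' := fun i => (norm_nonneg _).trans (hm' i 0)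
  have hcoef : ∀ k, ‖coef a k‖ ≤ ‖entry a k‖ := fun k => by
    rw [← norm_coef_mul_wt]
    exact le_mul_of_one_le_right (norm_nonneg _) (one_le_wt s k)
  rw [h0]
  let P : ι → (ι → ℝ) →L[ℝ] ℂ := fun i =>
    Complex.ofRealCLM.comp (ContinuousLinearMap.proj (R := ℝ) (φ := fun _ : ι => ℝ) i)
  let f' : (ι → ℤ) → (ι → ℝ) → ((ι → ℝ) →L[ℝ] ℂ) := fun k y =>
    ∑ i, (m' i k * coef a k * chr k y) • P i
  have hP : ∀ i, ‖P i‖ ≤ 1 := fun i => by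
    refine ContinuousLinearMap.opNorm_le_bound _ zero_le_one fun v => ?_
    simp only [P, ContinuousLinearMap.comp_apply, ContinuousLinearMap.proj_apply,
      Complex.ofRealCLM_apply, Complex.norm_real, one_mul]
    exact norm_le_pi_norm v i
  have hbound : ∀ k y, ‖f' k y‖ ≤ (Fintype.card ι * C') * ‖entry a k‖ := by
    intro k y
    refine (norm_sum_le _ _).trans ?_
    calc _ ≤ ∑ _i : ι, C' * ‖entry a k‖ := by
          refine Finset.sum_le_sum fun i _ => ?_
          rw [norm_smul, norm_mul, norm_mul, norm_chr, mul_one]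
          calc _ ≤ C' * ‖entry a k‖ * 1 := by
                gcongr
                · exact mul_nonneg (hC' i) (norm_nonneg _)
                · exact hC' i
                · exact hm' i k
                · exact hcoef k
                · exact hP i
            _ = _ := mul_one _
      _ = _ := by rw [Finset.sum_const, Finset.card_univ, nsmul_eq_mul]; ring
  have hsum : Summable fun k => (Fintype.card ι * C') * ‖entry a k‖ :=
    (hasSum_norm_entry a).summable.mul_left _
  have key := hasFDerivAt_tsum (𝕜 := ℝ) (f := fun k y => m k * coef a k * chr k y) (f' := f')
    hsum (fun k y => ?_) hbound (x₀ := 0) ?_ x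
  · refine key.congr_fderiv ?_
    have hs : ∀ i, HasSum (fun k => (m' i k * coef a k * chr k x) • P i)
        (evL x (mult (m' i) C' (hm' i) a) • P i) := fun i => by
      have := (hasSum_evL x (mult (m' i) C' (hm' i) a)).smul_const (P i)
      simpa only [coef_mult] using this
    exact (hasSum_sum fun i _ => hs i).tsum_eq
  · have := (hasFDerivAt_chr k y).const_mul (m k * coef a k)
    refine this.congr_fderiv ?_
    simp only [f', Finset.smul_sum, smul_smul, h, P]
    refine Finset.sum_congr rfl fun i _ => ?_
    congr 1
    ring
  · have := (hasSum_evL 0 (mult m C hm a)).summable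
    simpa only [coef_mult] using this

theorem hasFDerivAt_evL_R (a : Wiener ι s) (x : ι → ℝ) :
    HasFDerivAt (fun y => evL y (R a)) (∑ i, (evL x (R1 i a)) •
      (Complex.ofRealCLM.comp (ContinuousLinearMap.proj (R := ℝ) (φ := fun _ : ι => ℝ) i))) x :=
  hasFDerivAt_evL_mult _ _ _ _ _ _ (fun _ _ => rfl) a x

theorem hasFDerivAt_evL_R1 (j : ι) (a : Wiener ι s) (x : ι → ℝ) :
    HasFDerivAt (fun y => evL y (R1 j a)) (∑ i, (evL x (R2 i j a)) •
      (Complex.ofRealCLM.comp (ContinuousLinearMap.proj (R := ℝ) (φ := fun _ : ι => ℝ) i))) x :=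
  hasFDerivAt_evL_mult _ _ _ _ _ _ (fun _ _ => rfl) a x

end Wiener
end NN

namespace NN
open scoped BigOperators Topology ContDiff
namespace Wiener
variable {ι : Type*} [Fintype ι] {s : ℕ}

open MeasureTheory

theorem summable_wt_inv (m : ℕ) (hm : Fintype.card ι < m) :
    Summable fun k : ι → ℤ => (wt m k)⁻¹ := by
  classical
  let b := Pi.basisFun ℝ ι
  let L := Submodule.span ℤ (Set.range b)
  have hfin : Module.finrank ℤ L < m := by
    rw [Module.finrank_eq_card_basis (b.restrictScalars ℤ)]; exact hm
  have h1 := ZLattice.summable_norm_pow_inv L m hfin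
  let e : (ι → ℤ) ≃ L := (b.restrictScalars ℤ).equivFun.toEquiv.symm
  have he : ∀ k, ‖e k‖ = ‖k‖ := fun k => by
    have h2 : ((e k : L) : ι → ℝ) = fun j => (k j : ℝ) := by
      change (((b.restrictScalars ℤ).equivFun.symm k : L) : ι → ℝ) = _
      rw [Module.Basis.equivFun_symm_apply]
      funext j
      simp [b, Finset.sum_apply, Pi.single_apply]
    change ‖((e k : L) : ι → ℝ)‖ = _
    rw [h2, Pi.norm_def, Pi.norm_def]
    have h3 : ∀ b, ‖((k b : ℤ) : ℝ)‖₊ = ‖k b‖₊ := fun b => NNReal.eq (Int.norm_cast_real _)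
    simp only [h3]
  have h3 : Summable fun k : ι → ℤ => ‖k‖⁻¹ ^ m := by
    have := (e.summable_iff).2 h1
    refine this.congr fun k => ?_
    simp only [Function.comp_apply, he]
  have h4 : Summable fun k : ι → ℤ => ‖k‖⁻¹ ^ m + (if k = 0 then 1 else 0 : ℝ) :=
    h3.add (summable_of_hasFiniteSupport ((Set.finite_singleton (0 : ι → ℤ)).subset fun k hk => by
      by_contra h; exact hk (if_neg h)))
  refine Summable.of_nonneg_of_le (fun k => by have := wt_pos m k; positivity) (fun k => ?_) h4
  by_cases hk : k = 0
  · rw [hk, wt_zero, if_pos rfl, inv_one]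
    have : (0 : ℝ) ≤ ‖(0 : ι → ℤ)‖⁻¹ ^ m := by positivity
    linarith
  · rw [if_neg hk, add_zero, wt, inv_pow]
    have : 0 < ‖k‖ := norm_pos_iff.2 hk
    gcongr
    linarith

/-- Directional derivative along a coordinate vector. -/
noncomputable def dx [DecidableEq ι] {F : Type*} [NormedAddCommGroup F] [NormedSpace ℝ F] (j : ι)
    (φ : (ι → ℝ) → F) : (ι → ℝ) → F :=
  fun x => fderiv ℝ φ x (Pi.single j 1)

/-- Functions supported in the closed cube of half-side `1/3`. -/
def CS {F : Type*} [Zero F] (φ : (ι → ℝ) → F) : Prop := ∀ x, 1 / 3 < ‖x‖ → φ x = 0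

section
variable {F : Type*} [NormedAddCommGroup F] [NormedSpace ℝ F]

omit [NormedSpace ℝ F] in
theorem CS.hasCompactSupport {φ : (ι → ℝ) → F} (h : CS φ) : HasCompactSupport φ :=
  HasCompactSupport.of_support_subset_isCompact (isCompact_closedBall 0 (1 / 3)) fun x hx => by
    rw [mem_closedBall_zero_iff]
    by_contra hc
    exact hx (h x (not_le.1 hc))

theorem CS.dx [DecidableEq ι] {φ : (ι → ℝ) → F} (h : CS φ) (j : ι) : CS (dx j φ) := fun x hx => by
  have h1 : φ =ᶠ[𝓝 x] fun _ => 0 := by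
    filter_upwards [(isOpen_lt continuous_const continuous_norm).mem_nhds hx] with y hy
    exact h y hy
  rw [Wiener.dx, h1.fderiv_eq, fderiv_fun_const]; rfl

theorem CS.dx_iterate [DecidableEq ι] {φ : (ι → ℝ) → F} (h : CS φ) (j : ι) (m : ℕ) :
    CS ((Wiener.dx j)^[m] φ) := by
  induction m with
  | zero => exact h
  | succ m ih => rw [Function.iterate_succ_apply']; exact ih.dx j

theorem contDiff_dx [DecidableEq ι] {φ : (ι → ℝ) → F} {m : ℕ} (h : ContDiff ℝ (m + 1 : ℕ) φ)
    (j : ι) : ContDiff ℝ m (dx j φ) :=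
  (h.fderiv_right (m := m) (by norm_cast)).clm_apply contDiff_const

theorem contDiff_dx_iterate [DecidableEq ι] {φ : (ι → ℝ) → F} {m n : ℕ}
    (h : ContDiff ℝ (m + n : ℕ) φ) (j : ι) : ContDiff ℝ m ((dx j)^[n] φ) := by
  induction n generalizing φ with
  | zero => exact h
  | succ n ih => rw [Function.iterate_succ_apply]; exact ih (contDiff_dx h j)
end

/-- Fourier coefficients of a function on `ℝ^n`. -/
noncomputable def fc (φ : (ι → ℝ) → ℂ) (k : ι → ℤ) : ℂ := ∫ x, chr (-k) x * φ x

theorem continuous_chr (k : ι → ℤ) : Continuous (chr k) := (contDiff_chr k (n := 0)).continuous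

theorem integrable_chr_mul {φ : (ι → ℝ) → ℂ} (hφ : Continuous φ) (hs : CS φ) (k : ι → ℤ) :
    Integrable fun x => chr k x * φ x :=
  ((continuous_chr k).mul hφ).integrable_of_hasCompactSupport hs.hasCompactSupport.mul_left

theorem dx_chr [DecidableEq ι] (k : ι → ℤ) (j : ι) (x : ι → ℝ) :
    dx j (chr k) x = symD k j * chr k x := by
  rw [dx, (hasFDerivAt_chr k x).fderiv, _root_.sum_apply, Finset.sum_eq_single j]
  · simp
  · intro i _ hi; simp [hi]
  · simp

theorem fc_dx [DecidableEq ι] {φ : (ι → ℝ) → ℂ} (hφ : ContDiff ℝ 1 φ) (hs : CS φ) (j : ι)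
    (k : ι → ℤ) : fc (dx j φ) k = symD k j * fc φ k := by
  have hc : Continuous (dx j φ) := (contDiff_dx (m := 0) hφ j).continuous
  have h1 : ∀ x, fderiv ℝ (chr (-k)) x (Pi.single j 1) = -symD k j * chr (-k) x := fun x => by
    have := dx_chr (-k) j x
    rw [dx] at this
    rw [this, symD, symD]; simp
  have := integral_mul_fderiv_eq_neg_fderiv_mul_of_integrable (μ := volume) (f := chr (-k)) (g := φ)
    (v := Pi.single j 1)
    (by simp only [h1, mul_assoc]; exact (integrable_chr_mul hφ.continuous hs _).const_mul _)
    (integrable_chr_mul hc (hs.dx j) _) (integrable_chr_mul hφ.continuous hs _)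
    (fun x _ => (contDiff_chr (-k) (n := 1)).differentiable one_ne_zero x)
    (fun x _ => hφ.differentiable one_ne_zero x)
  unfold fc
  change ∫ x, chr (-k) x * dx j φ x = _ at this
  rw [this]
  simp only [h1, mul_assoc, neg_mul]
  rw [integral_neg, neg_neg, integral_const_mul]

theorem fc_dx_iterate [DecidableEq ι] {φ : (ι → ℝ) → ℂ} {m : ℕ} (hφ : ContDiff ℝ m φ) (hs : CS φ)
    (j : ι) (k : ι → ℤ) : fc ((dx j)^[m] φ) k = symD k j ^ m * fc φ k := by
  induction m with
  | zero => simp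
  | succ m ih =>
    rw [Function.iterate_succ_apply', fc_dx, ih, pow_succ']
    · ring
    · exact hφ.of_le (by norm_cast; omega)
    · exact contDiff_dx_iterate (m := 1) (by rwa [add_comm]) j
    · exact hs.dx_iterate j m

/-- The half-open unit cube centred at the origin. -/
def cube (ι : Type*) : Set (ι → ℝ) := {x | ∀ i, x i ∈ Set.Ioc (-(1 / 2) : ℝ) (-(1 / 2) + 1)}

omit [Fintype ι] in
theorem cube_eq : cube ι = Set.univ.pi fun _ => Set.Ioc (-(1 / 2) : ℝ) (-(1 / 2) + 1) := by
  ext x; simp [cube]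

theorem measurableSet_cube : MeasurableSet (cube ι) := by
  rw [cube_eq]; exact MeasurableSet.univ_pi fun _ => measurableSet_Ioc

theorem volume_cube : volume (cube ι) = 1 := by
  rw [cube_eq, volume_pi_pi]; simp [Real.volume_Ioc]

theorem mem_cube {x : ι → ℝ} (hx : ‖x‖ < 1 / 2) : x ∈ cube ι := fun i => by
  have := (norm_le_pi_norm x i).trans_lt hx
  rw [Real.norm_eq_abs, abs_lt] at this
  exact ⟨this.1, by linarith [this.2]⟩

theorem fc_eq {φ : (ι → ℝ) → ℂ} (hs : CS φ) (k : ι → ℤ) :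
    fc φ k = ∫ x in cube ι, chr (-k) x * φ x := by
  refine (setIntegral_eq_integral_of_forall_compl_eq_zero fun x hx => ?_).symm
  rw [hs x, mul_zero]
  by_contra h
  exact hx (mem_cube (by linarith))

theorem norm_fc_le {φ : (ι → ℝ) → ℂ} (hs : CS φ) {B : ℝ} (hB : ∀ x, ‖φ x‖ ≤ B) (k : ι → ℤ) :
    ‖fc φ k‖ ≤ B := by
  rw [fc_eq hs]
  refine (norm_setIntegral_le_of_norm_le_const (C := B) ?_ fun x _ => ?_).trans ?_
  · rw [volume_cube]; exact ENNReal.one_lt_top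
  · rw [norm_mul, norm_chr, one_mul]; exact hB x
  · rw [measureReal_def, volume_cube]; simp

theorem wt_mul_norm_fc_le [DecidableEq ι] {φ : (ι → ℝ) → ℂ} {m : ℕ} (hφ : ContDiff ℝ m φ)
    (hs : CS φ) {B : ℝ} (hB : ∀ x, ‖φ x‖ ≤ B) (hB' : ∀ j x, ‖(dx j)^[m] φ x‖ ≤ B) (k : ι → ℤ) :
    wt m k * ‖fc φ k‖ ≤ 2 ^ m * B := by
  have hB0 : 0 ≤ B := (norm_nonneg _).trans (hB 0)
  have h1 := norm_fc_le hs hB k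
  by_cases hk : ‖k‖ ≤ 1
  · unfold wt
    gcongr
    linarith
  · push Not at hk
    obtain ⟨j, hj⟩ : ∃ j, ‖k‖ = ‖k j‖ := by
      have : Nonempty ι := by
        by_contra h
        rw [not_nonempty_iff] at h
        have : k = 0 := Subsingleton.elim _ _
        rw [this, norm_zero] at hk; linarith
      obtain ⟨j, hj⟩ := Finite.exists_max fun j => ‖k j‖
      exact ⟨j, le_antisymm ((pi_norm_le_iff_of_nonneg (norm_nonneg _)).2 hj) (norm_le_pi_norm k j)⟩
    have h2 := norm_fc_le (hs.dx_iterate j m) (hB' j) k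
    rw [fc_dx_iterate hφ hs, norm_mul, norm_pow, norm_symD, Int.cast_abs] at h2
    have h3 : 1 + ‖k‖ ≤ 2 * (2 * Real.pi * |(k j : ℝ)|) := by
      have h4 : |(k j : ℝ)| = ‖k‖ := by rw [hj, ← Int.norm_cast_real, Real.norm_eq_abs]
      rw [h4]
      nlinarith [Real.pi_gt_three]
    calc wt m k * ‖fc φ k‖ ≤ (2 * (2 * Real.pi * |(k j : ℝ)|)) ^ m * ‖fc φ k‖ := by
          unfold wt; gcongr
      _ = 2 ^ m * ((2 * Real.pi * |(k j : ℝ)|) ^ m * ‖fc φ k‖) := by rw [mul_pow]; ring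
      _ ≤ _ := by gcongr

/-- Order of differentiability ensuring membership in the Wiener algebra of weight `s`. -/
def ord (ι : Type*) [Fintype ι] (s : ℕ) : ℕ := s + (Fintype.card ι + 1)

theorem wt_fc_le [DecidableEq ι] {φ : (ι → ℝ) → ℂ} (hφ : ContDiff ℝ (ord ι s) φ)
    (hs : CS φ) {B : ℝ} (hB : ∀ x, ‖φ x‖ ≤ B) (hB' : ∀ j x, ‖(dx j)^[ord ι s] φ x‖ ≤ B)
    (k : ι → ℤ) :
    wt s k * ‖fc φ k‖ ≤ 2 ^ ord ι s * B * (wt (Fintype.card ι + 1) k)⁻¹ := by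
  have h := wt_mul_norm_fc_le hφ hs hB hB' k
  have h1 : wt (ord ι s) k = wt s k * wt (Fintype.card ι + 1) k := by
    unfold wt ord; rw [pow_add]
  have h2 := wt_pos (Fintype.card ι + 1) k
  rw [h1] at h
  rw [← div_eq_mul_inv, le_div_iff₀ h2]
  linarith

theorem exists_bound [DecidableEq ι] {φ : (ι → ℝ) → ℂ} {m : ℕ} (hφ : ContDiff ℝ m φ) (hs : CS φ) :
    ∃ B, (∀ x, ‖φ x‖ ≤ B) ∧ ∀ j x, ‖(dx j)^[m] φ x‖ ≤ B := by
  have h1 : ∀ f : (ι → ℝ) → ℂ, Continuous f → CS f → ∃ B, ∀ x, ‖f x‖ ≤ B := fun f hf hs => by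
    obtain ⟨B, hB⟩ := hs.hasCompactSupport.exists_bound_of_continuous hf
    exact ⟨B, hB⟩
  obtain ⟨B, hB⟩ := h1 φ hφ.continuous hs
  have h2 : ∀ j, ∃ B, ∀ x, ‖(dx j)^[m] φ x‖ ≤ B := fun j =>
    h1 _ (contDiff_dx_iterate (m := 0) (by rwa [zero_add]) j).continuous (hs.dx_iterate j m)
  choose B' hB' using h2
  have h0 : 0 ≤ B := (norm_nonneg _).trans (hB 0)
  have h0' : ∀ j, 0 ≤ B' j := fun j => (norm_nonneg _).trans (hB' j 0)
  refine ⟨B + ∑ j, B' j, fun x => (hB x).trans ?_, fun j x => (hB' j x).trans ?_⟩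
  · have := Finset.sum_nonneg fun j (_ : j ∈ Finset.univ) => h0' j
    linarith
  · have := Finset.single_le_sum (f := B') (fun j _ => h0' j) (Finset.mem_univ j)
    linarith

/-- Functions with enough derivatives and small support are represented in the Wiener algebra. -/
theorem exists_coef_fc {φ : (ι → ℝ) → ℂ} (hφ : ContDiff ℝ (ord ι s) φ) (hs : CS φ) :
    ∃ a : Wiener ι s, ∀ k, coef a k = fc φ k := by
  classical
  obtain ⟨B, hB, hB'⟩ := exists_bound hφ hs
  obtain ⟨a, ha, -⟩ := exists_coef (s := s) (fc φ) (Summable.of_nonneg_of_le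
    (fun k => mul_nonneg (wt_pos s k).le (norm_nonneg _)) (wt_fc_le hφ hs hB hB')
    ((summable_wt_inv _ (Nat.lt_succ_self _)).mul_left _))
  exact ⟨a, ha⟩

theorem norm_le_of_coef_fc [DecidableEq ι] {φ : (ι → ℝ) → ℂ} (hφ : ContDiff ℝ (ord ι s) φ)
    (hs : CS φ) {B : ℝ} (hB : ∀ x, ‖φ x‖ ≤ B) (hB' : ∀ j x, ‖(dx j)^[ord ι s] φ x‖ ≤ B)
    {a : Wiener ι s} (ha : ∀ k, coef a k = fc φ k) :
    ‖a‖ ≤ 2 ^ ord ι s * B * ∑' k : ι → ℤ, (wt (Fintype.card ι + 1) k)⁻¹ := by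
  have hsum := (summable_wt_inv (ι := ι) _ (Nat.lt_succ_self _)).mul_left (2 ^ ord ι s * B)
  obtain ⟨b, hb, hbn⟩ := exists_coef (s := s) (fc φ) (Summable.of_nonneg_of_le
    (fun k => mul_nonneg (wt_pos s k).le (norm_nonneg _)) (wt_fc_le hφ hs hB hB') hsum)
  have : a = b := ext_coef fun k => by rw [ha, hb]
  rw [this, hbn, ← tsum_mul_left]
  exact (Summable.of_nonneg_of_le
    (fun k => mul_nonneg (wt_pos s k).le (norm_nonneg _)) (wt_fc_le hφ hs hB hB') hsum).tsum_le_tsum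
    (wt_fc_le hφ hs hB hB') hsum

end Wiener
end NN

namespace NN
open scoped BigOperators Topology ContDiff
namespace Wiener
variable {ι : Type*} [Fintype ι] {s : ℕ}

open MeasureTheory UnitAddTorus

theorem mFourier_coe (k : ι → ℤ) (x : ι → ℝ) :
    mFourier k (fun i => (x i : UnitAddCircle)) = chr k x := by
  change ∏ i, fourier (k i) (x i : UnitAddCircle) = _
  simp only [fourier_coe_apply, chr]
  rw [← Complex.exp_sum, Finset.mul_sum]
  congr 1
  refine Finset.sum_congr rfl fun j _ => ?_
  push_cast; ring

/-- Extension of a function on the unit cube to the torus. -/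
noncomputable def toTorus (φ : (ι → ℝ) → ℂ) : UnitAddTorus ι → ℂ :=
  fun t => φ fun j => (AddCircle.equivIoc (1 : ℝ) (-(1 / 2)) (t j) : ℝ)

theorem equivIoc_coe {y : ℝ} (hy : y ∈ Set.Ioc (-(1 / 2) : ℝ) (-(1 / 2) + 1)) :
    (AddCircle.equivIoc (1 : ℝ) (-(1 / 2)) (y : AddCircle (1 : ℝ)) : ℝ) = y := by
  have : AddCircle.equivIoc (1 : ℝ) (-(1 / 2)) (y : AddCircle (1 : ℝ)) = ⟨y, hy⟩ :=
    (AddCircle.equivIoc (1 : ℝ) (-(1 / 2))).right_inv ⟨y, hy⟩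
  rw [this]

theorem coe_equivIoc (t : AddCircle (1 : ℝ)) :
    ((AddCircle.equivIoc (1 : ℝ) (-(1 / 2)) t : ℝ) : AddCircle (1 : ℝ)) = t :=
  (AddCircle.equivIoc (1 : ℝ) (-(1 / 2))).left_inv t

omit [Fintype ι] in
theorem toTorus_coe (φ : (ι → ℝ) → ℂ) {x : ι → ℝ} (hx : x ∈ cube ι) :
    toTorus φ (fun i => (x i : UnitAddCircle)) = φ x := by
  unfold toTorus
  congr 1
  funext j
  exact equivIoc_coe (hx j)

theorem norm_equivIoc (t : AddCircle (1 : ℝ)) :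
    |(AddCircle.equivIoc (1 : ℝ) (-(1 / 2)) t : ℝ)| = ‖t‖ := by
  have h := (AddCircle.equivIoc (1 : ℝ) (-(1 / 2)) t).2
  conv_rhs => rw [← coe_equivIoc t]
  rw [AddCircle.norm_coe_eq_abs_iff 1 one_ne_zero |>.2]
  rw [abs_one, abs_le]
  constructor <;> linarith [h.1, h.2]

theorem continuous_toTorus {φ : (ι → ℝ) → ℂ} (hφ : Continuous φ) (hs : CS φ) :
    Continuous (toTorus φ) := by
  rw [continuous_iff_continuousAt]
  intro t
  by_cases h : ∃ j, 1 / 3 < ‖t j‖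
  · obtain ⟨j, hj⟩ := h
    have h1 : toTorus φ =ᶠ[𝓝 t] fun _ => 0 := by
      have : IsOpen {t : UnitAddTorus ι | 1 / 3 < ‖t j‖} :=
        isOpen_lt continuous_const (continuous_norm.comp (continuous_apply j))
      filter_upwards [this.mem_nhds hj] with u hu
      refine hs _ (lt_of_lt_of_le ?_ (norm_le_pi_norm _ j))
      rw [Real.norm_eq_abs, norm_equivIoc]
      exact hu
    exact continuousAt_const.congr h1.symm
  · push Not at h
    refine ContinuousAt.comp (g := φ) hφ.continuousAt ?_
    refine continuousAt_pi.2 fun j => ?_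
    have h2 : t j ≠ ((-(1 / 2) : ℝ) : AddCircle (1 : ℝ)) := fun he => by
      have h3 := h j
      rw [he, (AddCircle.norm_coe_eq_abs_iff 1 one_ne_zero).2 (by rw [abs_le, abs_one]; norm_num)] at h3
      norm_num [abs_of_pos] at h3
    have h3 := AddCircle.continuousAt_equivIoc (p := (1 : ℝ)) (a := -(1 / 2)) (x := t j) h2
    exact ContinuousAt.comp (f := fun t : UnitAddTorus ι => t j)
      (g := fun u => (AddCircle.equivIoc (1 : ℝ) (-(1 / 2)) u : ℝ))
      (continuous_subtype_val.continuousAt.comp h3) (continuous_apply j).continuousAt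

theorem mFourierCoeff_toTorus {φ : (ι → ℝ) → ℂ} (hs : CS φ) (k : ι → ℤ) :
    mFourierCoeff (toTorus φ) k = fc φ k := by
  rw [mFourierCoeff_eq_integral _ k (fun _ => -(1 / 2)), fc_eq hs]
  refine setIntegral_congr_fun measurableSet_cube fun x hx => ?_
  change mFourier (-k) (fun i => (x i : UnitAddCircle)) • toTorus φ (fun i => (x i : UnitAddCircle)) = _
  rw [mFourier_coe, toTorus_coe φ hx, smul_eq_mul]

theorem summable_coef (a : Wiener ι s) : Summable (coef a) := by
  refine Summable.of_norm_bounded (hasSum_norm_entry a).summable fun k => ?_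
  rw [← norm_coef_mul_wt]
  exact le_mul_of_one_le_right (norm_nonneg _) (one_le_wt s k)

/-- Fourier inversion. -/
theorem evL_of_coef_fc {φ : (ι → ℝ) → ℂ} (hφ : Continuous φ) (hs : CS φ) {a : Wiener ι s}
    (ha : ∀ k, coef a k = fc φ k) {x : ι → ℝ} (hx : x ∈ cube ι) : evL x a = φ x := by
  let f : C(UnitAddTorus ι, ℂ) := ⟨toTorus φ, continuous_toTorus hφ hs⟩
  have h0 : ∀ k, mFourierCoeff f k = coef a k := fun k => by
    rw [ha]; exact mFourierCoeff_toTorus hs k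
  have h1 : Summable (mFourierCoeff f) := (summable_coef a).congr fun k => (h0 k).symm
  have h2 := hasSum_mFourier_series_apply_of_summable h1 (fun i => (x i : UnitAddCircle))
  have h3 : f (fun i => (x i : UnitAddCircle)) = φ x := toTorus_coe φ hx
  rw [h3] at h2
  refine (hasSum_evL x a).unique ?_
  refine h2.congr_fun fun k => ?_
  rw [h0, mFourier_coe, smul_eq_mul]

theorem summable_coef_smul_mFourier (a : Wiener ι s) :
    Summable fun k => coef a k • (mFourier k : C(UnitAddTorus ι, ℂ)) := by
  refine Summable.of_norm ?_
  simp only [norm_smul, mFourier_norm, mul_one]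
  exact (summable_coef a).norm

/-- The function on the torus represented by an element of the Wiener algebra. -/
noncomputable def torusFun (a : Wiener ι s) : C(UnitAddTorus ι, ℂ) :=
  ∑' k, coef a k • (mFourier k : C(UnitAddTorus ι, ℂ))

theorem torusFun_coe (a : Wiener ι s) (x : ι → ℝ) :
    torusFun a (fun i => (x i : UnitAddCircle)) = evL x a := by
  have h := (ContinuousMap.evalCLM ℂ (fun i => (x i : UnitAddCircle))).hasSum
    (summable_coef_smul_mFourier a).hasSum
  refine HasSum.unique (HasSum.congr_fun h fun k => ?_) (hasSum_evL x a)
  simp [mFourier_coe]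

theorem mFourierCoeff_torusFun (a : Wiener ι s) (k : ι → ℤ) :
    mFourierCoeff (torusFun a) k = coef a k := by
  classical
  let _ : MeasureSpace UnitAddCircle := ⟨AddCircle.haarAddCircle⟩
  have _ : Measure.IsAddHaarMeasure (volume : Measure UnitAddCircle) :=
    inferInstanceAs (Measure.IsAddHaarMeasure AddCircle.haarAddCircle)
  have _ : IsProbabilityMeasure (volume : Measure UnitAddCircle) :=
    inferInstanceAs (IsProbabilityMeasure AddCircle.haarAddCircle)
  have h0 : mFourierCoeff (torusFun a) k =
      mFourierBasis.repr (ContinuousMap.toLp (E := ℂ) 2 volume ℂ (torusFun a)) k := by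
    rw [mFourierBasis_repr, mFourierCoeff_toLp]
  rw [h0, HilbertBasis.repr_apply_apply, coe_mFourierBasis]
  have h := (ContinuousMap.toLp (E := ℂ) 2 (volume : Measure (UnitAddTorus ι)) ℂ).hasSum
    (summable_coef_smul_mFourier a).hasSum
  have h1 := (innerSL ℂ (mFourierLp (d := ι) 2 k)).hasSum h
  refine HasSum.unique h1 (HasSum.congr_fun (hasSum_ite_eq k (coef a k)) fun l => ?_)
  rw [innerSL_apply_apply, map_smul, inner_smul_right, orthonormal_iff_ite.1 orthonormal_mFourier]
  by_cases hl : l = k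
  · rw [hl]; simp
  · rw [if_neg hl, if_neg (Ne.symm hl), mul_zero]

/-- Uniqueness of Fourier coefficients. -/
theorem ext_evL {a b : Wiener ι s} (h : ∀ x ∈ cube ι, evL x a = evL x b) : a = b := by
  have : torusFun a = torusFun b := by
    ext t
    have ht : t = fun i => (((AddCircle.equivIoc (1 : ℝ) (-(1 / 2)) (t i) : ℝ)) : UnitAddCircle) := by
      funext i; exact (coe_equivIoc (t i)).symm
    rw [ht, torusFun_coe, torusFun_coe]
    exact h _ fun i => (AddCircle.equivIoc (1 : ℝ) (-(1 / 2)) (t i)).2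
  exact ext_coef fun k => by rw [← mFourierCoeff_torusFun, this, mFourierCoeff_torusFun]

end Wiener
end NN

namespace NN
open scoped BigOperators Topology ContDiff
namespace Wiener
variable {ι : Type*} [Fintype ι] {s : ℕ}

open Filter

open Classical in
/-- The element of the Wiener algebra representing a function with small support. -/
noncomputable def rep (s : ℕ) (φ : (ι → ℝ) → ℂ) : Wiener ι s :=
  if h : ContDiff ℝ (ord ι s) φ ∧ CS φ then (exists_coef_fc h.1 h.2).choose else 0

theorem coef_rep {φ : (ι → ℝ) → ℂ} (hφ : ContDiff ℝ (ord ι s) φ) (hs : CS φ) (k : ι → ℤ) :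
    coef (rep s φ) k = fc φ k := by
  rw [rep, dif_pos ⟨hφ, hs⟩]
  exact (exists_coef_fc hφ hs).choose_spec k

theorem evL_rep {φ : (ι → ℝ) → ℂ} (hφ : ContDiff ℝ (ord ι s) φ) (hs : CS φ) {x : ι → ℝ}
    (hx : x ∈ cube ι) : evL x (rep s φ) = φ x :=
  evL_of_coef_fc hφ.continuous hs (coef_rep hφ hs) hx

theorem rep_mem_realSub {φ : (ι → ℝ) → ℂ} (hφ : ContDiff ℝ (ord ι s) φ) (hs : CS φ)
    (hr : ∀ x, (φ x).im = 0) : rep s φ ∈ realSub ι s := by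
  rw [mem_realSub]
  refine ext_evL fun x hx => ?_
  rw [evL_conj, evL_rep hφ hs hx]
  exact Complex.conj_eq_iff_im.2 (hr x)

/-- The Laplacian. -/
noncomputable def lap [DecidableEq ι] {F : Type*} [NormedAddCommGroup F] [NormedSpace ℝ F]
    (φ : (ι → ℝ) → F) : (ι → ℝ) → F := fun x => ∑ j, dx j (dx j φ) x

section
variable {F : Type*} [NormedAddCommGroup F] [NormedSpace ℝ F]

theorem CS.lap [DecidableEq ι] {φ : (ι → ℝ) → F} (h : CS φ) : CS (lap φ) := fun x hx =>
  Finset.sum_eq_zero fun j _ => (h.dx j).dx j x hx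

theorem contDiff_lap [DecidableEq ι] {φ : (ι → ℝ) → F} {m : ℕ} (h : ContDiff ℝ (m + 2 : ℕ) φ) :
    ContDiff ℝ m (lap φ) :=
  ContDiff.sum fun j _ => contDiff_dx (contDiff_dx (m := m + 1) h j) j
end

theorem fc_lap [DecidableEq ι] {φ : (ι → ℝ) → ℂ} (hφ : ContDiff ℝ 2 φ) (hs : CS φ) (k : ι → ℤ) :
    fc (lap φ) k = (∑ j, symD k j * symD k j) * fc φ k := by
  have h1 : ∀ j, ContDiff ℝ 1 (dx j φ) := fun j => contDiff_dx (m := 1) hφ j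
  unfold fc lap
  simp only [Finset.mul_sum]
  rw [MeasureTheory.integral_finsetSum _ fun j _ => integrable_chr_mul
    (contDiff_dx (m := 0) (h1 j) j).continuous ((hs.dx j).dx j) _, Finset.sum_mul]
  refine Finset.sum_congr rfl fun j _ => ?_
  have h2 := fc_dx (h1 j) (hs.dx j) j k
  have h3 := fc_dx (hφ.of_le one_le_two) hs j k
  rw [h3] at h2
  rw [mul_assoc]
  exact h2

theorem sum_symD_mul_symR {k : ι → ℤ} (hk : k ≠ 0) :
    (∑ j, symD k j * symD k j) * symR k = 1 := by
  have h1 : (nsq k : ℂ) ≠ 0 := by exact_mod_cast (zero_lt_one.trans_le (nsq_pos hk)).ne'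
  have h2 : (Real.pi : ℂ) ≠ 0 := by exact_mod_cast Real.pi_ne_zero
  have h3 : ∀ j, symD k j * symD k j = (-(4 * Real.pi ^ 2) : ℂ) * (k j : ℂ) ^ 2 := fun j => by
    simp only [symD]
    ring_nf
    rw [Complex.I_sq]; ring
  have h4 : ∑ j, (k j : ℂ) ^ 2 = nsq k := by rw [nsq]; push_cast; rfl
  simp only [h3]
  rw [← Finset.mul_sum, h4, symR]
  push_cast
  field_simp

/-- The inverse Laplacian inverts the Laplacian up to the mean value. -/
theorem R_rep_lap [DecidableEq ι] {φ : (ι → ℝ) → ℂ} (hφ : ContDiff ℝ (ord ι s + 2 : ℕ) φ)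
    (hs : CS φ) : R (rep s (lap φ)) = rep s φ - mean (rep s φ) := by
  refine ext_coef fun k => ?_
  rw [coef_sub, R, mean, coef_mult, coef_mult, coef_rep (contDiff_lap hφ) hs.lap,
    coef_rep (hφ.of_le (by norm_cast; omega)) hs, fc_lap (hφ.of_le (by norm_cast; omega)) hs]
  split_ifs with hk
  · rw [hk, symR_zero]; ring
  · rw [zero_mul, sub_zero, ← mul_assoc, mul_comm (symR k), sum_symD_mul_symR hk, one_mul]

theorem evL_R_rep_lap [DecidableEq ι] {φ : (ι → ℝ) → ℂ} (hφ : ContDiff ℝ (ord ι s + 2 : ℕ) φ)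
    (hs : CS φ) {x y : ι → ℝ} (hx : x ∈ cube ι) (hy : y ∈ cube ι) :
    evL x (R (rep s (lap φ))) - evL y (R (rep s (lap φ))) = φ x - φ y := by
  have h1 : ContDiff ℝ (ord ι s) φ := hφ.of_le (by norm_cast; omega)
  rw [R_rep_lap hφ hs, map_sub, map_sub, evL_mean x y, evL_rep h1 hs hx, evL_rep h1 hs hy]
  ring

/-! ### Families -/

section family
variable {P : Type*} [NormedAddCommGroup P] [NormedSpace ℝ P] [DecidableEq ι]

theorem dx_slice {Θ : P × (ι → ℝ) → ℂ} (h : ContDiff ℝ 1 Θ) (j : ι) (p : P) :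
    dx j (fun x => Θ (p, x)) = fun x => fderiv ℝ Θ (p, x) (0, Pi.single j 1) := by
  funext x
  have h1 : HasFDerivAt (fun x : ι → ℝ => (p, x)) (ContinuousLinearMap.inr ℝ P (ι → ℝ)) x := by
    exact hasFDerivAt_prodMk_right p x
  have h2 := ((h.differentiable one_ne_zero (p, x)).hasFDerivAt.comp x h1)
  rw [dx]
  change fderiv ℝ (Θ ∘ fun x => (p, x)) x _ = _
  rw [h2.fderiv]
  simp

theorem exists_slice {Θ : P × (ι → ℝ) → ℂ} {m n : ℕ} (h : ContDiff ℝ (m + n : ℕ) Θ) (j : ι) :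
    ∃ Ψ : P × (ι → ℝ) → ℂ, ContDiff ℝ m Ψ ∧ ∀ p, (dx j)^[n] (fun x => Θ (p, x)) = fun x => Ψ (p, x) := by
  induction n generalizing Θ with
  | zero => exact ⟨Θ, h, fun p => rfl⟩
  | succ n ih =>
    have h1 : ContDiff ℝ (m + n : ℕ) fun q => fderiv ℝ Θ q (0, Pi.single j 1) :=
      (h.fderiv_right (m := (m + n : ℕ)) (by norm_cast)).clm_apply contDiff_const
    obtain ⟨Ψ, h2, h3⟩ := ih h1
    refine ⟨Ψ, h2, fun p => ?_⟩
    rw [Function.iterate_succ_apply, dx_slice (h.of_le (by norm_cast; omega))]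
    exact h3 p

omit [NormedSpace ℝ P] [DecidableEq ι] in
theorem eventually_slice_lt {Ψ : P × (ι → ℝ) → ℂ} (h : Continuous Ψ) (hs : ∀ p, CS fun x => Ψ (p, x))
    (h0 : ∀ x, Ψ (0, x) = 0) {ε : ℝ} (hε : 0 < ε) : ∀ᶠ p in 𝓝 (0 : P), ∀ x, ‖Ψ (p, x)‖ ≤ ε := by
  have h1 : ∀ᶠ p in 𝓝 (0 : P), ∀ x ∈ Metric.closedBall (0 : ι → ℝ) (1 / 3), ‖Ψ (p, x)‖ < ε := by
    refine (isCompact_closedBall (0 : ι → ℝ) (1 / 3)).eventually_forall_of_forall_eventually fun x _ => ?_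
    have : ContinuousAt (fun q : P × (ι → ℝ) => ‖Ψ q‖) (0, x) := h.norm.continuousAt
    refine this.eventually_lt continuousAt_const ?_
    simp [h0, hε]
  filter_upwards [h1] with p hp x
  by_cases hx : ‖x‖ ≤ 1 / 3
  · exact (hp x (mem_closedBall_zero_iff.2 hx)).le
  · have : Ψ (p, x) = 0 := hs p x (not_le.1 hx)
    rw [this, norm_zero]; exact hε.le

/-- Elements of the Wiener algebra representing a regular family depend continuously on the
parameter. -/
theorem tendsto_rep {Θ : P × (ι → ℝ) → ℂ} (h : ContDiff ℝ (ord ι s) Θ)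
    (hs : ∀ p, CS fun x => Θ (p, x)) (h0 : ∀ x, Θ (0, x) = 0) :
    Tendsto (fun p => rep s fun x => Θ (p, x)) (𝓝 0) (𝓝 0) := by
  set m := ord ι s
  have hsl : ∀ p, ContDiff ℝ m fun x => Θ (p, x) := fun p => h.comp (contDiff_const.prodMk contDiff_id)
  have hΨ : ∀ j, ∃ Ψ : P × (ι → ℝ) → ℂ, Continuous Ψ ∧
      ∀ p, (dx j)^[m] (fun x => Θ (p, x)) = fun x => Ψ (p, x) := fun j => by
    obtain ⟨Ψ, h1, h2⟩ := exists_slice (m := 0) (n := m) (by rwa [zero_add]) j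
    exact ⟨Ψ, h1.continuous, h2⟩
  choose Ψ hc hΨ using hΨ
  set C : ℝ := 2 ^ m * ∑' k : ι → ℤ, (wt (Fintype.card ι + 1) k)⁻¹ with hC
  have hC0 : 0 ≤ C := mul_nonneg (by positivity) (tsum_nonneg fun k => (inv_pos.2 (wt_pos _ k)).le)
  have hz : ∀ j x, Ψ j (0, x) = 0 := fun j x => by
    have h1 : _ = Ψ j (0, x) := congrFun (hΨ j 0) x
    rw [← h1]
    have h2 : (fun x => Θ (0, x)) = fun _ => 0 := funext h0
    rw [h2]
    have : ∀ n, (dx j)^[n] (fun _ : ι → ℝ => (0 : ℂ)) = fun _ => 0 := fun n => by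
      induction n with
      | zero => rfl
      | succ n ih =>
        rw [Function.iterate_succ_apply', ih]
        funext y; simp [dx]
    rw [this]
  rw [Metric.tendsto_nhds]
  intro ε hε
  have hε' : 0 < ε / (2 * (C + 1)) := by positivity
  have e1 := eventually_slice_lt h.continuous hs h0 hε'
  have e2 := eventually_all.2 fun j => eventually_slice_lt (hc j)
    (fun p => by rw [← hΨ j p]; exact (hs p).dx_iterate j m) (hz j) hε'
  filter_upwards [e1, e2] with p h1 h2
  rw [dist_zero_right]
  have h3 := norm_le_of_coef_fc (hsl p) (hs p) h1 (fun j x => by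
    change ‖(dx j)^[m] _ x‖ ≤ _
    rw [hΨ j p]; exact h2 j x) (coef_rep (hsl p) (hs p))
  refine h3.trans_lt ?_
  have h4 : 2 ^ m * (ε / (2 * (C + 1))) * ∑' k : ι → ℤ, (wt (Fintype.card ι + 1) k)⁻¹
      = (C / (C + 1)) * (ε / 2) := by rw [hC]; field_simp
  change 2 ^ m * (ε / (2 * (C + 1))) * ∑' k : ι → ℤ, (wt (Fintype.card ι + 1) k)⁻¹ < ε
  rw [h4]
  have h5 : C / (C + 1) ≤ 1 := div_le_one_of_le₀ (by linarith) (by linarith)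
  nlinarith [h5]
end family

end Wiener
end NN

namespace NN
open scoped BigOperators Topology ContDiff

/-! ### Maps whose partial derivative in the second variable vanishes -/

/-- `f` is continuously differentiable at the origin, vanishes there, and its derivative in the
second variable vanishes there. -/
def VanishY (𝕜 : Type*) [RCLike 𝕜] {P Y A : Type*} [NormedAddCommGroup P] [NormedSpace 𝕜 P]
    [NormedAddCommGroup Y] [NormedSpace 𝕜 Y]
    [NormedAddCommGroup A] [NormedSpace 𝕜 A] (f : P × Y → A) : Prop :=
  ContDiffAt 𝕜 1 f 0 ∧ f 0 = 0 ∧ ∀ y, fderiv 𝕜 f 0 (0, y) = 0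

section
variable {𝕜 : Type*} [RCLike 𝕜] {P Y A B : Type*} [NormedAddCommGroup P] [NormedSpace 𝕜 P]
    [NormedAddCommGroup Y] [NormedSpace 𝕜 Y]
    [NormedAddCommGroup A] [NormedSpace 𝕜 A] [NormedAddCommGroup B] [NormedSpace 𝕜 B]
    {f g : P × Y → A}

theorem VanishY.hasFDerivAt (hf : VanishY 𝕜 f) : HasFDerivAt f (fderiv 𝕜 f 0) 0 :=
  (hf.1.differentiableAt (by norm_num)).hasFDerivAt

theorem VanishTwo.vanishY (hf : VanishTwo 𝕜 f) : VanishY 𝕜 f :=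
  ⟨hf.1, hf.2.1, fun y => by rw [hf.2.2]; rfl⟩

theorem vanishY_fst (L : P →L[𝕜] A) : VanishY 𝕜 (fun q : P × Y => L q.1) :=
  ⟨(L.contDiff.comp contDiff_fst).contDiffAt, by simp, fun y => by
    have : HasFDerivAt (fun q : P × Y => L q.1) (L.comp (ContinuousLinearMap.fst 𝕜 P Y)) 0 :=
      (L.comp (ContinuousLinearMap.fst 𝕜 P Y)).hasFDerivAt
    rw [this.fderiv]; simp⟩

theorem VanishY.add (hf : VanishY 𝕜 f) (hg : VanishY 𝕜 g) : VanishY 𝕜 (fun q => f q + g q) :=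
  ⟨hf.1.add hg.1, by simp [hf.2.1, hg.2.1], fun y => by
    rw [(hf.hasFDerivAt.fun_add hg.hasFDerivAt).fderiv]; simp [hf.2.2, hg.2.2]⟩

theorem VanishY.clm (L : A →L[𝕜] B) (hf : VanishY 𝕜 f) : VanishY 𝕜 (fun q => L (f q)) :=
  ⟨L.contDiff.contDiffAt.comp 0 hf.1, by simp [hf.2.1], fun y => by
    have h : HasFDerivAt (fun q => L (f q)) (L.comp (fderiv 𝕜 f 0)) 0 :=
      L.hasFDerivAt.comp 0 hf.hasFDerivAt
    rw [h.fderiv]; simp [hf.2.2]⟩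

theorem VanishY.neg (hf : VanishY 𝕜 f) : VanishY 𝕜 (fun q => -f q) :=
  hf.clm (-ContinuousLinearMap.id 𝕜 A)

theorem VanishY.sub (hf : VanishY 𝕜 f) (hg : VanishY 𝕜 g) : VanishY 𝕜 (fun q => f q - g q) := by
  simpa only [sub_eq_add_neg] using hf.add hg.neg

theorem vanishY_zero : VanishY 𝕜 (fun _ : P × Y => (0 : A)) :=
  ⟨contDiffAt_const, rfl, fun y => by simp⟩

theorem VanishY.sum {α : Type*} {t : Finset α} {f : α → P × Y → A}
    (hf : ∀ i ∈ t, VanishY 𝕜 (f i)) : VanishY 𝕜 (fun q => ∑ i ∈ t, f i q) := by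
  classical
  induction t using Finset.induction_on with
  | empty => simpa using vanishY_zero
  | insert i t hi ih =>
    simp only [Finset.sum_insert hi]
    exact (hf i (Finset.mem_insert_self i t)).add (ih fun j hj => hf j (Finset.mem_insert_of_mem hj))

theorem vanishY_pi {ι : Type*} [Fintype ι] {f : P × Y → ι → A}
    (hf : ∀ i, VanishY 𝕜 (fun q => f q i)) : VanishY 𝕜 f :=
  ⟨contDiffAt_pi.2 fun i => (hf i).1, funext fun i => (hf i).2.1, fun y => by
    have : HasFDerivAt f (ContinuousLinearMap.pi fun i => fderiv 𝕜 (fun q => f q i) 0) 0 :=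
      hasFDerivAt_pi.2 fun i => (hf i).hasFDerivAt
    rw [this.fderiv]
    funext i
    simp [(hf i).2.2]⟩

theorem vanishY_prodMk {f : P × Y → A} {g : P × Y → B}
    (hf : VanishY 𝕜 f) (hg : VanishY 𝕜 g) : VanishY 𝕜 (fun q => (f q, g q)) :=
  ⟨hf.1.prodMk hg.1, Prod.ext hf.2.1 hg.2.1, fun y => by
    rw [(hf.hasFDerivAt.prodMk hg.hasFDerivAt).fderiv]; simp [hf.2.2, hg.2.2]⟩
end

/-! ### Matrix-valued maps -/

section
variable {𝕜 : Type*} [RCLike 𝕜] {V A ι : Type*} [Fintype ι] [NormedAddCommGroup V] [NormedSpace 𝕜 V]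
    [NormedCommRing A] [NormedAlgebra 𝕜 A] {f g : V → Matrix ι ι A}

/-- Entrywise continuous differentiability at the origin. -/
def ContM (𝕜 : Type*) [RCLike 𝕜] {V A ι : Type*} [NormedAddCommGroup V] [NormedSpace 𝕜 V]
    [NormedCommRing A] [NormedAlgebra 𝕜 A] (f : V → Matrix ι ι A) : Prop :=
  ∀ i j, ContDiffAt 𝕜 1 (fun q => f q i j) 0

/-- Entrywise first order vanishing at the origin. -/
def OneM (𝕜 : Type*) [RCLike 𝕜] {V A ι : Type*} [NormedAddCommGroup V] [NormedSpace 𝕜 V]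
    [NormedCommRing A] [NormedAlgebra 𝕜 A] (f : V → Matrix ι ι A) : Prop :=
  ∀ i j, VanishOne 𝕜 (fun q => f q i j)

/-- Entrywise second order vanishing at the origin. -/
def TwoM (𝕜 : Type*) [RCLike 𝕜] {V A ι : Type*} [NormedAddCommGroup V] [NormedSpace 𝕜 V]
    [NormedCommRing A] [NormedAlgebra 𝕜 A] (f : V → Matrix ι ι A) : Prop :=
  ∀ i j, VanishTwo 𝕜 (fun q => f q i j)

omit [Fintype ι] in
theorem OneM.cont (hf : OneM 𝕜 f) : ContM 𝕜 f := fun i j => (hf i j).1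
omit [Fintype ι] in
theorem TwoM.one (hf : TwoM 𝕜 f) : OneM 𝕜 f := fun i j => (hf i j).one
omit [Fintype ι] in
theorem contM_const (M : Matrix ι ι A) : ContM 𝕜 (fun _ : V => M) := fun _ _ => contDiffAt_const
omit [Fintype ι] in
theorem ContM.add (hf : ContM 𝕜 f) (hg : ContM 𝕜 g) : ContM 𝕜 fun q => f q + g q :=
  fun i j => (hf i j).add (hg i j)
omit [Fintype ι] in
theorem OneM.add (hf : OneM 𝕜 f) (hg : OneM 𝕜 g) : OneM 𝕜 fun q => f q + g q :=
  fun i j => (hf i j).add (hg i j)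
omit [Fintype ι] in
theorem OneM.sub (hf : OneM 𝕜 f) (hg : OneM 𝕜 g) : OneM 𝕜 fun q => f q - g q :=
  fun i j => (hf i j).sub (hg i j)
omit [Fintype ι] in
theorem TwoM.add (hf : TwoM 𝕜 f) (hg : TwoM 𝕜 g) : TwoM 𝕜 fun q => f q + g q :=
  fun i j => (hf i j).add (hg i j)
omit [Fintype ι] in
theorem TwoM.sub (hf : TwoM 𝕜 f) (hg : TwoM 𝕜 g) : TwoM 𝕜 fun q => f q - g q :=
  fun i j => (hf i j).sub (hg i j)
theorem ContM.mul (hf : ContM 𝕜 f) (hg : ContM 𝕜 g) : ContM 𝕜 fun q => f q * g q :=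
  fun i j => by
    simp only [Matrix.mul_apply]
    exact ContDiffAt.sum fun k _ => (hf i k).mul (hg k j)
theorem OneM.mul_left (hf : ContM 𝕜 f) (hg : OneM 𝕜 g) : OneM 𝕜 fun q => f q * g q :=
  fun i j => by
    simp only [Matrix.mul_apply]
    exact VanishOne.sum fun k _ => VanishOne.mul_left (hf i k) (hg k j)
theorem OneM.mul_right (hf : OneM 𝕜 f) (hg : ContM 𝕜 g) : OneM 𝕜 fun q => f q * g q :=
  fun i j => by
    simp only [Matrix.mul_apply]
    exact VanishOne.sum fun k _ => VanishOne.mul_right (hf i k) (hg k j)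
theorem OneM.mul (hf : OneM 𝕜 f) (hg : OneM 𝕜 g) : TwoM 𝕜 fun q => f q * g q :=
  fun i j => by
    simp only [Matrix.mul_apply]
    exact VanishTwo.sum fun k _ => (hf i k).mul (hg k j)
end

namespace Wiener
variable {ι : Type*} [Fintype ι] {s : ℕ}

/-- `R` on the real Wiener algebra. -/
noncomputable def RR : realSub ι s →L[ℝ] realSub ι s := multReal symR 1 norm_symR_le symR_neg
/-- `R1` on the real Wiener algebra. -/
noncomputable def RR1 (i : ι) : realSub ι s →L[ℝ] realSub ι s :=
  multReal (fun k => symD k i * symR k) 1 (norm_symR1_le i) fun k => by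
    rw [symD_neg, symR_neg, star_mul']
/-- `R2` on the real Wiener algebra. -/
noncomputable def RR2 (i j : ι) : realSub ι s →L[ℝ] realSub ι s :=
  multReal (fun k => symD k i * (symD k j * symR k)) 1 (norm_symR2_le i j) fun k => by
    rw [symD_neg, symD_neg, symR_neg, star_mul', star_mul']

open Classical in
/-- The mean value on the real Wiener algebra. -/
noncomputable def meanR : realSub ι s →L[ℝ] realSub ι s :=
  multReal (fun k => if k = 0 then 1 else 0) 1 norm_symMean_le fun k => by
    simp only [neg_eq_zero]; split_ifs <;> simp

theorem RR2_comm (i j : ι) (a : realSub ι s) : RR2 i j a = RR2 j i a :=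
  Subtype.ext (R2_comm i j (a : Wiener ι s))

theorem sum_RR2 (a : realSub ι s) : ∑ i, RR2 i i a = a - meanR a :=
  Subtype.ext (by
    have := sum_R2 (a : Wiener ι s)
    rw [AddSubgroupClass.coe_sub, AddSubmonoidClass.coe_finsetSum]
    exact this)

theorem evR_eq_re (x : ι → ℝ) (a : realSub ι s) : evR x a = (evL x (a : Wiener ι s)).re := rfl

theorem evR_meanR (x y : ι → ℝ) (a : realSub ι s) : evR x (meanR a) = evR y (meanR a) :=
  congrArg Complex.re (evL_mean x y (a : Wiener ι s))

/-- Evaluation as a continuous linear map. -/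
noncomputable def evRL (x : ι → ℝ) : realSub ι s →L[ℝ] ℝ :=
  ⟨(evR x).toLinearMap, continuous_evR x⟩

/-- The constant real algebra element with the value of `a` at `x`. -/
noncomputable def constAt (x : ι → ℝ) : realSub ι s →L[ℝ] realSub ι s :=
  (Algebra.linearMap ℝ (realSub ι s)).toContinuousLinearMap.comp (evRL x)

theorem constAt_apply (x : ι → ℝ) (a : realSub ι s) :
    constAt x a = algebraMap ℝ (realSub ι s) (evR x a) := rfl

theorem evR_constAt (x y : ι → ℝ) (a : realSub ι s) : evR y (constAt x a) = evR x a := by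
  rw [constAt_apply, AlgHom.commutes]; rfl

theorem contDiff_evR (a : realSub ι s) : ContDiff ℝ s fun x => evR x a :=
  Complex.reCLM.contDiff.comp (contDiff_evL (a : Wiener ι s))

theorem hasFDerivAt_re {f : (ι → ℝ) → ℂ} {x : ι → ℝ} {c : ι → ℝ} {z : ι → ℂ}
    (hf : HasFDerivAt f (∑ i, z i •
      (Complex.ofRealCLM.comp (ContinuousLinearMap.proj (R := ℝ) (φ := fun _ : ι => ℝ) i))) x)
    (hc : ∀ i, (z i).re = c i) : HasFDerivAt (fun y => (f y).re)
      (∑ i, c i • ContinuousLinearMap.proj (R := ℝ) (φ := fun _ : ι => ℝ) i) x := by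
  have h := Complex.reCLM.hasFDerivAt.comp x hf
  refine h.congr_fderiv ?_
  ext v
  simp [hc]

theorem hasFDerivAt_evR_RR (a : realSub ι s) (x : ι → ℝ) :
    HasFDerivAt (fun y => evR y (RR a))
      (∑ i, evR x (RR1 i a) • ContinuousLinearMap.proj (R := ℝ) (φ := fun _ : ι => ℝ) i) x :=
  hasFDerivAt_re (hasFDerivAt_evL_R (a : Wiener ι s) x) fun _ => rfl

theorem hasFDerivAt_evR_RR1 (j : ι) (a : realSub ι s) (x : ι → ℝ) :
    HasFDerivAt (fun y => evR y (RR1 j a))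
      (∑ i, evR x (RR2 i j a) • ContinuousLinearMap.proj (R := ℝ) (φ := fun _ : ι => ℝ) i) x :=
  hasFDerivAt_re (hasFDerivAt_evL_R1 j (a : Wiener ι s) x) fun _ => rfl

end Wiener
end NN

namespace NN
open scoped BigOperators Topology ContDiff
set_option linter.unusedSectionVars false
namespace Gauge

variable {ι : Type*} [Fintype ι] {𝒜 : Type*} [NormedCommRing 𝒜] [NormedAlgebra ℝ 𝒜]
  (T : ι → 𝒜 →L[ℝ] 𝒜) (D : ι → ι → 𝒜 →L[ℝ] 𝒜)

/-- Parameters of the gauge problem: the perturbation and its derivatives. -/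
abbrev Par (ι 𝒜 : Type*) :=
  (ι → ι → 𝒜) × (ι → ι → ι → 𝒜)
/-- Unknowns of the gauge problem: the source of the coordinate change and the inverse Jacobian. -/
abbrev Unk (ι 𝒜 : Type*) :=
  (ι → 𝒜) × (ι → ι → 𝒜)

/-- The constant matrix in the algebra. -/
noncomputable def cst (I₀ : Matrix ι ι ℝ) : Matrix ι ι (𝒜) := I₀.map (algebraMap ℝ _)
/-- Jacobian correction. -/
noncomputable def om (g : ι → 𝒜) : Matrix ι ι (𝒜) :=
  Matrix.of fun M A => T M (g A)
/-- Second derivatives. -/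
noncomputable def hess (M : ι) (g : ι → 𝒜) : Matrix ι ι (𝒜) :=
  Matrix.of fun N A => D M N (g A)
/-- The perturbation as a matrix. -/
def matA (q : Par ι 𝒜 × Unk ι 𝒜) : Matrix ι ι (𝒜) := Matrix.of q.1.1
/-- The derivatives of the perturbation as matrices. -/
def matB (M : ι) (q : Par ι 𝒜 × Unk ι 𝒜) : Matrix ι ι (𝒜) := Matrix.of (q.1.2 M)
/-- The correction of the inverse Jacobian as a matrix. -/
def matC (q : Par ι 𝒜 × Unk ι 𝒜) : Matrix ι ι (𝒜) := Matrix.of q.2.2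

variable [DecidableEq ι] (I₀ : Matrix ι ι ℝ)

/-- Nonlinear part of the derivative of the transformed structure. -/
noncomputable def nonl (M : ι) (q : Par ι 𝒜 × Unk ι 𝒜) : Matrix ι ι (𝒜) :=
  matB M q * om T q.2.1 + matA q * hess D M q.2.1
    - hess D M q.2.1 * ((1 + matC q) * (cst I₀ + matA q) * (1 + om T q.2.1) - cst I₀)
/-- Derivative of the transformed structure, up to the inverse Jacobian. -/
noncomputable def der (M : ι) (q : Par ι 𝒜 × Unk ι 𝒜) : Matrix ι ι (𝒜) :=
  matB M q + (cst I₀ * hess D M q.2.1 - hess D M q.2.1 * cst I₀) + nonl T D I₀ M q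
/-- Quadratic part of the divergence. -/
noncomputable def quad (C : ι) (q : Par ι 𝒜 × Unk ι 𝒜) : 𝒜 :=
  ∑ A, nonl T D I₀ A q A C + ∑ A, (matC q * der T D I₀ A q) A C
    + ∑ A, ∑ M, matC q A M * ((1 + matC q) * der T D I₀ M q) A C
/-- First component of the fixed point map. -/
noncomputable def fix1 (q : Par ι 𝒜 × Unk ι 𝒜) (C : ι) : 𝒜 :=
  -∑ K, (∑ A, matB A q A K + quad T D I₀ K q) * cst I₀ K C
/-- Second component of the fixed point map. -/
noncomputable def fix2 (q : Par ι 𝒜 × Unk ι 𝒜) : ι → ι → 𝒜 :=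
  fun M N => (-om T (fix1 T D I₀ q) - matC q * om T q.2.1) M N
/-- The fixed point map. -/
noncomputable def fixMap (q : Par ι 𝒜 × Unk ι 𝒜) : Unk ι 𝒜 := (fix1 T D I₀ q, fix2 T D I₀ q)

theorem _root_.NN.ContM.oneM {𝕜 : Type*} [RCLike 𝕜] {V A ι : Type*} [NormedAddCommGroup V]
    [NormedSpace 𝕜 V] [NormedCommRing A] [NormedAlgebra 𝕜 A] {f : V → Matrix ι ι A}
    (hf : ContM 𝕜 f) (h : f 0 = 0) : OneM 𝕜 f := fun i j => ⟨hf i j, congrFun (congrFun h i) j⟩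

theorem oneM_matA : OneM ℝ (matA (ι := ι) (𝒜 := 𝒜)) := fun i j =>
  ⟨by unfold matA; simp only [Matrix.of_apply]; fun_prop, by simp [matA]⟩
theorem oneM_matB (M : ι) : OneM ℝ (matB (ι := ι) (𝒜 := 𝒜) M) := fun i j =>
  ⟨by unfold matB; simp only [Matrix.of_apply]; fun_prop, by simp [matB]⟩
theorem oneM_matC : OneM ℝ (matC (ι := ι) (𝒜 := 𝒜)) := fun i j =>
  ⟨by unfold matC; simp only [Matrix.of_apply]; fun_prop, by simp [matC]⟩
theorem oneM_om : OneM ℝ (fun q : Par ι 𝒜 × Unk ι 𝒜 => om T q.2.1) := fun i j =>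
  ⟨by unfold om; simp only [Matrix.of_apply]; fun_prop, by simp [om]⟩
theorem oneM_hess (M : ι) : OneM ℝ (fun q : Par ι 𝒜 × Unk ι 𝒜 => hess D M q.2.1) := fun i j =>
  ⟨by unfold hess; simp only [Matrix.of_apply]; fun_prop, by simp [hess]⟩

theorem matA_zero : matA (0 : Par ι 𝒜 × Unk ι 𝒜) = 0 := rfl
theorem matC_zero : matC (0 : Par ι 𝒜 × Unk ι 𝒜) = 0 := rfl
theorem om_zero : om T (0 : ι → 𝒜) = 0 := by
  ext1; simp [om]

theorem twoM_nonl (M : ι) : TwoM ℝ (nonl T D I₀ M) := by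
  refine (((oneM_matB M).mul (oneM_om T)).add
    ((oneM_matA).mul (oneM_hess D M))).sub
    ((oneM_hess D M).mul (ContM.oneM (V := Par ι 𝒜 × Unk ι 𝒜) ?_ ?_))
  · intro i j
    have h := (((contM_const (𝕜 := ℝ) (V := Par ι 𝒜 × Unk ι 𝒜) (1 : Matrix ι ι (𝒜))).add
      oneM_matC.cont).mul ((contM_const (V := Par ι 𝒜 × Unk ι 𝒜) (cst I₀)).add oneM_matA.cont)).mul
      ((contM_const (1 : Matrix ι ι (𝒜))).add (oneM_om T).cont)
    exact (h i j).sub contDiffAt_const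
  · simp only [Prod.snd_zero, Prod.fst_zero, matA_zero, matC_zero, om_zero, add_zero, one_mul,
      mul_one, sub_self]

theorem oneM_der (M : ι) : OneM ℝ (der T D I₀ M) :=
  ((oneM_matB M).add ((OneM.mul_left (contM_const (V := Par ι 𝒜 × Unk ι 𝒜) (cst I₀)) (oneM_hess D M)).sub
    (OneM.mul_right (oneM_hess D M) (contM_const (V := Par ι 𝒜 × Unk ι 𝒜) (cst I₀))))).add (twoM_nonl T D I₀ M).one

theorem vanishTwo_quad (C : ι) : VanishTwo ℝ (quad T D I₀ C) := by
  refine ((VanishTwo.sum fun A _ => twoM_nonl T D I₀ A A C).add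
    (VanishTwo.sum fun A _ => ((oneM_matC).mul (oneM_der T D I₀ A)) A C)).add
    (VanishTwo.sum fun A _ => VanishTwo.sum fun M _ => (oneM_matC A M).mul ?_)
  exact (OneM.mul_left ((contM_const 1).add (oneM_matC).cont)
    (oneM_der T D I₀ M)) A C

theorem vanishY_fix1 : VanishY ℝ (fix1 T D I₀) := by
  refine vanishY_pi fun C => ?_
  refine VanishY.neg (VanishY.sum fun K _ => ?_)
  have h1 : VanishY ℝ fun q : Par ι 𝒜 × Unk ι 𝒜 => ∑ A, matB A q A K :=
    VanishY.sum fun A _ => vanishY_fst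
      (((ContinuousLinearMap.proj (R := ℝ) (φ := fun _ : ι => 𝒜) K).comp
        ((ContinuousLinearMap.proj (R := ℝ) (φ := fun _ : ι => ι → 𝒜) A).comp
          (ContinuousLinearMap.proj (R := ℝ) (φ := fun _ : ι => ι → ι → 𝒜) A))).comp
        (ContinuousLinearMap.snd ℝ (ι → ι → 𝒜) (ι → ι → ι → 𝒜)))
  have h2 := (h1.add (vanishTwo_quad T D I₀ K).vanishY).clm
    ((ContinuousLinearMap.mul ℝ (𝒜)).flip (cst I₀ K C))
  exact h2

theorem vanishY_fixMap : VanishY ℝ (fixMap T D I₀) := by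
  refine vanishY_prodMk (vanishY_fix1 T D I₀) (vanishY_pi fun M => vanishY_pi fun N => ?_)
  refine VanishY.sub (VanishY.neg ?_) (((oneM_matC).mul (oneM_om T)) M N).vanishY
  have h := (vanishY_fix1 T D I₀).clm
    ((T M).comp
      (ContinuousLinearMap.proj (R := ℝ) (φ := fun _ : ι => 𝒜) N))
  exact h

theorem sum_cst_hess (hD : ∀ i j a, D i j a = D j i a) (hI : ∀ i j, I₀ i j = -I₀ j i) (g : ι → 𝒜) (C : ι) :
    ∑ A, (cst I₀ * hess D A g : Matrix ι ι (𝒜)) A C = 0 := by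
  have h : ∑ A, ∑ N, I₀ A N • D A N (g C) = -∑ A, ∑ N, I₀ A N • D A N (g C) := by
    conv_lhs => rw [Finset.sum_comm]
    simp only [← Finset.sum_neg_distrib]
    refine Finset.sum_congr rfl fun A _ => Finset.sum_congr rfl fun N _ => ?_
    rw [hI N A, hD N A, neg_smul]
  have h2 : ∑ A, ∑ N, I₀ A N • D A N (g C) = 0 := by
    have h3 : (2 : ℝ) • ∑ A, ∑ N, I₀ A N • D A N (g C) = 0 := by
      rw [two_smul]; nth_rewrite 1 [h]; exact neg_add_cancel _
    exact (smul_eq_zero.1 h3).resolve_left two_ne_zero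
  rw [← h2]
  refine Finset.sum_congr rfl fun A _ => ?_
  rw [Matrix.mul_apply]
  refine Finset.sum_congr rfl fun N _ => ?_
  rw [Algebra.smul_def]; rfl

theorem sum_hess_cst (g : ι → 𝒜) (C : ι) :
    ∑ A, (hess D A g * cst I₀ : Matrix ι ι (𝒜)) A C = ∑ N, (∑ i, D i i (g N)) * cst I₀ N C := by
  simp only [Matrix.mul_apply, Finset.sum_mul]
  rw [Finset.sum_comm]; rfl

/-- A fixed point yields the inverse Jacobian and a constant divergence. -/
theorem of_fixed (hD : ∀ i j a, D i j a = D j i a) (hI : ∀ i j, I₀ i j = -I₀ j i) (hI2 : I₀ * I₀ = -1) {q : Par ι 𝒜 × Unk ι 𝒜}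
    (hq : fixMap T D I₀ q = q.2) :
    (1 + matC q) * (1 + om T q.2.1) = 1 ∧
    ∀ C, ∑ A, ∑ M, (1 + matC q) A M * ((1 + matC q) * (matB M q * (1 + om T q.2.1)
      + (cst I₀ + matA q) * hess D M q.2.1
      - hess D M q.2.1 * ((1 + matC q) * (cst I₀ + matA q) * (1 + om T q.2.1))) :
        Matrix ι ι (𝒜)) A C
      = ∑ N, (q.2.1 N - ∑ i, D i i (q.2.1 N)) * cst I₀ N C := by
  have hc2 : (cst I₀ * cst I₀ : Matrix ι ι (𝒜)) = -1 := by
    have := congrArg (fun m : Matrix ι ι ℝ => m.map (algebraMap ℝ (𝒜))) hI2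
    simp only [Matrix.map_mul] at this
    rw [cst, this]
    ext1 i j
    by_cases h : i = j <;> simp [h, Matrix.map_apply]
  have h1 : fix1 T D I₀ q = q.2.1 := congrArg Prod.fst hq
  have h2 : -om T q.2.1 - matC q * om T q.2.1 = matC q := by
    have := congrArg Prod.snd hq
    ext1 i j
    have h3 := congrFun (congrFun this i) j
    simp only [fixMap, fix2, h1] at h3
    exact h3
  have hgJ : ∀ C, ∑ N, q.2.1 N * cst I₀ N C = ∑ A, matB A q A C + quad T D I₀ C q := by
    intro C
    set v : ι → 𝒜 := fun K => ∑ A, matB A q A K + quad T D I₀ K q with hv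
    have hg : q.2.1 = -(Matrix.vecMul v (cst I₀)) := by
      rw [← h1]; funext K; simp [fix1, Matrix.vecMul, dotProduct, hv]
    have : Matrix.vecMul q.2.1 (cst I₀) = v := by
      rw [hg, Matrix.neg_vecMul, Matrix.vecMul_vecMul, hc2, Matrix.vecMul_neg, Matrix.vecMul_one,
        neg_neg]
    exact congrFun this C
  have hX : ∀ M, matB M q * (1 + om T q.2.1) + (cst I₀ + matA q) * hess D M q.2.1
      - hess D M q.2.1 * ((1 + matC q) * (cst I₀ + matA q) * (1 + om T q.2.1)) = der T D I₀ M q := by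
    intro M
    rw [der, nonl]; noncomm_ring
  refine ⟨?_, fun C => ?_⟩
  · have : (1 + matC q) * (1 + om T q.2.1)
        = 1 + (matC q - (-om T q.2.1 - matC q * om T q.2.1)) := by noncomm_ring
    rw [this, h2]; simp
  · simp only [hX]
    have hs : ∀ A, ∑ M, (1 + matC q) A M * ((1 + matC q) * der T D I₀ M q) A C
        = der T D I₀ A q A C + (matC q * der T D I₀ A q) A C
          + ∑ M, matC q A M * ((1 + matC q) * der T D I₀ M q) A C := by
      intro A
      have h0 : ∀ M, (1 + matC q) A M * ((1 + matC q) * der T D I₀ M q) A C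
          = (if A = M then ((1 + matC q) * der T D I₀ M q) A C else 0)
            + matC q A M * ((1 + matC q) * der T D I₀ M q) A C := by
        intro M
        rw [Matrix.add_apply, add_mul, Matrix.one_apply]
        split_ifs <;> simp
      simp only [h0, Finset.sum_add_distrib, Finset.sum_ite_eq, Finset.mem_univ, if_true]
      rw [add_mul, one_mul, Matrix.add_apply]
    have hd : ∑ A, der T D I₀ A q A C = ∑ A, matB A q A C
        - ∑ N, (∑ i, D i i (q.2.1 N)) * cst I₀ N C + ∑ A, nonl T D I₀ A q A C := by
      simp only [der, Matrix.add_apply, Matrix.sub_apply, Finset.sum_add_distrib,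
        Finset.sum_sub_distrib, sum_cst_hess D I₀ hD hI, sum_hess_cst]
      ring
    simp only [hs, Finset.sum_add_distrib, hd]
    have := hgJ C
    simp only [sub_mul, Finset.sum_sub_distrib, this, quad]
    ring

theorem map_conj {A : Type*} [CommRing A] (f : A →+* ℝ) (c b w a h : Matrix ι ι A) :
    (c * (b * w + a * h - h * (c * a * w))).map f
      = c.map f * (b.map f * w.map f + a.map f * h.map f - h.map f * (c.map f * a.map f * w.map f)) := by
  simp only [Matrix.map_mul, Matrix.map_add _ (map_add f), Matrix.map_sub _ (map_sub f)]

/-- The image of a fixed point under a character. -/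
theorem of_fixed_map (f : 𝒜 →ₐ[ℝ] ℝ) (hD : ∀ i j a, D i j a = D j i a)
    (hI : ∀ i j, I₀ i j = -I₀ j i) (hI2 : I₀ * I₀ = -1) {q : Par ι 𝒜 × Unk ι 𝒜}
    (hq : fixMap T D I₀ q = q.2) :
    (1 + matC q).map f * (1 + om T q.2.1).map f = 1 ∧
    ∀ C, ∑ A, ∑ M, (1 + matC q).map f A M * ((1 + matC q).map f *
      ((matB M q).map f * (1 + om T q.2.1).map f + (I₀ + (matA q).map f) * (hess D M q.2.1).map f
      - (hess D M q.2.1).map f * ((1 + matC q).map f * (I₀ + (matA q).map f)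
        * (1 + om T q.2.1).map f))) A C
      = ∑ N, f (q.2.1 N - ∑ i, D i i (q.2.1 N)) * I₀ N C := by
  obtain ⟨h1, h2⟩ := of_fixed T D I₀ hD hI hI2 hq
  have hc : (cst I₀ + matA q).map f = I₀ + (matA q).map f := by
    ext i j
    simp [cst, Matrix.map_apply]
  refine ⟨?_, fun C => ?_⟩
  · have := congrArg (fun m : Matrix ι ι 𝒜 => m.map f) h1
    simp only [Matrix.map_mul] at this
    rw [this]
    ext i j
    by_cases hij : i = j <;> simp [Matrix.one_apply, hij]
  · have h3 := congrArg f (h2 C)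
    simp only [map_sum, map_mul] at h3
    have h6 : ∀ M A, f (((1 + matC q) * (matB M q * (1 + om T q.2.1)
        + (cst I₀ + matA q) * hess D M q.2.1
        - hess D M q.2.1 * ((1 + matC q) * (cst I₀ + matA q) * (1 + om T q.2.1))) :
          Matrix ι ι 𝒜) A C)
        = ((1 + matC q).map f * ((matB M q).map f * (1 + om T q.2.1).map f
        + (cst I₀ + matA q).map f * (hess D M q.2.1).map f
        - (hess D M q.2.1).map f * ((1 + matC q).map f * (cst I₀ + matA q).map f
          * (1 + om T q.2.1).map f))) A C := by
      intro M A
      exact congrFun (congrFun (map_conj (f : 𝒜 →+* ℝ) (1 + matC q) (matB M q) (1 + om T q.2.1)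
        (cst I₀ + matA q) (hess D M q.2.1)) A) C
    simp only [h6, hc] at h3
    refine Eq.trans ?_ (h3.trans ?_)
    · rfl
    · refine Finset.sum_congr rfl fun N _ => ?_
      simp [cst]

end Gauge
end NN

namespace NN
open scoped BigOperators Topology ContDiff
open Filter
open Wiener Gauge

variable {ι : Type*} [Fintype ι] {s : ℕ}

theorem contDiff_ofReal_comp {V : Type*} [NormedAddCommGroup V] [NormedSpace ℝ V] {φ : V → ℝ}
    {n : ℕ} (h : ContDiff ℝ ∞ φ) : ContDiff ℝ n fun x => (φ x : ℂ) :=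
  Complex.ofRealCLM.contDiff.comp (h.of_le (by exact_mod_cast le_top))

namespace Wiener
theorem CS.ofReal {φ : (ι → ℝ) → ℝ} (h : CS φ) : CS fun x => (φ x : ℂ) := fun x hx => by
  change ((φ x : ℝ) : ℂ) = 0
  rw [h x hx, Complex.ofReal_zero]

open Classical in
/-- The element of the real Wiener algebra representing a real function. -/
noncomputable def rrep (s : ℕ) (φ : (ι → ℝ) → ℝ) : realSub ι s :=
  if h : rep s (fun x => (φ x : ℂ)) ∈ realSub ι s then ⟨_, h⟩ else 0

theorem coe_rrep {φ : (ι → ℝ) → ℝ} (hφ : ContDiff ℝ ∞ φ) (hs : CS φ) :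
    (rrep s φ : Wiener ι s) = rep s fun x => (φ x : ℂ) := by
  have h : rep s (fun x => (φ x : ℂ)) ∈ realSub ι s :=
    rep_mem_realSub (contDiff_ofReal_comp hφ) hs.ofReal fun x => Complex.ofReal_im _
  rw [rrep, dif_pos h]

theorem evR_rrep {φ : (ι → ℝ) → ℝ} (hφ : ContDiff ℝ ∞ φ) (hs : CS φ) {x : ι → ℝ}
    (hx : x ∈ cube ι) : evR x (rrep s φ) = φ x := by
  rw [evR_eq_re, coe_rrep hφ hs, evL_rep (contDiff_ofReal_comp hφ) hs.ofReal hx,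
    Complex.ofReal_re]

theorem tendsto_rrep [DecidableEq ι] {P : Type*} [NormedAddCommGroup P] [NormedSpace ℝ P]
    {Θ : P × (ι → ℝ) → ℝ} (h : ContDiff ℝ ∞ Θ)
    (hs : ∀ p, CS fun x => Θ (p, x)) (h0 : ∀ x, Θ (0, x) = 0) :
    Tendsto (fun p => rrep s fun x => Θ (p, x)) (𝓝 0) (𝓝 0) := by
  have h1 := tendsto_rep (s := s) (Θ := fun q => (Θ q : ℂ)) (contDiff_ofReal_comp h)
    (fun p => (hs p).ofReal) (fun x => by rw [h0, Complex.ofReal_zero])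
  rw [tendsto_subtype_rng]
  refine h1.congr fun p => ?_
  exact (coe_rrep (φ := fun x => Θ (p, x)) (h.comp (contDiff_prodMk_right p)) (hs p)).symm
end Wiener

/-- A smooth cutoff function equal to one on the ball of radius `1/8` and supported in the ball of
radius `1/4`. -/
theorem exists_cutoff (ι : Type*) [Fintype ι] {r R : ℝ} (hr : 0 < r) (hR : r < R) :
    ∃ χ : (ι → ℝ) → ℝ, ContDiff ℝ ∞ χ ∧ (∀ x, ‖x‖ ≤ r → χ x = 1) ∧ ∀ x, R ≤ ‖x‖ → χ x = 0 := by
  let f : ContDiffBump (0 : ι → ℝ) := ⟨r, R, hr, hR⟩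
  refine ⟨f, f.contDiff, fun x hx => f.one_of_mem_closedBall ?_, fun x hx => ?_⟩
  · simpa using hx
  · exact f.zero_of_le_dist (by simpa using hx)

/-- Existence of coordinates in which the divergence of the structure is constant. -/
theorem exists_gauge [DecidableEq ι] (s : ℕ) {I₀ : Matrix ι ι ℝ} (hI : ∀ i j, I₀ i j = -I₀ j i)
    (hI2 : I₀ * I₀ = -1) {J : (ι → ℝ) → Matrix ι ι ℝ} (hJ : ∀ i j, ContDiff ℝ ∞ fun x => J x i j)
    (hJ0 : J 0 = I₀) : ∃ ε : ℝ, 0 < ε ∧ ∃ (w : (ι → ℝ) → ι → ℝ) (W B : (ι → ℝ) → Matrix ι ι ℝ)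
      (G : ι → (ι → ℝ) → Matrix ι ι ℝ) (c : ι → ℝ),
      ContDiff ℝ s w ∧ w 0 = 0 ∧
      (∀ x A, HasFDerivAt (fun y => w y A)
        (∑ M, W x M A • ContinuousLinearMap.proj (R := ℝ) (φ := fun _ : ι => ℝ) M) x) ∧
      W 0 = 1 ∧ (∀ x, B x * W x = 1) ∧
      (∀ x N A, HasFDerivAt (fun y => W y N A)
        (∑ M, G M x N A • ContinuousLinearMap.proj (R := ℝ) (φ := fun _ : ι => ℝ) M) x) ∧
      ∀ᶠ x in 𝓝 0, ∀ C, ∑ A, ∑ M, B x A M * (B x *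
        ((Matrix.of fun i j => ε * dx M (fun y => J y i j) (ε • x)) * W x + J (ε • x) * G M x
          - G M x * (B x * J (ε • x) * W x))) A C = c C := by
  obtain ⟨χ, hχ, hχ1, hχ0⟩ := exists_cutoff ι (r := 1/8) (R := 1/4) (by norm_num) (by norm_num)
  set T : ι → realSub ι s →L[ℝ] realSub ι s := fun M => RR1 M - (constAt 0).comp (RR1 M) with hT
  obtain ⟨φ, hφ, hφ0, hfix, -⟩ := exists_fixedPoint (fixMap T RR2 I₀)
    (vanishY_fixMap T RR2 I₀).1 (vanishY_fixMap T RR2 I₀).2.1 (vanishY_fixMap T RR2 I₀).2.2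
  -- the parameters
  set Θa : ι → ι → ℝ × (ι → ℝ) → ℝ := fun i j q => χ q.2 * (J (q.1 • q.2) i j - I₀ i j) with hΘa
  set Θb : ι → ι → ι → ℝ × (ι → ℝ) → ℝ :=
    fun M i j q => χ q.2 * (q.1 * dx M (fun y => J y i j) (q.1 • q.2)) with hΘb
  have hΘas : ∀ i j, ContDiff ℝ ∞ (Θa i j) := fun i j =>
    (hχ.comp contDiff_snd).mul (((hJ i j).comp (contDiff_fst.smul contDiff_snd)).sub contDiff_const)
  have hdx : ∀ M i j, ContDiff ℝ ∞ (dx M fun y => J y i j) := fun M i j =>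
    ((hJ i j).fderiv_right (m := ∞) (by simp)).clm_apply contDiff_const
  have hΘbs : ∀ M i j, ContDiff ℝ ∞ (Θb M i j) := fun M i j =>
    (hχ.comp contDiff_snd).mul
      (contDiff_fst.mul ((hdx M i j).comp (contDiff_fst.smul contDiff_snd)))
  have hχs : ∀ x, 1/3 < ‖x‖ → χ x = 0 := fun x hx => hχ0 x (by linarith)
  have hΘac : ∀ i j ε, CS fun x => Θa i j (ε, x) := fun i j ε x hx => by
    simp only [hΘa, hχs x hx, zero_mul]
  have hΘbc : ∀ M i j ε, CS fun x => Θb M i j (ε, x) := fun M i j ε x hx => by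
    simp only [hΘb, hχs x hx, zero_mul]
  set p : ℝ → Par ι (realSub ι s) := fun ε => (fun i j => rrep s fun x => Θa i j (ε, x),
    fun M i j => rrep s fun x => Θb M i j (ε, x)) with hp
  have hp0 : Tendsto p (𝓝 0) (𝓝 0) := by
    refine Tendsto.prodMk_nhds ?_ ?_
    · exact tendsto_pi_nhds.2 fun i => tendsto_pi_nhds.2 fun j =>
        tendsto_rrep (hΘas i j) (hΘac i j) fun x => by simp [hΘa, hJ0]
    · exact tendsto_pi_nhds.2 fun M => tendsto_pi_nhds.2 fun i => tendsto_pi_nhds.2 fun j =>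
        tendsto_rrep (hΘbs M i j) (hΘbc M i j) fun x => by simp [hΘb]
  have hev : ∀ᶠ ε in 𝓝[>] (0 : ℝ), fixMap T RR2 I₀ (p ε, φ (p ε)) = φ (p ε) :=
    (hp0.eventually hfix).filter_mono nhdsWithin_le_nhds
  obtain ⟨ε, hεp, hε⟩ := (hev.and self_mem_nhdsWithin).exists
  have h12 := fun x => of_fixed_map T RR2 I₀ (evR x) RR2_comm hI hI2 (q := (p ε, φ (p ε))) hεp
  set q : Par ι (realSub ι s) × Unk ι (realSub ι s) := (p ε, φ (p ε)) with hq
  set g := q.2.1 with hg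
  refine ⟨ε, hε, fun x A => x A + (evR x (RR (g A)) - evR 0 (RR (g A))
      - ∑ M, x M * evR 0 (RR1 M (g A))), fun x => (1 + om T g).map (evR x),
    fun x => (1 + matC q).map (evR x), fun M x => (hess RR2 M g).map (evR x),
    fun C => ∑ N, evR 0 ((g N - ∑ i, RR2 i i (g N))) * I₀ N C, ?_, ?_, ?_, ?_, ?_, ?_, ?_⟩
  · refine contDiff_pi.2 fun A => (contDiff_apply ℝ ℝ A).add ?_
    refine ((contDiff_evR _).sub contDiff_const).sub (ContDiff.sum fun M _ => ?_)
    exact (contDiff_apply ℝ ℝ M).mul contDiff_const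
  · funext A; simp
  · intro x A
    have h3 : HasFDerivAt (fun y : ι → ℝ => ∑ M, y M * evR 0 (RR1 M (g A)))
        (∑ M, evR 0 (RR1 M (g A)) •
          ContinuousLinearMap.proj (R := ℝ) (φ := fun _ : ι => ℝ) M) x :=
      HasFDerivAt.fun_sum fun M _ => (hasFDerivAt_apply M x).mul_const _
    refine ((hasFDerivAt_apply A x).fun_add
      (((hasFDerivAt_evR_RR (g A) x).sub_const _).fun_sub h3)).congr_fderiv ?_
    ext v
    simp [om, hT, Matrix.one_apply, add_mul, sub_mul, Finset.sum_add_distrib,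
      Finset.sum_sub_distrib, apply_ite, evR_constAt]
  · ext i j
    by_cases hij : i = j <;> simp [om, hT, Matrix.one_apply, hij, evR_constAt]
  · exact fun x => (h12 x).1
  · intro x N A
    have h3 := ((hasFDerivAt_evR_RR1 N (g A) x).sub_const (evR 0 (RR1 N (g A)))).const_add
      (evR x ((1 : Matrix ι ι (realSub ι s)) N A))
    refine (h3.congr_of_eventuallyEq (Eventually.of_forall fun y => ?_)).congr_fderiv ?_
    · by_cases hij : N = A <;> simp [om, hT, Matrix.one_apply, hij, evR_constAt]
    · rfl
  · filter_upwards [Metric.ball_mem_nhds (0 : ι → ℝ) (by norm_num : (0 : ℝ) < 1/8)] with x hx C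
    have hx' : ‖x‖ < 1/8 := by simpa using hx
    have hxc : x ∈ cube ι := mem_cube (by linarith)
    have hχx : χ x = 1 := hχ1 x hx'.le
    have ha : I₀ + (matA q).map (evR x) = J (ε • x) := by
      ext i j
      simp only [Matrix.map_apply, Matrix.add_apply, matA,
        Matrix.of_apply, hq, hp]
      rw [evR_rrep (φ := fun x => Θa i j (ε, x)) ((hΘas i j).comp (contDiff_prodMk_right ε)) (hΘac i j ε) hxc]
      simp [hΘa, hχx]
    have hb : ∀ M, (matB M q).map (evR x)
        = Matrix.of fun i j => ε * dx M (fun y => J y i j) (ε • x) := by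
      intro M
      ext i j
      simp only [Matrix.map_apply, matB, Matrix.of_apply, hq, hp]
      rw [evR_rrep (φ := fun x => Θb M i j (ε, x)) ((hΘbs M i j).comp (contDiff_prodMk_right ε)) (hΘbc M i j ε) hxc]
      simp [hΘb, hχx]
    have h3 := (h12 x).2 C
    rw [ha] at h3
    refine Eq.trans ?_ (h3.trans ?_)
    · refine Finset.sum_congr rfl fun A _ => Finset.sum_congr rfl fun M _ => ?_
      rw [hb M]
    · refine Finset.sum_congr rfl fun N _ => ?_
      rw [sum_RR2, sub_sub_cancel, evR_meanR x 0]
end NN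

namespace NN
open scoped BigOperators Topology ContDiff
open Filter
open Wiener

set_option linter.unusedSectionVars false

section dxlemmas
variable {ι : Type*} [Fintype ι] [DecidableEq ι] {F : Type*} [NormedAddCommGroup F]
  [NormedSpace ℝ F] {𝔸 : Type*} [NormedCommRing 𝔸] [NormedAlgebra ℝ 𝔸]

theorem dx_congr {f g : (ι → ℝ) → F} {x : ι → ℝ} (h : f =ᶠ[𝓝 x] g) (j : ι) :
    dx j f x = dx j g x := by
  rw [dx, h.fderiv_eq, dx]

theorem dx_const (j : ι) (c : F) (x : ι → ℝ) : dx j (fun _ => c) x = 0 := by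
  rw [dx, fderiv_fun_const]; rfl

theorem dx_add {f g : (ι → ℝ) → F} {x : ι → ℝ} (hf : DifferentiableAt ℝ f x)
    (hg : DifferentiableAt ℝ g x) (j : ι) :
    dx j (fun y => f y + g y) x = dx j f x + dx j g x := by
  rw [dx, fderiv_fun_add hf hg]; rfl

theorem dx_sub {f g : (ι → ℝ) → F} {x : ι → ℝ} (hf : DifferentiableAt ℝ f x)
    (hg : DifferentiableAt ℝ g x) (j : ι) :
    dx j (fun y => f y - g y) x = dx j f x - dx j g x := by
  rw [dx, fderiv_fun_sub hf hg]; rfl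

theorem dx_sum {κ : Type*} {s : Finset κ} {f : κ → (ι → ℝ) → F} {x : ι → ℝ}
    (hf : ∀ k ∈ s, DifferentiableAt ℝ (f k) x) (j : ι) :
    dx j (fun y => ∑ k ∈ s, f k y) x = ∑ k ∈ s, dx j (f k) x := by
  rw [dx, fderiv_fun_sum hf, _root_.sum_apply]; rfl

theorem dx_mul {f g : (ι → ℝ) → 𝔸} {x : ι → ℝ} (hf : DifferentiableAt ℝ f x)
    (hg : DifferentiableAt ℝ g x) (j : ι) :
    dx j (fun y => f y * g y) x = dx j f x * g x + f x * dx j g x := by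
  rw [dx, fderiv_fun_mul hf hg, _root_.add_apply, _root_.smul_apply, _root_.smul_apply,
    smul_eq_mul, smul_eq_mul, add_comm, mul_comm (g x)]; rfl

theorem fderiv_eq_sum_dx (f : (ι → ℝ) → F) (x v : ι → ℝ) :
    fderiv ℝ f x v = ∑ j, v j • dx j f x := by
  conv_lhs => rw [pi_eq_sum_univ' v, map_sum]
  refine Finset.sum_congr rfl fun j _ => ?_
  rw [map_smul, dx]

theorem dx_of_hasFDerivAt {f : (ι → ℝ) → ℝ} {x : ι → ℝ} {a : ι → ℝ}
    (h : HasFDerivAt f (∑ M, a M • ContinuousLinearMap.proj (R := ℝ) (φ := fun _ : ι => ℝ) M) x)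
    (j : ι) : dx j f x = a j := by
  rw [dx, h.fderiv]
  simp [Pi.single_apply]

theorem dx_comp {κ : Type*} [Fintype κ] [DecidableEq κ] {w : (ι → ℝ) → κ → ℝ} {φ : (κ → ℝ) → F}
    {x : ι → ℝ} (hw : DifferentiableAt ℝ w x) (hφ : DifferentiableAt ℝ φ (w x)) (j : ι) :
    dx j (fun y => φ (w y)) x = ∑ A, dx j (fun y => w y A) x • dx A φ (w x) := by
  have h : HasFDerivAt (fun y => φ (w y)) ((fderiv ℝ φ (w x)).comp (fderiv ℝ w x)) x :=
    hφ.hasFDerivAt.comp x hw.hasFDerivAt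
  rw [dx, h.fderiv, ContinuousLinearMap.comp_apply, fderiv_eq_sum_dx]
  refine Finset.sum_congr rfl fun A _ => ?_
  congr 1
  have h2 : HasFDerivAt (fun y => w y A) ((ContinuousLinearMap.proj A).comp (fderiv ℝ w x)) x :=
    (ContinuousLinearMap.proj (R := ℝ) (φ := fun _ : κ => ℝ) A).hasFDerivAt.comp x hw.hasFDerivAt
  rw [dx, h2.fderiv]
  rfl

theorem contDiffAt_dx {φ : (ι → ℝ) → F} {m : ℕ} {x : ι → ℝ} (h : ContDiffAt ℝ (m + 1 : ℕ) φ x)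
    (j : ι) : ContDiffAt ℝ m (dx j φ) x :=
  (h.fderiv_right (m := m) (by norm_cast)).clm_apply contDiffAt_const

theorem dx_comm {φ : (ι → ℝ) → F} {x : ι → ℝ} (h : ContDiffAt ℝ 2 φ x) (i j : ι) :
    dx i (dx j φ) x = dx j (dx i φ) x := by
  have h1 : DifferentiableAt ℝ (fderiv ℝ φ) x :=
    (h.fderiv_right (m := 1) (by norm_num)).differentiableAt (by norm_num)
  have h2 : ∀ i j, dx i (dx j φ) x
      = fderiv ℝ (fderiv ℝ φ) x (Pi.single i 1) (Pi.single j 1) := fun i j => by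
    have := h1.hasFDerivAt.clm_apply (hasFDerivAt_const (Pi.single j (1 : ℝ)) x)
    rw [dx]
    change fderiv ℝ (fun y => fderiv ℝ φ y (Pi.single j 1)) x _ = _
    rw [this.fderiv]
    simp
  rw [h2, h2]
  exact (h.isSymmSndFDerivAt (by simp)) _ _
end dxlemmas

section curl
variable {ι : Type*} [Fintype ι] [DecidableEq ι]

/-- The exterior derivative of a one-form. -/
noncomputable def ext1 (α : ι → (ι → ℝ) → ℝ) (x : ι → ℝ) : Matrix ι ι ℝ :=
  Matrix.of fun M N => dx M (α N) x - dx N (α M) x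

/-- The curl of a column of a matrix field. -/
noncomputable def curl (J : (ι → ℝ) → Matrix ι ι ℝ) (K : ι) (x : ι → ℝ) : Matrix ι ι ℝ :=
  ext1 (fun N y => J y N K) x

/-- Vanishing of the Nijenhuis tensor in matrix form. -/
def Integ (J : (ι → ℝ) → Matrix ι ι ℝ) (x : ι → ℝ) : Prop :=
  ∀ K, curl J K x = J x * curl J K x * (J x).transpose

theorem sum_smul_curl {J : (ι → ℝ) → Matrix ι ι ℝ} {a : ι → (ι → ℝ) → ℝ} {x : ι → ℝ}
    (hJ : ∀ i j, DifferentiableAt ℝ (fun y => J y i j) x) (hJ2 : J x * J x = -1)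
    (ha : ∀ K, DifferentiableAt ℝ (a K) x) (hs : ∀ M K, dx M (a K) x = dx K (a M) x) :
    ∑ K, a K x • (curl J K x - J x * curl J K x * (J x).transpose) =
      ext1 (fun N y => ∑ K, J y N K * a K y) x
        - J x * ext1 (fun N y => ∑ K, J y N K * a K y) x * (J x).transpose := by
  set H : Matrix ι ι ℝ := Matrix.of fun M K => dx M (a K) x with hH
  have hHs : H.transpose = H := by
    ext M K; exact (hs M K).symm
  have h1 : ext1 (fun N y => ∑ K, J y N K * a K y) x
      = ∑ K, a K x • curl J K x + (H * (J x).transpose - J x * H) := by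
    have h2 : ∀ M N, dx M (fun y => ∑ K, J y N K * a K y) x
        = ∑ K, (a K x * dx M (fun y => J y N K) x + J x N K * dx M (a K) x) := fun M N => by
      rw [dx_sum fun K _ => (hJ N K).fun_mul (ha K)]
      exact Finset.sum_congr rfl fun K _ => by rw [dx_mul (hJ N K) (ha K)]; ring
    ext M N
    simp only [ext1, Matrix.of_apply, h2, Matrix.add_apply, Matrix.sum_apply, Matrix.smul_apply,
      Matrix.sub_apply, Matrix.mul_apply, Matrix.transpose_apply, curl, smul_eq_mul, hH,
      ← Finset.sum_sub_distrib, ← Finset.sum_add_distrib]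
    exact Finset.sum_congr rfl fun K _ => by rw [hs N K]; ring
  have hT : (J x).transpose * (J x).transpose = -1 := by
    rw [← Matrix.transpose_mul, hJ2, Matrix.transpose_neg, Matrix.transpose_one]
  rw [h1]
  have h3 : J x * (H * (J x).transpose - J x * H) * (J x).transpose
      = H * (J x).transpose - J x * H := by
    have : J x * (H * (J x).transpose - J x * H) * (J x).transpose
      = J x * H * ((J x).transpose * (J x).transpose) - (J x * J x) * H * (J x).transpose := by
      noncomm_ring
    rw [this, hT, hJ2]
    noncomm_ring
  simp only [mul_add, add_mul, h3, smul_sub, Finset.sum_sub_distrib, Finset.mul_sum,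
    Finset.sum_mul, Matrix.mul_smul, Matrix.smul_mul]
  abel

/-- The exterior derivative commutes with pullback. -/
theorem ext1_pullback {w : (ι → ℝ) → ι → ℝ} {W : (ι → ℝ) → Matrix ι ι ℝ} {β : ι → (ι → ℝ) → ℝ}
    {x : ι → ℝ} (hw : DifferentiableAt ℝ w x) (hW : ∀ M A, dx M (fun y => w y A) x = W x M A)
    (hWd : ∀ M A, DifferentiableAt ℝ (fun y => W y M A) x)
    (hs : ∀ M N A, dx M (fun y => W y N A) x = dx N (fun y => W y M A) x)
    (hβ : ∀ A, DifferentiableAt ℝ (β A) (w x)) :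
    ext1 (fun N y => ∑ A, W y N A * β A (w y)) x = W x * ext1 β (w x) * (W x).transpose := by
  have hβw : ∀ A, DifferentiableAt ℝ (fun y => β A (w y)) x := fun A => (hβ A).comp x hw
  have h2 : ∀ M N, dx M (fun y => ∑ A, W y N A * β A (w y)) x
      = ∑ A, (dx M (fun y => W y N A) x * β A (w x))
        + ∑ A, ∑ B, W x M B * dx B (β A) (w x) * W x N A := fun M N => by
    rw [dx_sum fun A _ => (hWd N A).fun_mul (hβw A), ← Finset.sum_add_distrib]
    refine Finset.sum_congr rfl fun A _ => ?_
    rw [dx_mul (hWd N A) (hβw A), dx_comp hw (hβ A), Finset.mul_sum]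
    simp only [hW, smul_eq_mul]
    congr 1
    exact Finset.sum_congr rfl fun B _ => by ring
  ext M N
  simp only [ext1, Matrix.of_apply, h2, Matrix.mul_apply, Matrix.transpose_apply, mul_sub, sub_mul,
    Finset.sum_sub_distrib, Finset.sum_mul]
  simp only [hs M N]
  rw [add_sub_add_left_eq_sub]
  congr 1
  rw [Finset.sum_comm]
  exact Finset.sum_congr rfl fun B _ => Finset.sum_congr rfl fun A _ => by ring

/-- Integrability is invariant under coordinate changes. -/
theorem Integ.transport {w : (ι → ℝ) → ι → ℝ} {W I J : (ι → ℝ) → Matrix ι ι ℝ}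
    {x : ι → ℝ} (h : Integ I x) (hI : ∀ i j, DifferentiableAt ℝ (fun y => I y i j) x)
    (hI2 : I x * I x = -1) (hw : DifferentiableAt ℝ w x)
    (hW : ∀ M A, dx M (fun y => w y A) x = W x M A)
    (hWd : ∀ M A, DifferentiableAt ℝ (fun y => W y M A) x)
    (hs : ∀ M N A, dx M (fun y => W y N A) x = dx N (fun y => W y M A) x)
    {B : Matrix ι ι ℝ} (hB : B * W x = 1)
    (hJ : ∀ i j, DifferentiableAt ℝ (fun y => J y i j) (w x))
    (hJI : ∀ᶠ y in 𝓝 x, W y * J (w y) = I y * W y) : Integ J (w x) := by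
  intro C
  have h1 := sum_smul_curl hI hI2 (fun K => hWd K C) (fun M K => hs M K C)
  have h2 : ∀ N, (fun y => ∑ K, I y N K * W y K C) =ᶠ[𝓝 x] fun y => ∑ A, W y N A * J (w y) A C :=
    fun N => hJI.mono fun y hy => by
      have := congrFun (congrFun hy N) C
      rw [Matrix.mul_apply, Matrix.mul_apply] at this
      exact this.symm
  have h3 : ext1 (fun N y => ∑ K, I y N K * W y K C) x = W x * curl J C (w x) * (W x).transpose := by
    rw [curl, ← ext1_pullback hw hW hWd hs fun A => hJ A C]
    ext M N
    simp only [ext1, Matrix.of_apply]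
    rw [dx_congr (h2 N), dx_congr (h2 M)]
  have h4 : I x * W x = W x * J (w x) := hJI.self_of_nhds.symm
  rw [h3] at h1
  have h5 : (0 : Matrix ι ι ℝ) = W x * (curl J C (w x) - J (w x) * curl J C (w x)
      * (J (w x)).transpose) * (W x).transpose := by
    have h6 : I x * (W x * curl J C (w x) * (W x).transpose) * (I x).transpose
        = (I x * W x) * curl J C (w x) * (I x * W x).transpose := by
      rw [Matrix.transpose_mul]; noncomm_ring
    have h7 : ∑ K, W x K C • (curl I K x - I x * curl I K x * (I x).transpose) = 0 :=
      Finset.sum_eq_zero fun K _ => by rw [← h K, sub_self, smul_zero]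
    rw [h6, h4, Matrix.transpose_mul, h7] at h1
    rw [h1]; noncomm_ring
  have hB' : (W x).transpose * B.transpose = 1 := by
    rw [← Matrix.transpose_mul, hB, Matrix.transpose_one]
  rw [← sub_eq_zero]
  calc _ = (B * W x) * (curl J C (w x) - J (w x) * curl J C (w x) * (J (w x)).transpose)
        * ((W x).transpose * B.transpose) := by rw [hB, hB', one_mul, mul_one]
    _ = B * (W x * (curl J C (w x) - J (w x) * curl J C (w x) * (J (w x)).transpose)
        * (W x).transpose) * B.transpose := by simp only [mul_assoc]
    _ = 0 := by rw [← h5, mul_zero, zero_mul]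
end curl
end NN

namespace NN
open scoped BigOperators Topology ContDiff
open Filter
open Wiener

theorem natCast_ne_infty (n : ℕ) : (n : WithTop ℕ∞) ≠ ∞ := by
  intro h
  have : ((n : ℕ∞) : WithTop ℕ∞) = ((⊤ : ℕ∞) : WithTop ℕ∞) := h
  exact ENat.natCast_ne_top n (WithTop.coe_injective this)

/-- The inverse function theorem, as an existence statement. -/
theorem exists_local_inverse {𝕂 E F : Type*} [RCLike 𝕂] [NormedAddCommGroup E] [NormedSpace 𝕂 E]
    [CompleteSpace E] [NormedAddCommGroup F] [NormedSpace 𝕂 F] {f : E → F} {f' : E ≃L[𝕂] F} {a : E}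
    {n : WithTop ℕ∞} (hf : ContDiffAt 𝕂 n f a) (hf' : HasFDerivAt f (f' : E →L[𝕂] F) a)
    (hn : n ≠ 0) : ∃ u : F → E, ContDiffAt 𝕂 n u (f a) ∧ u (f a) = a ∧
      (∀ᶠ x in 𝓝 a, u (f x) = x) ∧ ∀ᶠ y in 𝓝 (f a), f (u y) = y :=
  ⟨hf.localInverse hf' hn, hf.to_localInverse hf' hn, hf.localInverse_apply_image hf' hn,
    (hf.hasStrictFDerivAt' hf' hn).eventually_left_inverse,
    (hf.hasStrictFDerivAt' hf' hn).eventually_right_inverse⟩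

set_option linter.unusedSectionVars false

section
variable {ι : Type*} [Fintype ι] [DecidableEq ι]

/-- Entrywise partial derivative of a matrix field. -/
noncomputable def mdx (M : ι) (A : (ι → ℝ) → Matrix ι ι ℝ) (x : ι → ℝ) : Matrix ι ι ℝ :=
  Matrix.of fun i j => dx M (fun y => A y i j) x

/-- Entrywise differentiability of a matrix field. -/
def MDiff (A : (ι → ℝ) → Matrix ι ι ℝ) (x : ι → ℝ) : Prop :=
  ∀ i j, DifferentiableAt ℝ (fun y => A y i j) x

theorem MDiff.mul {A B : (ι → ℝ) → Matrix ι ι ℝ} {x : ι → ℝ} (hA : MDiff A x) (hB : MDiff B x) :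
    MDiff (fun y => A y * B y) x := fun i j => by
  simp only [Matrix.mul_apply]
  exact DifferentiableAt.fun_sum fun k _ => (hA i k).fun_mul (hB k j)

theorem mdx_mul {A B : (ι → ℝ) → Matrix ι ι ℝ} {x : ι → ℝ} (hA : MDiff A x) (hB : MDiff B x)
    (M : ι) : mdx M (fun y => A y * B y) x = mdx M A x * B x + A x * mdx M B x := by
  ext i j
  simp only [mdx, Matrix.of_apply, Matrix.mul_apply, Matrix.add_apply]
  rw [dx_sum fun k _ => (hA i k).fun_mul (hB k j), ← Finset.sum_add_distrib]
  exact Finset.sum_congr rfl fun k _ => dx_mul (hA i k) (hB k j) M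

theorem mdx_congr {A B : (ι → ℝ) → Matrix ι ι ℝ} {x : ι → ℝ} (h : A =ᶠ[𝓝 x] B) (M : ι) :
    mdx M A x = mdx M B x := by
  ext i j
  exact dx_congr (h.mono fun y hy => by rw [hy]) M

/-- After a suitable coordinate change, an integrable structure has constant divergence. -/
theorem exists_divergence_const (m : ℕ) {I₀ : Matrix ι ι ℝ} (hI : ∀ i j, I₀ i j = -I₀ j i)
    (hI2 : I₀ * I₀ = -1) {Jo : (ι → ℝ) → Matrix ι ι ℝ}
    (hJo : ∀ i j, ContDiff ℝ ∞ fun x => Jo x i j) (hJ0 : Jo 0 = I₀)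
    (hJsq : ∀ᶠ x in 𝓝 0, Jo x * Jo x = -1) (hinteg : ∀ᶠ x in 𝓝 0, Integ Jo x) :
    ∃ ε : ℝ, 0 < ε ∧ ∃ (w : (ι → ℝ) → ι → ℝ) (J : (ι → ℝ) → Matrix ι ι ℝ) (c : ι → ℝ),
      ContDiff ℝ (m + 2 : ℕ) w ∧ w 0 = 0 ∧ HasFDerivAt w (ContinuousLinearMap.id ℝ (ι → ℝ)) 0 ∧
      (∀ i j, ContDiffAt ℝ (m + 1 : ℕ) (fun y => J y i j) 0) ∧ J 0 = I₀ ∧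
      (∀ᶠ y in 𝓝 0, J y * J y = -1) ∧ (∀ᶠ y in 𝓝 0, Integ J y) ∧
      (∀ᶠ y in 𝓝 0, ∀ C, ∑ A, dx A (fun y => J y A C) y = c C) ∧
      ∀ᶠ x in 𝓝 0, (Matrix.of fun M A => dx M (fun y => w y A) x) * J (w x)
        = Jo (ε • x) * Matrix.of fun M A => dx M (fun y => w y A) x := by
  obtain ⟨ε, hε, w, W, B, G, c, hw, hw0, hW, hW0, hBW, hG, hdiv⟩ :=
    exists_gauge (m + 2) hI hI2 hJo hJ0
  have hWx : ∀ x M A, dx M (fun y => w y A) x = W x M A := fun x M A => dx_of_hasFDerivAt (hW x A) M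
  have hGx : ∀ x M N A, dx M (fun y => W y N A) x = G M x N A :=
    fun x M N A => dx_of_hasFDerivAt (hG x N A) M
  have hWof : ∀ x, (Matrix.of fun M A => dx M (fun y => w y A) x) = W x := fun x => by
    ext M A; exact hWx x M A
  have hWd : ∀ x, MDiff W x := fun x M A => (hG x M A).differentiableAt
  have hwx : ∀ A, ContDiff ℝ (m + 2 : ℕ) fun x => w x A := fun A => contDiff_pi.1 hw A
  have hwd : ∀ x, DifferentiableAt ℝ w x := fun x =>
    hw.contDiffAt.differentiableAt (by norm_cast)
  have hWB : ∀ x, W x * B x = 1 := fun x => mul_eq_one_comm.1 (hBW x)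
  have hsym : ∀ x M N A, dx M (fun y => W y N A) x = dx N (fun y => W y M A) x := by
    intro x M N A
    have h1 : ∀ N, (fun y => W y N A) = dx N fun y => w y A := fun N => by
      funext y; exact (hWx y N A).symm
    rw [h1, h1]
    exact dx_comm ((hwx A).contDiffAt.of_le (by norm_cast; omega)) _ _
  have hWs : ∀ M A, ContDiff ℝ (m + 1 : ℕ) fun x => W x M A := fun M A => by
    have : (fun y => W y M A) = dx M fun y => w y A := by
      funext y; exact (hWx y M A).symm
    rw [this]
    exact contDiff_dx (hwx A) M
  have hwid : HasFDerivAt w (ContinuousLinearMap.id ℝ (ι → ℝ)) 0 := by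
    rw [hasFDerivAt_pi']
    intro A
    refine (hW 0 A).congr_fderiv ?_
    ext v
    simp [hW0, Matrix.one_apply]
  obtain ⟨u, hu, hu0, huw, hwu⟩ := exists_local_inverse (f' := ContinuousLinearEquiv.refl ℝ (ι → ℝ))
    hw.contDiffAt (a := 0) hwid (n := (m + 2 : ℕ)) (by norm_cast)
  rw [hw0] at hu hu0 hwu
  set I : (ι → ℝ) → Matrix ι ι ℝ := fun x => Jo (ε • x) with hIdef
  have hεt : Tendsto (fun x : ι → ℝ => ε • x) (𝓝 0) (𝓝 0) := by
    have : Continuous fun x : ι → ℝ => ε • x := continuous_const_smul ε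
    simpa using this.tendsto 0
  have hIs : ∀ i j, ContDiff ℝ ∞ fun x => I x i j := fun i j =>
    (hJo i j).comp (contDiff_const_smul ε)
  have hId : ∀ x, MDiff I x := fun x i j => (hIs i j).contDiffAt.differentiableAt (by simp)
  have hIdx : ∀ M x, mdx M I x = Matrix.of fun i j => ε * dx M (fun y => Jo y i j) (ε • x) := by
    intro M x
    ext i j
    have h1 := ((hJo i j).contDiffAt (x := ε • x)).differentiableAt (by simp)
    have h2 : HasFDerivAt (fun y : ι → ℝ => ε • y) (ε • ContinuousLinearMap.id ℝ (ι → ℝ)) x :=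
      (hasFDerivAt_id x).const_smul ε
    have h3 := h1.hasFDerivAt.comp x h2
    change fderiv ℝ ((fun y => Jo y i j) ∘ fun y => ε • y) x _ = _
    rw [h3.fderiv]
    simp [dx]
  have hIint : ∀ᶠ x in 𝓝 0, Integ I x := by
    filter_upwards [hεt.eventually hinteg] with x hx K
    have h1 : curl I K x = ε • curl Jo K (ε • x) := by
      ext M N
      have := congrFun (congrFun (hIdx M x) N) K
      have h2 := congrFun (congrFun (hIdx N x) M) K
      simp only [mdx, Matrix.of_apply] at this h2
      simp only [curl, ext1, Matrix.of_apply, this, h2, Matrix.smul_apply, smul_eq_mul, mul_sub]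
    rw [h1]
    conv_lhs => rw [hx K]
    rw [Matrix.mul_smul, Matrix.smul_mul]
  have hIsq : ∀ᶠ x in 𝓝 0, I x * I x = -1 := hεt.eventually hJsq
  have hI00 : I 0 = I₀ := by simp only [hIdef, smul_zero, hJ0]
  have hwt : Tendsto w (𝓝 0) (𝓝 0) := by simpa [hw0] using hw.continuous.tendsto 0
  have hut : Tendsto u (𝓝 0) (𝓝 0) := by
    have := hu.continuousAt.tendsto; rwa [hu0] at this
  have hus : ∀ M, ContDiffAt ℝ (m + 2 : ℕ) (fun y => u y M) 0 := fun M => contDiffAt_pi.1 hu M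
  set Du : (ι → ℝ) → Matrix ι ι ℝ := fun y => Matrix.of fun A M => dx A (fun z => u z M) y with hDu
  have hDus : ∀ A M, ContDiffAt ℝ (m + 1 : ℕ) (fun y => Du y A M) 0 := fun A M =>
    contDiffAt_dx (m := m + 1) (hus M) A
  set J : (ι → ℝ) → Matrix ι ι ℝ := fun y => Du y * I (u y) * W (u y) with hJ
  have hJs : ∀ i j, ContDiffAt ℝ (m + 1 : ℕ) (fun y => J y i j) 0 := by
    intro i j
    have hu' : ContDiffAt ℝ (m + 1 : ℕ) u 0 := hu.of_le (by norm_cast; omega)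
    simp only [hJ, Matrix.mul_apply]
    refine ContDiffAt.sum fun k _ => ContDiffAt.mul (ContDiffAt.sum fun l _ => ?_) ?_
    · refine (hDus i l).mul (ContDiffAt.comp (g := fun x => I x l k) 0 ?_ hu')
      exact ((hIs l k).of_le (by exact_mod_cast le_top)).contDiffAt
    · exact ContDiffAt.comp (g := fun x => W x k j) 0 (hWs k j).contDiffAt hu'
  have hDuB : ∀ᶠ x in 𝓝 0, Du (w x) = B x := by
    have h1 : ∀ᶠ y in 𝓝 (0 : ι → ℝ), ContDiffAt ℝ (m + 2 : ℕ) u y :=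
      hu.eventually (natCast_ne_infty _)
    filter_upwards [hwt.eventually h1, huw.eventually_nhds] with x hx hux
    have h2 : W x * Du (w x) = 1 := by
      ext M N
      have h3 : (fun y => u (w y) N) =ᶠ[𝓝 x] fun y => y N := hux.mono fun y hy => congrFun hy N
      have h4 := dx_congr h3 M
      rw [dx_comp (φ := fun y => u y N) (hwd x)
        ((contDiffAt_pi.1 hx N).differentiableAt (by norm_cast))] at h4
      have h5 : dx M (fun y : ι → ℝ => y N) x = (1 : Matrix ι ι ℝ) M N := by
        rw [dx, (hasFDerivAt_apply N x).fderiv]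
        simp [Pi.single_apply, Matrix.one_apply, eq_comm]
      rw [h5] at h4
      rw [Matrix.mul_apply, ← h4]
      simp only [hWx, smul_eq_mul]
      rfl
    calc Du (w x) = B x * W x * Du (w x) := by rw [hBW, one_mul]
      _ = B x := by rw [mul_assoc, h2, mul_one]
  have hJw : ∀ᶠ x in 𝓝 0, J (w x) = B x * I x * W x := by
    filter_upwards [hDuB, huw] with x h1 h2
    simp only [hJ, h1, h2]
  have hWJ : ∀ᶠ x in 𝓝 0, W x * J (w x) = I x * W x := by
    filter_upwards [hJw] with x hx
    rw [hx, ← mul_assoc, ← mul_assoc, hWB, one_mul]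
  have hJd : ∀ᶠ y in 𝓝 0, MDiff J y := by
    have : ∀ᶠ y in 𝓝 (0 : ι → ℝ), ∀ i j, ContDiffAt ℝ (m + 1 : ℕ) (fun y => J y i j) y :=
      eventually_all.2 fun i => eventually_all.2 fun j => (hJs i j).eventually (natCast_ne_infty _)
    exact this.mono fun y hy i j => (hy i j).differentiableAt (by norm_cast)
  have hDud : ∀ᶠ y in 𝓝 0, MDiff Du y := by
    have : ∀ᶠ y in 𝓝 (0 : ι → ℝ), ∀ i j, ContDiffAt ℝ (m + 1 : ℕ) (fun y => Du y i j) y :=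
      eventually_all.2 fun i => eventually_all.2 fun j => (hDus i j).eventually (natCast_ne_infty _)
    exact this.mono fun y hy i j => (hy i j).differentiableAt (by norm_cast)
  have key : ∀ {Q : (ι → ℝ) → Prop}, (∀ᶠ x in 𝓝 0, Q (w x)) → ∀ᶠ y in 𝓝 0, Q y := by
    intro Q hQ
    filter_upwards [hut.eventually hQ, hwu] with y h1 h2
    rwa [h2] at h1
  refine ⟨ε, hε, w, J, c, hw, hw0, hwid, hJs, ?_, key ?_, key ?_, key ?_, ?_⟩
  · have h1 := hJw.self_of_nhds
    have h2 := hBW 0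
    rw [hW0, mul_one] at h2
    rw [hw0, hI00, hW0, h2, one_mul, mul_one] at h1
    exact h1
  · filter_upwards [hJw, hIsq] with x h1 h2
    rw [h1]
    calc _ = B x * I x * (W x * B x) * I x * W x := by noncomm_ring
      _ = B x * (I x * I x) * W x := by rw [hWB]; noncomm_ring
      _ = _ := by rw [h2, mul_neg, mul_one, neg_mul, hBW]
  · filter_upwards [hIint, hIsq, hwt.eventually hJd, hWJ.eventually_nhds] with x h1 h2 h3 h4
    exact h1.transport (hId x) h2 (hwd x) (hWx x) (hWd x) (hsym x) (hBW x) h3 h4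
  · filter_upwards [hdiv, hwt.eventually hJd, hwt.eventually hDud, hJw.eventually_nhds,
      hDuB.eventually_nhds] with x h1 h3 h4 h5 h6 C
    rw [← h1 C]
    have hBd : MDiff B x := fun i j => by
      have h7 : (fun y => Du (w y) i j) =ᶠ[𝓝 x] fun y => B y i j :=
        h6.mono fun y hy => congrFun (congrFun hy i) j
      exact h7.differentiableAt_iff.1 ((h4 i j).comp x (hwd x))
    have hmW : ∀ M, mdx M W x = G M x := fun M => by
      ext i j; exact hGx x M i j
    have hmB : ∀ M, mdx M B x = -(B x * G M x * B x) := fun M => by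
      have h7 : mdx M (fun y => B y * W y) x = 0 := by
        have : (fun y => B y * W y) = fun _ => (1 : Matrix ι ι ℝ) := funext hBW
        rw [this]
        ext i j
        exact dx_const _ _ _
      rw [mdx_mul hBd (hWd x), hmW] at h7
      have h8 : mdx M B x * (W x * B x) + B x * G M x * B x = 0 := by
        rw [← mul_assoc, ← add_mul, h7, zero_mul]
      rw [hWB, mul_one] at h8
      exact eq_neg_of_add_eq_zero_left h8
    have hmJ : ∀ M, mdx M (fun y => J (w y)) x = B x * (mdx M I x * W x + I x * G M x
        - G M x * (B x * I x * W x)) := fun M => by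
      rw [mdx_congr h5, mdx_mul (hBd.mul (hId x)) (hWd x), mdx_mul hBd (hId x), hmB, hmW]
      noncomm_ring
    have hchain : ∀ M i j, mdx M (fun y => J (w y)) x i j
        = ∑ A, W x M A * dx A (fun y => J y i j) (w x) := fun M i j => by
      change dx M (fun y => J (w y) i j) x = _
      rw [dx_comp (φ := fun y => J y i j) (hwd x) (h3 i j)]
      simp only [hWx, smul_eq_mul]
    have hinv : ∀ A i j, dx A (fun y => J y i j) (w x)
        = ∑ M, B x A M * mdx M (fun y => J (w y)) x i j := fun A i j => by
      simp only [hchain, Finset.mul_sum]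
      rw [Finset.sum_comm]
      have h7 : ∀ A', ∑ M, B x A M * (W x M A' * dx A' (fun y => J y i j) (w x))
          = (1 : Matrix ι ι ℝ) A A' * dx A' (fun y => J y i j) (w x) := fun A' => by
        rw [← hBW x, Matrix.mul_apply, Finset.sum_mul]
        exact Finset.sum_congr rfl fun M _ => by ring
      simp only [h7, Matrix.one_apply, ite_mul, one_mul, zero_mul, Finset.sum_ite_eq,
        Finset.mem_univ, if_true]
    refine Finset.sum_congr rfl fun A _ => ?_
    rw [hinv]
    refine Finset.sum_congr rfl fun M _ => ?_
    rw [hmJ, hIdx]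
  · filter_upwards [hWJ] with x hx
    rw [hWof, hx]
end
end NN

namespace NN
open scoped BigOperators Topology ContDiff
open Filter
open Wiener
set_option linter.unusedSectionVars false

section
variable {ι : Type*} [Fintype ι]

/-- Right-hand side of the elliptic equation satisfied by an integrable structure of constant
divergence. -/
def ellRhs {𝒜 : Type*} [CommRing 𝒜] (J f : ι → ι → 𝒜) (c : ι → 𝒜) (d1 : ι → ι → ι → 𝒜)
    (d2 : ι → ι → ι → ι → 𝒜) (N K : ι) : 𝒜 :=
  ∑ Q, J N Q * (∑ M, ∑ P, (f M P * d2 M P Q K + d1 Q M P * d1 M P K) + ∑ P, c P * d1 P Q K)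
    + ∑ M, ∑ P, ∑ Q, J M P * d1 M N Q * (d1 P Q K - d1 Q P K)

theorem map_ellRhs {𝒜 ℬ : Type*} [CommRing 𝒜] [CommRing ℬ] (e : 𝒜 →+* ℬ) (J f : ι → ι → 𝒜)
    (c : ι → 𝒜) (d1 : ι → ι → ι → 𝒜) (d2 : ι → ι → ι → ι → 𝒜) (N K : ι) :
    e (ellRhs J f c d1 d2 N K) = ellRhs (fun i j => e (J i j)) (fun i j => e (f i j))
      (fun i => e (c i)) (fun M i j => e (d1 M i j)) (fun M P i j => e (d2 M P i j)) N K := by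
  simp only [ellRhs, map_add, map_sum, map_mul, map_sub]

theorem ellRhs_smul {𝒜 : Type*} [CommRing 𝒜] (ε : 𝒜) (J f : ι → ι → 𝒜)
    (c : ι → 𝒜) (d1 : ι → ι → ι → 𝒜) (d2 : ι → ι → ι → ι → 𝒜) (N K : ι) :
    ellRhs J f (fun i => ε * c i) (fun M i j => ε * d1 M i j) (fun M P i j => ε ^ 2 * d2 M P i j) N K
      = ε ^ 2 * ellRhs J f c d1 d2 N K := by
  simp only [ellRhs, mul_add, Finset.mul_sum, Finset.sum_add_distrib]
  congr 1
  · congr 1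
    · congr 1
      all_goals
        exact Finset.sum_congr rfl fun _ _ => Finset.sum_congr rfl fun _ _ =>
          Finset.sum_congr rfl fun _ _ => by ring
    · exact Finset.sum_congr rfl fun _ _ => Finset.sum_congr rfl fun _ _ => by ring
  · exact Finset.sum_congr rfl fun _ _ => Finset.sum_congr rfl fun _ _ =>
      Finset.sum_congr rfl fun _ _ => by ring

variable [DecidableEq ι]

theorem sum_antisymm_mul_symm {𝒜 : Type*} [CommRing 𝒜] [IsAddTorsionFree 𝒜] {a b : ι → ι → 𝒜}
    (ha : ∀ i j, a i j = -a j i) (hb : ∀ i j, b i j = b j i) : ∑ i, ∑ j, a i j * b i j = 0 := by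
  have h : ∑ i, ∑ j, a i j * b i j = -∑ i, ∑ j, a i j * b i j := by
    conv_lhs => rw [Finset.sum_comm]
    rw [← Finset.sum_neg_distrib]
    refine Finset.sum_congr rfl fun i _ => ?_
    rw [← Finset.sum_neg_distrib]
    exact Finset.sum_congr rfl fun j _ => by rw [ha j i, hb j i]; ring
  exact self_eq_neg.1 h

/-- The elliptic equation. -/
theorem laplacian_eq {J : (ι → ℝ) → Matrix ι ι ℝ} {I₀ : Matrix ι ι ℝ}
    (hI : ∀ i j, I₀ i j = -I₀ j i) {c : ι → ℝ} {x : ι → ℝ}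
    (hJ : ∀ i j, ContDiffAt ℝ 2 (fun y => J y i j) x) (hsq : ∀ᶠ y in 𝓝 x, J y * J y = -1)
    (hinteg : ∀ᶠ y in 𝓝 x, Integ J y)
    (hdiv : ∀ᶠ y in 𝓝 x, ∀ C, ∑ A, dx A (fun y => J y A C) y = c C) (N K : ι) :
    ∑ M, dx M (dx M fun y => J y N K) x = ellRhs (fun i j => J x i j)
      (fun i j => J x i j - I₀ i j) c (fun M i j => dx M (fun y => J y i j) x)
      (fun M P i j => dx M (dx P fun y => J y i j) x) N K := by
  have hJd : ∀ i j, DifferentiableAt ℝ (fun y => J y i j) x := fun i j =>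
    (hJ i j).differentiableAt (by norm_num)
  have hJd' : ∀ᶠ y in 𝓝 x, ∀ i j, DifferentiableAt ℝ (fun y => J y i j) y :=
    eventually_all.2 fun i => eventually_all.2 fun j =>
      ((hJ i j).eventually (natCast_ne_infty 2)).mono fun y hy => hy.differentiableAt (by norm_num)
  have hD : ∀ M i j, DifferentiableAt ℝ (dx M fun y => J y i j) x := fun M i j =>
    (contDiffAt_dx (m := 1) (hJ i j) M).differentiableAt (by norm_num)
  set d1 : ι → ι → ι → ℝ := fun M i j => dx M (fun y => J y i j) x with hd1
  set d2 : ι → ι → ι → ι → ℝ := fun M P i j => dx M (dx P fun y => J y i j) x with hd2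
  have hcomm : ∀ M P i j, d2 M P i j = d2 P M i j := fun M P i j => dx_comm (hJ i j) M P
  have hc : ∀ P, ∑ M, d1 M M P = c P := hdiv.self_of_nhds
  -- differentiating the divergence
  have hdc : ∀ N K, ∑ M, d2 N M M K = 0 := fun N K => by
    have h1 : (fun y => ∑ M, dx M (fun y => J y M K) y) =ᶠ[𝓝 x] fun _ => c K :=
      hdiv.mono fun y hy => hy K
    have h2 := dx_congr h1 N
    rwa [dx_const, dx_sum fun M _ => hD M M K] at h2
  -- the laplacian as a divergence of the curl
  set Om : ι → ι → ι → (ι → ℝ) → ℝ := fun M N K y =>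
    dx M (fun y => J y N K) y - dx N (fun y => J y M K) y with hOm
  have hOmd : ∀ M N K, DifferentiableAt ℝ (Om M N K) x := fun M N K => (hD M N K).sub (hD N M K)
  have hdOm : ∀ L M N K, dx L (Om M N K) x = d2 L M N K - d2 L N M K := fun L M N K =>
    dx_sub (hD M N K) (hD N M K) L
  have h1 : ∑ M, d2 M M N K = ∑ M, dx M (Om M N K) x := by
    simp only [hdOm, Finset.sum_sub_distrib]
    have : ∑ M, d2 M N M K = 0 := by
      rw [← hdc N K]; exact Finset.sum_congr rfl fun M _ => hcomm _ _ _ _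
    rw [this, sub_zero]
  have h2 : ∀ M, Om M N K =ᶠ[𝓝 x] fun y => ∑ P, ∑ Q, J y M P * J y N Q * Om P Q K y := fun M => by
    filter_upwards [hinteg] with y hy
    have := congrFun (congrFun (hy K) M) N
    simp only [curl, ext1, Matrix.mul_apply, Matrix.of_apply, Matrix.transpose_apply,
      Finset.sum_mul] at this
    change dx M (fun y => J y N K) y - dx N (fun y => J y M K) y = _
    rw [this, Finset.sum_comm]
    exact Finset.sum_congr rfl fun P _ => Finset.sum_congr rfl fun Q _ => by
      simp only [hOm]; ring
  have h3 : ∀ M, dx M (Om M N K) x = ∑ P, ∑ Q, (d1 M M P * (J x N Q * Om P Q K x)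
      + J x M P * d1 M N Q * Om P Q K x
      + J x N Q * (J x M P * d2 M P Q K - J x M P * d2 Q M P K)) := fun M => by
    rw [dx_congr (h2 M), dx_sum fun P _ => DifferentiableAt.fun_sum fun Q _ =>
      ((hJd M P).fun_mul (hJd N Q)).fun_mul (hOmd P Q K)]
    refine Finset.sum_congr rfl fun P _ => ?_
    rw [dx_sum fun Q _ => ((hJd M P).fun_mul (hJd N Q)).fun_mul (hOmd P Q K)]
    refine Finset.sum_congr rfl fun Q _ => ?_
    rw [dx_mul ((hJd M P).fun_mul (hJd N Q)) (hOmd P Q K), dx_mul (hJd M P) (hJd N Q), hdOm,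
      hcomm M Q P K]
    simp only [hd1]
    ring
  -- antisymmetry
  have h4 : ∀ Q, ∑ M, ∑ P, J x M P * d2 M P Q K
      = ∑ M, ∑ P, (J x M P - I₀ M P) * d2 M P Q K := fun Q => by
    simp only [sub_mul, Finset.sum_sub_distrib]
    rw [sum_antisymm_mul_symm (a := fun i j => I₀ i j) hI fun i j => hcomm i j Q K, sub_zero]
  -- differentiating the square
  have h5 : ∀ᶠ y in 𝓝 x, ∑ P, c P * J y P K + ∑ M, ∑ P, J y M P * dx M (fun y => J y P K) y
      = 0 := by
    filter_upwards [hsq.eventually_nhds, hdiv, hJd'] with y hy1 hy2 hy3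
    have h6 : ∀ M, ∑ P, (dx M (fun y => J y M P) y * J y P K + J y M P * dx M (fun y => J y P K) y)
        = 0 := fun M => by
      have h7 : (fun y => ∑ P, J y M P * J y P K) =ᶠ[𝓝 y] fun _ => (-1 : Matrix ι ι ℝ) M K :=
        hy1.mono fun z hz => by
          have := congrFun (congrFun hz M) K
          rwa [Matrix.mul_apply] at this
      have h8 := dx_congr h7 M
      rw [dx_const, dx_sum fun P _ => (hy3 M P).fun_mul (hy3 P K)] at h8
      rw [← h8]
      exact Finset.sum_congr rfl fun P _ => (dx_mul (hy3 M P) (hy3 P K) M).symm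
    have h9 : ∑ M, ∑ P, (dx M (fun y => J y M P) y * J y P K
        + J y M P * dx M (fun y => J y P K) y) = 0 := Finset.sum_eq_zero fun M _ => h6 M
    simp only [Finset.sum_add_distrib] at h9
    rw [Finset.sum_comm] at h9
    rw [← h9]
    congr 1
    refine Finset.sum_congr rfl fun P _ => ?_
    rw [← hy2 P, Finset.sum_mul]
  have h6 : ∀ Q, ∑ M, ∑ P, J x M P * d2 Q M P K
      = -(∑ P, c P * d1 Q P K + ∑ M, ∑ P, d1 Q M P * d1 M P K) := fun Q => by
    have h7 := dx_congr (g := fun _ => (0 : ℝ)) h5 Q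
    rw [dx_const, dx_add (DifferentiableAt.fun_sum fun P _ => (hJd P K).const_mul _)
      (DifferentiableAt.fun_sum fun M _ => DifferentiableAt.fun_sum fun P _ =>
        (hJd M P).fun_mul (hD M P K)),
      dx_sum fun P _ => (hJd P K).const_mul _,
      dx_sum fun M _ => DifferentiableAt.fun_sum fun P _ => (hJd M P).fun_mul (hD M P K)] at h7
    have h8 : ∀ P, dx Q (fun y => c P * J y P K) x = c P * d1 Q P K := fun P => by
      rw [dx_mul (f := fun _ => c P) (differentiableAt_const _) (hJd P K), dx_const, zero_mul,
        zero_add]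
    have h9 : ∀ M, dx Q (fun y => ∑ P, J y M P * dx M (fun y => J y P K) y) x
        = ∑ P, d1 Q M P * d1 M P K + ∑ P, J x M P * d2 Q M P K := fun M => by
      rw [dx_sum fun P _ => (hJd M P).fun_mul (hD M P K), ← Finset.sum_add_distrib]
      exact Finset.sum_congr rfl fun P _ => dx_mul (hJd M P) (hD M P K) Q
    simp only [h8, h9, Finset.sum_add_distrib] at h7
    linarith
  rw [h1]
  simp only [h3, Finset.sum_add_distrib]
  have e1 : ∑ M, ∑ P, ∑ Q, d1 M M P * (J x N Q * Om P Q K x)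
      = ∑ Q, J x N Q * (∑ P, c P * (d1 P Q K - d1 Q P K)) := by
    rw [Finset.sum_comm]
    have : ∀ P, ∑ M, ∑ Q, d1 M M P * (J x N Q * Om P Q K x)
        = ∑ Q, J x N Q * (c P * (d1 P Q K - d1 Q P K)) := fun P => by
      rw [Finset.sum_comm]
      refine Finset.sum_congr rfl fun Q _ => ?_
      rw [← Finset.sum_mul, hc]
      simp only [hOm, hd1]
      ring
    simp only [this, Finset.mul_sum]
    rw [Finset.sum_comm]
  have e2 : ∑ M, ∑ P, ∑ Q, J x N Q * (J x M P * d2 M P Q K - J x M P * d2 Q M P K)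
      = ∑ Q, J x N Q * (∑ M, ∑ P, J x M P * d2 M P Q K - ∑ M, ∑ P, J x M P * d2 Q M P K) := by
    simp only [← Finset.sum_sub_distrib, Finset.mul_sum]
    rw [Finset.sum_comm (s := (Finset.univ : Finset ι)) (t := (Finset.univ : Finset ι))
      (f := fun Q M => ∑ P, J x N Q * (J x M P * d2 M P Q K - J x M P * d2 Q M P K))]
    exact Finset.sum_congr rfl fun M _ => Finset.sum_comm
  rw [e1, e2, ellRhs]
  rw [add_right_comm, ← Finset.sum_add_distrib]
  congr 1
  refine Finset.sum_congr rfl fun Q _ => ?_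
  rw [← mul_add, h4, h6]
  congr 1
  simp only [Finset.sum_add_distrib, mul_sub, Finset.sum_sub_distrib]
  ring
end
end NN

namespace NN
open scoped BigOperators Topology ContDiff
open Filter
set_option linter.unusedSectionVars false
namespace KM

variable {ι : Type*} [Fintype ι] [DecidableEq ι] {𝒜 : Type*} [NormedCommRing 𝒜]
  [NormedAlgebra ℂ 𝒜] [CompleteSpace 𝒜]

/-- Data of the transformed elliptic problem: the solution operator, its derivatives, and the
derivatives of the bump function generating the family of diffeomorphisms. -/
structure Data (ι 𝒜 : Type*) [NormedCommRing 𝒜] [NormedAlgebra ℂ 𝒜] where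
  /-- the solution operator -/
  S : 𝒜 →L[ℂ] 𝒜
  /-- first derivatives of the solution operator -/
  R1 : ι → 𝒜 →L[ℂ] 𝒜
  /-- second derivatives of the solution operator -/
  R2 : ι → ι → 𝒜 →L[ℂ] 𝒜
  /-- first derivatives of the bump function -/
  e1 : ι → 𝒜
  /-- second derivatives of the bump function -/
  e2 : ι → ι → 𝒜
  /-- the constant structure -/
  J0 : ι → ι → 𝒜

/-- Parameters: translation, divergence and source. -/
abbrev Par (ι 𝒜 : Type*) := (ι → ℂ) × (ι → ℂ) × (ι → ι → 𝒜)

variable (D : Data ι 𝒜)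

/-- Reciprocal of the Jacobian. -/
noncomputable def kap (y : ι → ℂ) : 𝒜 := Ring.inverse (1 + ∑ L, y L • D.e1 L)
/-- Inverse Jacobian. -/
noncomputable def KK (y : ι → ℂ) (P M : ι) : 𝒜 :=
  (if P = M then 1 else 0) - y M • (kap D y * D.e1 P)
/-- Derivatives of the inverse Jacobian. -/
noncomputable def dK (y : ι → ℂ) (M Q N : ι) : 𝒜 :=
  -(y N • (kap D y * D.e2 M Q - kap D y ^ 2 * (∑ L, y L • D.e2 M L) * D.e1 Q))
/-- Transformed first derivatives. -/
noncomputable def d1 (y : ι → ℂ) (h : ι → ι → 𝒜) (P i j : ι) : 𝒜 :=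
  ∑ M, KK D y P M * D.R1 M (h i j)
/-- Transformed second derivatives. -/
noncomputable def d2 (y : ι → ℂ) (h : ι → ι → 𝒜) (P Q i j : ι) : 𝒜 :=
  ∑ M, KK D y P M * ∑ N, (dK D y M Q N * D.R1 N (h i j) + KK D y Q N * D.R2 M N (h i j))

/-- The right-hand side of the transformed equation. -/
noncomputable def rhsY (y c : ι → ℂ) (h : ι → ι → 𝒜) (N K : ι) : 𝒜 :=
  ellRhs (fun i j => D.J0 i j + D.S (h i j)) (fun i j => D.S (h i j)) (fun i => algebraMap ℂ 𝒜 (c i))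
    (d1 D y h) (d2 D y h) N K

/-- The nonlinear map. -/
noncomputable def nl (y c : ι → ℂ) (h : ι → ι → 𝒜) (N K : ι) : 𝒜 :=
  ∑ M, (D.R2 M M (h N K) - d2 D y h M M N K) + rhsY D y c h N K

section smooth
variable {V : Type*} [NormedAddCommGroup V] [NormedSpace ℂ V] {y c : V → ι → ℂ} {h : V → ι → ι → 𝒜}

theorem contDiffAt_kap (hy : ContDiffAt ℂ 1 y 0) (hy0 : y 0 = 0) :
    ContDiffAt ℂ 1 (fun v => kap D (y v)) 0 := by
  have h1 : ContDiffAt ℂ 1 (fun v => 1 + ∑ L, y v L • D.e1 L) 0 :=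
    contDiffAt_const.add (ContDiffAt.sum fun L _ => (contDiffAt_pi.1 hy L).smul contDiffAt_const)
  refine ContDiffAt.comp (g := Ring.inverse) 0 ?_ h1
  have : (1 : 𝒜) + ∑ L, y 0 L • D.e1 L = (1 : 𝒜ˣ) := by simp [hy0]
  rw [this]
  exact contDiffAt_ringInverse ℂ _

theorem vanishOne_comp (hy : ContDiffAt ℂ 1 y 0) (hy0 : y 0 = 0) (M : ι) {f : V → 𝒜}
    (hf : ContDiffAt ℂ 1 f 0) : VanishOne ℂ fun v => y v M • f v :=
  ⟨(contDiffAt_pi.1 hy M).smul hf, by simp [hy0]⟩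

theorem vanishOne_KK (hy : ContDiffAt ℂ 1 y 0) (hy0 : y 0 = 0) (P M : ι) :
    VanishOne ℂ fun v => KK D (y v) P M - if P = M then 1 else 0 := by
  have := (vanishOne_comp hy hy0 M ((contDiffAt_kap D hy hy0).mul (contDiffAt_const (c := D.e1 P)))).neg
  refine ⟨this.1.congr_of_eventuallyEq (Eventually.of_forall fun v => ?_), ?_⟩
  · simp only [KK]; ring
  · simp [KK, hy0]

theorem contDiffAt_KK (hy : ContDiffAt ℂ 1 y 0) (hy0 : y 0 = 0) (P M : ι) :
    ContDiffAt ℂ 1 (fun v => KK D (y v) P M) 0 := by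
  have := (vanishOne_KK D hy hy0 P M).1.add (contDiffAt_const (c := if P = M then (1 : 𝒜) else 0))
  simpa using this

theorem vanishOne_dK (hy : ContDiffAt ℂ 1 y 0) (hy0 : y 0 = 0) (M Q N : ι) :
    VanishOne ℂ fun v => dK D (y v) M Q N := by
  have hk := contDiffAt_kap D hy hy0
  refine (vanishOne_comp hy hy0 N ((hk.mul contDiffAt_const).sub
    (((hk.pow 2).mul ?_).mul contDiffAt_const))).neg
  exact ContDiffAt.sum fun L _ => (contDiffAt_pi.1 hy L).smul contDiffAt_const

theorem vanishOne_op (L : 𝒜 →L[ℂ] 𝒜) (hh : ContDiffAt ℂ 1 h 0) (hh0 : h 0 = 0) (i j : ι) :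
    VanishOne ℂ fun v => L (h v i j) :=
  VanishOne.clm L ⟨contDiffAt_pi.1 (contDiffAt_pi.1 hh i) j, by change h 0 i j = 0; rw [hh0]; rfl⟩

theorem vanishOne_d1 (hy : ContDiffAt ℂ 1 y 0) (hy0 : y 0 = 0) (hh : ContDiffAt ℂ 1 h 0)
    (hh0 : h 0 = 0) (P i j : ι) : VanishOne ℂ fun v => d1 D (y v) (h v) P i j :=
  VanishOne.sum fun M _ => VanishOne.mul_left (contDiffAt_KK D hy hy0 P M)
    (vanishOne_op _ hh hh0 i j)

theorem vanishOne_d2 (hy : ContDiffAt ℂ 1 y 0) (hy0 : y 0 = 0) (hh : ContDiffAt ℂ 1 h 0)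
    (hh0 : h 0 = 0) (P Q i j : ι) : VanishOne ℂ fun v => d2 D (y v) (h v) P Q i j :=
  VanishOne.sum fun M _ => VanishOne.mul_left (contDiffAt_KK D hy hy0 P M)
    (VanishOne.sum fun N _ => (VanishOne.mul_left (vanishOne_dK D hy hy0 M Q N).1
      (vanishOne_op _ hh hh0 i j)).add (VanishOne.mul_left (contDiffAt_KK D hy hy0 Q N)
      (vanishOne_op _ hh hh0 i j)))

theorem vanishTwo_d2 (hy : ContDiffAt ℂ 1 y 0) (hy0 : y 0 = 0) (hh : ContDiffAt ℂ 1 h 0)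
    (hh0 : h 0 = 0) (P Q i j : ι) :
    VanishTwo ℂ fun v => D.R2 P Q (h v i j) - d2 D (y v) (h v) P Q i j := by
  have h1 : ∀ v, D.R2 P Q (h v i j) - d2 D (y v) (h v) P Q i j
      = -(∑ M, (KK D (y v) P M - if P = M then 1 else 0) *
          ∑ N, (dK D (y v) M Q N * D.R1 N (h v i j) + KK D (y v) Q N * D.R2 M N (h v i j))
        + ∑ N, (dK D (y v) P Q N * D.R1 N (h v i j)
          + (KK D (y v) Q N - if Q = N then 1 else 0) * D.R2 P N (h v i j))) := fun v => by
    simp only [d2, sub_mul, Finset.sum_sub_distrib, ite_mul, one_mul, zero_mul, Finset.sum_ite_eq,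
      Finset.mem_univ, if_true, Finset.sum_add_distrib]
    ring
  simp only [h1]
  refine (VanishTwo.add (VanishTwo.sum fun M _ => (vanishOne_KK D hy hy0 P M).mul
    (VanishOne.sum fun N _ => ?_)) (VanishTwo.sum fun N _ => VanishTwo.add ?_ ?_)).neg
  · exact (VanishOne.mul_left (vanishOne_dK D hy hy0 M Q N).1
      (vanishOne_op _ hh hh0 i j)).add (VanishOne.mul_left (contDiffAt_KK D hy hy0 Q N)
      (vanishOne_op _ hh hh0 i j))
  · exact (vanishOne_dK D hy hy0 P Q N).mul (vanishOne_op _ hh hh0 i j)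
  · exact (vanishOne_KK D hy hy0 Q N).mul (vanishOne_op _ hh hh0 i j)

theorem vanishTwo_rhsY (hy : ContDiffAt ℂ 1 y 0) (hy0 : y 0 = 0) (hc : ContDiffAt ℂ 1 c 0)
    (hc0 : c 0 = 0) (hh : ContDiffAt ℂ 1 h 0) (hh0 : h 0 = 0) (N K : ι) :
    VanishTwo ℂ fun v => rhsY D (y v) (c v) (h v) N K := by
  have hS := vanishOne_op D.S hh hh0
  have hJ : ∀ i j, ContDiffAt ℂ 1 (fun v => D.J0 i j + D.S (h v i j)) 0 := fun i j =>
    contDiffAt_const.add (hS i j).1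
  have h1 := vanishOne_d1 D hy hy0 hh hh0
  have h2 := vanishOne_d2 D hy hy0 hh hh0
  have hcc : ∀ i, VanishOne ℂ fun v => algebraMap ℂ 𝒜 (c v i) := fun i =>
    ⟨(algebraMapCLM ℂ 𝒜).contDiff.contDiffAt.comp 0 (contDiffAt_pi.1 hc i), by simp [hc0]⟩
  refine VanishTwo.add (VanishTwo.sum fun Q _ => VanishTwo.mul_left (hJ N Q) (VanishTwo.add
    (VanishTwo.sum fun M _ => VanishTwo.sum fun P _ => VanishTwo.add ?_ ?_)
    (VanishTwo.sum fun P _ => ?_)))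
    (VanishTwo.sum fun M _ => VanishTwo.sum fun P _ => VanishTwo.sum fun Q _ => ?_)
  · exact (hS M P).mul (h2 M P Q K)
  · exact (h1 Q M P).mul (h1 M P K)
  · exact (hcc P).mul (h1 P Q K)
  · exact (VanishOne.mul_left (hJ M P) (h1 M N Q)).mul ((h1 P Q K).sub (h1 Q P K))
end smooth

theorem exists_solution : ∃ φ : Par ι 𝒜 → ι → ι → 𝒜, ContDiffAt ℂ 1 φ 0 ∧ φ 0 = 0 ∧
    ContDiffAt ℂ 1 (fun q : Par ι 𝒜 × (ι → ι → 𝒜) => nl D q.1.1 q.1.2.1 q.2) 0 ∧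
    nl D 0 0 0 = 0 ∧
    ∀ᶠ q in 𝓝 (0 : Par ι 𝒜 × (ι → ι → 𝒜)),
      (fun i j => nl D q.1.1 q.1.2.1 q.2 i j + q.1.2.2 i j) = q.2 → q.2 = φ q.1 := by
  have h1 : VanishTwo ℂ (fun q : Par ι 𝒜 × (ι → ι → 𝒜) => nl D q.1.1 q.1.2.1 q.2) := by
    refine vanishTwo_pi fun N => vanishTwo_pi fun K => VanishTwo.add
      (VanishTwo.sum fun M _ => ?_) ?_
    · exact vanishTwo_d2 D (y := fun q : Par ι 𝒜 × (ι → ι → 𝒜) => q.1.1) (h := fun q => q.2)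
        contDiffAt_fst.fst rfl contDiffAt_snd rfl M M N K
    · exact vanishTwo_rhsY D (y := fun q : Par ι 𝒜 × (ι → ι → 𝒜) => q.1.1) (h := fun q => q.2)
        (c := fun q => q.1.2.1) contDiffAt_fst.fst rfl contDiffAt_fst.snd.fst rfl
        contDiffAt_snd rfl N K
  have h2 : VanishY ℂ (fun q : Par ι 𝒜 × (ι → ι → 𝒜) =>
      nl D q.1.1 q.1.2.1 q.2 + q.1.2.2) :=
    h1.vanishY.add (vanishY_fst ((ContinuousLinearMap.snd ℂ (ι → ℂ) (ι → ι → 𝒜)).comp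
      (ContinuousLinearMap.snd ℂ (ι → ℂ) ((ι → ℂ) × (ι → ι → 𝒜)))))
  obtain ⟨φ, h3, h4, -, h5⟩ := exists_fixedPoint _ h2.1 h2.2.1 h2.2.2
  exact ⟨φ, h3, h4, h1.1, h1.2.1, h5⟩
end KM
end NN

namespace NN
open scoped BigOperators Topology ContDiff
open Filter
open Wiener
set_option linter.unusedSectionVars false
namespace KM

variable {ι : Type*} [Fintype ι] [DecidableEq ι]

/-- Complexification of a real function. -/
noncomputable def cpx (η : (ι → ℝ) → ℝ) : (ι → ℝ) → ℂ := fun x => (η x : ℂ)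

/-- The family of maps shearing along `y` with amplitude `η`. -/
def shear (η : (ι → ℝ) → ℝ) (y x : ι → ℝ) : ι → ℝ := fun A => x A + η x * y A

/-- The Jacobian of `shear`. -/
noncomputable def sjac (η : (ι → ℝ) → ℝ) (y x : ι → ℝ) : ℂ :=
  1 + ∑ L, (y L : ℂ) * dx L (cpx η) x

/-- Entries of the inverse derivative of `shear`. -/
noncomputable def sK (η : (ι → ℝ) → ℝ) (y : ι → ℝ) (P M : ι) (x : ι → ℝ) : ℂ :=
  (if P = M then 1 else 0) - (y M : ℂ) * ((sjac η y x)⁻¹ * dx P (cpx η) x)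

/-- Derivatives of `sK`. -/
noncomputable def sdK (η : (ι → ℝ) → ℝ) (y : ι → ℝ) (M Q N : ι) (x : ι → ℝ) : ℂ :=
  -((y N : ℂ) * ((sjac η y x)⁻¹ * dx M (dx Q (cpx η)) x - (sjac η y x)⁻¹ ^ 2 *
    (∑ L, (y L : ℂ) * dx M (dx L (cpx η)) x) * dx Q (cpx η) x))

variable {η : (ι → ℝ) → ℝ} (hη : ContDiff ℝ ∞ η)
include hη

theorem contDiff_cpx : ContDiff ℝ ∞ (cpx η) := Complex.ofRealCLM.contDiff.comp hη

theorem contDiff_dx_cpx (j : ι) (m : ℕ) : ContDiff ℝ m (dx j (cpx η)) :=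
  contDiff_dx ((contDiff_cpx hη).of_le (by exact_mod_cast le_top)) j

theorem dx_cpx (j : ι) (x : ι → ℝ) : dx j (cpx η) x = ((dx j η x : ℝ) : ℂ) := by
  have h := (Complex.ofRealCLM.hasFDerivAt (x := η x)).comp x
    (hη.differentiable (by simp) x).hasFDerivAt
  rw [dx]
  change fderiv ℝ (Complex.ofRealCLM ∘ η) x _ = _
  rw [h.fderiv]; rfl

theorem contDiff_shear (y : ι → ℝ) : ContDiff ℝ ∞ (shear η y) :=
  contDiff_pi.2 fun A => (contDiff_apply ℝ ℝ A).add (hη.mul contDiff_const)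

theorem contDiff_sjac (y : ι → ℝ) (m : ℕ) : ContDiff ℝ m (sjac η y) :=
  contDiff_const.add (ContDiff.sum fun L _ => contDiff_const.mul (contDiff_dx_cpx hη L m))

theorem dx_shear (y x : ι → ℝ) (M A : ι) :
    dx M (fun x => shear η y x A) x = (if M = A then 1 else 0) + dx M η x * y A := by
  have hd := hη.differentiable (by simp) x
  have hA : HasFDerivAt (fun x : ι → ℝ => x A)
      (ContinuousLinearMap.proj (R := ℝ) (φ := fun _ : ι => ℝ) A) x := hasFDerivAt_apply A x
  simp only [shear]
  rw [dx_add hA.differentiableAt (hd.fun_mul (differentiableAt_const _)),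
    dx_mul hd (differentiableAt_const _), dx_const, mul_zero, add_zero]
  congr 1
  rw [dx, hA.fderiv]
  simp [Pi.single_apply, eq_comm]

theorem sum_sK_mul_dx {v : (ι → ℝ) → ℂ} {y x : ι → ℝ} (hv : DifferentiableAt ℝ v (shear η y x))
    (ha : sjac η y x ≠ 0) (P : ι) :
    ∑ M, sK η y P M x * dx M (fun x => v (shear η y x)) x = dx P v (shear η y x) := by
  have h1 : ∀ M, dx M (fun x => v (shear η y x)) x = dx M v (shear η y x)
      + dx M (cpx η) x * ∑ A, (y A : ℂ) * dx A v (shear η y x) := fun M => by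
    rw [dx_comp ((contDiff_shear hη y).differentiable (by simp) x) hv]
    simp only [dx_shear hη, add_smul, ite_smul, one_smul, zero_smul, Finset.sum_add_distrib,
      Finset.sum_ite_eq, Finset.mem_univ, if_true, Finset.mul_sum, dx_cpx hη]
    congr 1
    refine Finset.sum_congr rfl fun A _ => ?_
    rw [Complex.real_smul]; push_cast; ring
  simp only [h1, sK]
  set Y := ∑ A, (y A : ℂ) * dx A v (shear η y x)
  simp only [sub_mul, ite_mul, one_mul, zero_mul, Finset.sum_sub_distrib, Finset.sum_ite_eq,
    Finset.mem_univ, if_true]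
  have h2 : ∑ M, (y M : ℂ) * ((sjac η y x)⁻¹ * dx P (cpx η) x) *
      (dx M v (shear η y x) + dx M (cpx η) x * Y) = (sjac η y x)⁻¹ * dx P (cpx η) x * Y *
        sjac η y x := by
    have : ∀ M, (y M : ℂ) * ((sjac η y x)⁻¹ * dx P (cpx η) x) *
      (dx M v (shear η y x) + dx M (cpx η) x * Y) = (sjac η y x)⁻¹ * dx P (cpx η) x *
        ((y M : ℂ) * dx M v (shear η y x)) + (sjac η y x)⁻¹ * dx P (cpx η) x * Y *
        ((y M : ℂ) * dx M (cpx η) x) := fun M => by ring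
    simp only [this, Finset.sum_add_distrib, ← Finset.mul_sum]
    have hs : ∑ L, (y L : ℂ) * dx L (cpx η) x = sjac η y x - 1 := by simp [sjac]
    rw [hs]
    change _ * Y + _ = _
    ring
  rw [h2]
  field_simp
  ring

theorem dx_sK {y x : ι → ℝ} (ha : sjac η y x ≠ 0) (M Q N : ι) :
    dx M (sK η y Q N) x = sdK η y M Q N x := by
  have hs : DifferentiableAt ℝ (sjac η y) x := (contDiff_sjac hη y 1).differentiable (by simp) x
  have hd : ∀ L, DifferentiableAt ℝ (dx L (cpx η)) x := fun L =>
    (contDiff_dx_cpx hη L 1).differentiable (by simp) x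
  have hi : DifferentiableAt ℝ (fun x => (sjac η y x)⁻¹) x := hs.fun_inv ha
  have h1 : dx M (sjac η y) x = ∑ L, (y L : ℂ) * dx M (dx L (cpx η)) x := by
    change dx M (fun x => 1 + ∑ L, (y L : ℂ) * dx L (cpx η) x) x = _
    rw [dx_add (differentiableAt_const _) (DifferentiableAt.fun_sum fun L _ =>
      (differentiableAt_const _).fun_mul (hd L)), dx_const, zero_add,
      dx_sum fun L _ => (differentiableAt_const _).fun_mul (hd L)]
    refine Finset.sum_congr rfl fun L _ => ?_
    rw [dx_mul (differentiableAt_const _) (hd L), dx_const, zero_mul, zero_add]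
  have h2 : dx M (fun x => (sjac η y x)⁻¹) x = -(sjac η y x)⁻¹ ^ 2 * dx M (sjac η y) x := by
    have h3 : (fun x => sjac η y x * (sjac η y x)⁻¹) =ᶠ[𝓝 x] fun _ => 1 := by
      filter_upwards [hs.continuousAt.eventually_ne ha] with z hz
      exact mul_inv_cancel₀ hz
    have h4 := dx_congr h3 M
    rw [dx_mul hs hi, dx_const] at h4
    have h5 : dx M (fun x => (sjac η y x)⁻¹) x = (sjac η y x)⁻¹ *
      (sjac η y x * dx M (fun x => (sjac η y x)⁻¹) x) := by
      rw [← mul_assoc, inv_mul_cancel₀ ha, one_mul]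
    rw [h5, eq_neg_of_add_eq_zero_right h4]
    ring
  change dx M (fun x => (if Q = N then 1 else 0) - (y N : ℂ) * ((sjac η y x)⁻¹ * dx Q (cpx η) x)) x = _
  rw [dx_sub (differentiableAt_const _) ((differentiableAt_const _).fun_mul (hi.fun_mul (hd Q))), dx_const,
    dx_mul (differentiableAt_const _) (hi.fun_mul (hd Q)), dx_const, dx_mul hi (hd Q), h2, h1, sdK]
  ring

theorem differentiableAt_sK {y x : ι → ℝ} (ha : sjac η y x ≠ 0) (Q N : ι) :
    DifferentiableAt ℝ (sK η y Q N) x :=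
  (differentiableAt_const _).sub ((differentiableAt_const _).fun_mul
    ((((contDiff_sjac hη y 1).differentiable (by simp) x).fun_inv ha).mul
    ((contDiff_dx_cpx hη Q 1).differentiable (by simp) x)))

theorem sum_sK_mul_dx_dx {v : (ι → ℝ) → ℂ} (hv : ContDiff ℝ (2 : ℕ) v) {y x : ι → ℝ}
    (ha : sjac η y x ≠ 0) (P Q : ι) :
    ∑ M, sK η y P M x * ∑ N, (sdK η y M Q N x * dx N (fun x => v (shear η y x)) x
      + sK η y Q N x * dx M (dx N fun x => v (shear η y x)) x) = dx P (dx Q v) (shear η y x) := by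
  have hQ : ContDiff ℝ (1 : ℕ) (dx Q v) := contDiff_dx hv Q
  have hv1 : Differentiable ℝ v := hv.differentiable (by norm_num)
  have hvs : ContDiff ℝ (2 : ℕ) fun x => v (shear η y x) :=
    hv.comp (contDiff_infty.1 (contDiff_shear hη y) 2)
  have hdN : ∀ N, DifferentiableAt ℝ (dx N fun x => v (shear η y x)) x := fun N =>
    (contDiff_dx (m := 1) hvs N).differentiable (by norm_num) x
  rw [← sum_sK_mul_dx hη (hQ.differentiable (by norm_num) _) ha P]
  refine Finset.sum_congr rfl fun M _ => ?_
  congr 1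
  have h1 : (fun x => dx Q v (shear η y x)) =ᶠ[𝓝 x]
      fun x => ∑ N, sK η y Q N x * dx N (fun x => v (shear η y x)) x := by
    filter_upwards [(contDiff_sjac hη y 1).continuous.continuousAt.eventually_ne ha] with z hz
    exact (sum_sK_mul_dx hη (hv1 _) hz Q).symm
  rw [dx_congr h1, dx_sum fun N _ => (differentiableAt_sK hη ha Q N).fun_mul (hdN N)]
  refine Finset.sum_congr rfl fun N _ => ?_
  rw [dx_mul (differentiableAt_sK hη ha Q N) (hdN N), dx_sK hη ha]

omit hη

theorem dx_eq_of_hasFDerivAt {f : (ι → ℝ) → ℂ} {x : ι → ℝ} {g : ι → ℂ}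
    (h : HasFDerivAt f (∑ i, g i •
      (Complex.ofRealCLM.comp (ContinuousLinearMap.proj (R := ℝ) (φ := fun _ : ι => ℝ) i))) x)
    (j : ι) : dx j f x = g j := by
  rw [dx, h.fderiv, _root_.sum_apply, Finset.sum_eq_single j]
  · simp
  · intro i _ hi
    simp [hi]
  · simp

theorem eventually_norm_lt {x : ι → ℝ} {r : ℝ} (hx : ‖x‖ < r) : ∀ᶠ z in 𝓝 x, ‖z‖ < r :=
  continuousAt_id.norm.eventually_lt continuousAt_const hx

theorem evL_R1_rep_lap {s : ℕ} {φ : (ι → ℝ) → ℂ} (hφ : ContDiff ℝ (ord ι s + 2 : ℕ) φ) (hs : CS φ)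
    {x : ι → ℝ} (hx : ‖x‖ < 1 / 2) (j : ι) :
    evL x (R1 j (rep s (lap φ)) : Wiener ι s) = dx j φ x := by
  rw [← dx_eq_of_hasFDerivAt (hasFDerivAt_evL_R (rep s (lap φ)) x) j]
  have h1 : (fun z => evL z (R (rep s (lap φ)) : Wiener ι s)) =ᶠ[𝓝 x]
      fun z => φ z + (evL x (R (rep s (lap φ)) : Wiener ι s) - φ x) := by
    filter_upwards [eventually_norm_lt hx] with z hz
    linear_combination evL_R_rep_lap hφ hs (mem_cube hz) (mem_cube hx)
  rw [dx_congr h1, dx_add (hφ.differentiable (by norm_cast) x) (differentiableAt_const _),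
    dx_const, add_zero]

theorem evL_R2_rep_lap {s : ℕ} {φ : (ι → ℝ) → ℂ} (hφ : ContDiff ℝ (ord ι s + 2 : ℕ) φ) (hs : CS φ)
    {x : ι → ℝ} (hx : ‖x‖ < 1 / 2) (i j : ι) :
    evL x (R2 i j (rep s (lap φ)) : Wiener ι s) = dx i (dx j φ) x := by
  rw [← dx_eq_of_hasFDerivAt (hasFDerivAt_evL_R1 j (rep s (lap φ)) x) i]
  refine dx_congr ?_ i
  filter_upwards [eventually_norm_lt hx] with z hz
  exact evL_R1_rep_lap hφ hs hz j

theorem ext_evL_ball {s : ℕ} {a b : Wiener ι s} (h : ∀ x : ι → ℝ, ‖x‖ < 1 / 2 → evL x a = evL x b) :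
    a = b := by
  refine ext_evL fun x hx => ?_
  have h1 : IsClosed {x : ι → ℝ | evL x a = evL x b} :=
    isClosed_eq (continuous_evL a) (continuous_evL b)
  have h2 : x ∈ closure (Metric.ball (0 : ι → ℝ) (1 / 2)) := by
    rw [closure_ball _ (by norm_num), mem_closedBall_zero_iff, pi_norm_le_iff_of_nonneg (by norm_num)]
    intro i
    have := hx i
    rw [Real.norm_eq_abs, abs_le]
    constructor <;> linarith [this.1, this.2]
  exact closure_minimal (fun z hz => h z (mem_ball_zero_iff.1 hz)) h1 h2

theorem contDiff_dx_param {P : Type*} [NormedAddCommGroup P] [NormedSpace ℝ P]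
    {V : P × (ι → ℝ) → ℂ} {m : ℕ} (hV : ContDiff ℝ (m + 1 : ℕ) V) (j : ι) :
    ContDiff ℝ m fun q : P × (ι → ℝ) => dx j (fun x => V (q.1, x)) q.2 := by
  have h1 : ContDiff ℝ m fun q => fderiv ℝ V q (0, Pi.single j 1) :=
    (hV.fderiv_right (m := m) (by norm_cast)).clm_apply contDiff_const
  have h2 : (fun q : P × (ι → ℝ) => dx j (fun x => V (q.1, x)) q.2)
      = fun q => fderiv ℝ V q (0, Pi.single j 1) := by
    funext q
    rw [dx_slice (hV.of_le (by norm_cast; omega))]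
  rwa [h2]

theorem contDiff_lap_param {P : Type*} [NormedAddCommGroup P] [NormedSpace ℝ P]
    {V : P × (ι → ℝ) → ℂ} {m : ℕ} (hV : ContDiff ℝ (m + 2 : ℕ) V) :
    ContDiff ℝ m fun q : P × (ι → ℝ) => lap (fun x => V (q.1, x)) q.2 :=
  ContDiff.sum fun j _ => contDiff_dx_param (contDiff_dx_param (m := m + 1) hV j) j
end KM
end NN

namespace NN
open scoped BigOperators Topology ContDiff
open Filter
open Wiener
set_option linter.unusedSectionVars false
namespace KM

variable {ι : Type*} [Fintype ι] [DecidableEq ι]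

/-- The concrete elliptic data attached to a bump function. -/
noncomputable def conc (η : (ι → ℝ) → ℝ) (x₀ : ι → ℝ) (J0 : ι → ι → ℂ) : Data ι (Wiener ι 0) where
  S := R - ((evL x₀).comp R).smulRight (1 : Wiener ι 0)
  R1 := R1
  R2 := R2
  e1 L := rep 0 (dx L (cpx η))
  e2 M L := rep 0 (dx M (dx L (cpx η)))
  J0 i j := algebraMap ℂ (Wiener ι 0) (J0 i j)

variable {η : (ι → ℝ) → ℝ} {x₀ : ι → ℝ} {J0 : ι → ι → ℂ}

theorem ev_S {φ : (ι → ℝ) → ℂ} (hφ : ContDiff ℝ (ord ι 0 + 2 : ℕ) φ) (hs : CS φ)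
    (hx₀ : 1 / 3 < ‖x₀‖) (hx₀' : ‖x₀‖ < 1 / 2) {x : ι → ℝ} (hx : ‖x‖ < 1 / 2) :
    ev x ((conc η x₀ J0).S (rep 0 (lap φ))) = φ x := by
  have h := evL_R_rep_lap (s := 0) hφ hs (mem_cube hx) (mem_cube hx₀')
  rw [hs x₀ hx₀, sub_zero] at h
  rw [← h]
  change evL x (R (rep 0 (lap φ)) - evL x₀ (R (rep 0 (lap φ))) • (1 : Wiener ι 0)) = _
  rw [map_sub, map_smul, evL_one, smul_eq_mul, mul_one]

variable (hη : ContDiff ℝ ∞ η) (hη1 : ∀ x, 1 / 8 ≤ ‖x‖ → η x = 0)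
include hη1
theorem CS_cpx : CS (cpx η) := fun x hx => by
  simp [cpx, hη1 x (by linarith)]

include hη
theorem ev_e1 {x : ι → ℝ} (hx : ‖x‖ < 1 / 2) (L : ι) :
    ev x ((conc η x₀ J0).e1 L) = dx L (cpx η) x :=
  evL_rep (contDiff_dx_cpx hη L _) ((CS_cpx hη1).dx L) (mem_cube hx)

theorem ev_e2 {x : ι → ℝ} (hx : ‖x‖ < 1 / 2) (M L : ι) :
    ev x ((conc η x₀ J0).e2 M L) = dx M (dx L (cpx η)) x :=
  evL_rep (contDiff_dx (contDiff_dx_cpx hη L _) M) (((CS_cpx hη1).dx L).dx M) (mem_cube hx)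

variable {y : ι → ℝ}
  (hu : IsUnit (1 + ∑ L, (y L : ℂ) • (conc η x₀ J0).e1 L))

theorem ev_jac {x : ι → ℝ} (hx : ‖x‖ < 1 / 2) :
    ev x (1 + ∑ L, (y L : ℂ) • (conc η x₀ J0).e1 L) = sjac η y x := by
  simp only [map_add, map_one, map_sum, map_smul, ev_e1 hη hη1 hx, sjac, smul_eq_mul]

include hu
theorem sjac_ne_zero {x : ι → ℝ} (hx : ‖x‖ < 1 / 2) : sjac η y x ≠ 0 := by
  rw [← ev_jac (x₀ := x₀) (J0 := J0) hη hη1 hx]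
  exact (hu.map (ev x)).ne_zero

theorem ev_kap {x : ι → ℝ} (hx : ‖x‖ < 1 / 2) :
    ev x (kap (conc η x₀ J0) fun L => (y L : ℂ)) = (sjac η y x)⁻¹ := by
  have h := congrArg (ev x) (Ring.inverse_mul_cancel _ hu)
  rw [map_mul, map_one, ev_jac hη hη1 hx] at h
  exact eq_inv_of_mul_eq_one_left h

theorem ev_KK {x : ι → ℝ} (hx : ‖x‖ < 1 / 2) (P M : ι) :
    ev x (KK (conc η x₀ J0) (fun L => (y L : ℂ)) P M) = sK η y P M x := by
  rw [KK, map_sub, map_smul, map_mul, ev_kap hη hη1 hu hx, ev_e1 hη hη1 hx, sK, smul_eq_mul]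
  congr 1
  split_ifs <;> simp

theorem ev_dK {x : ι → ℝ} (hx : ‖x‖ < 1 / 2) (M Q N : ι) :
    ev x (dK (conc η x₀ J0) (fun L => (y L : ℂ)) M Q N) = sdK η y M Q N x := by
  simp only [dK, map_neg, map_sub, map_smul, map_mul, map_pow, map_sum, ev_kap hη hη1 hu hx,
    ev_e1 hη hη1 hx, ev_e2 hη hη1 hx, sdK, smul_eq_mul]

variable {v : ι → ι → (ι → ℝ) → ℂ} (hv : ∀ i j, ContDiff ℝ (ord ι 0 + 2 : ℕ) (v i j))
  (hs : ∀ i j, CS (v i j))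

omit hη hu in
theorem CS_shear {w : (ι → ℝ) → ℂ} (hs : CS w) : CS fun x => w (shear η y x) := fun x hx => by
  have : shear η y x = x := by
    funext A
    simp [shear, hη1 x (by linarith)]
  change w (shear η y x) = 0
  rw [this]
  exact hs x hx

omit hη1 hu in
theorem contDiff_comp_shear {w : (ι → ℝ) → ℂ} {m : ℕ} (hw : ContDiff ℝ m w) :
    ContDiff ℝ m fun x => w (shear η y x) :=
  hw.comp (contDiff_infty.1 (contDiff_shear hη y) m)

include hv hs
theorem ev_d1 {x : ι → ℝ} (hx : ‖x‖ < 1 / 2) (P i j : ι) :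
    ev x (d1 (conc η x₀ J0) (fun L => (y L : ℂ))
      (fun i j => rep 0 (lap fun x => v i j (shear η y x))) P i j) = dx P (v i j) (shear η y x) := by
  rw [d1, map_sum, ← sum_sK_mul_dx hη ((hv i j).differentiable (by norm_cast) _)
    (sjac_ne_zero hη hη1 hu hx) P]
  refine Finset.sum_congr rfl fun M _ => ?_
  rw [map_mul, ev_KK hη hη1 hu hx]
  congr 1
  exact evL_R1_rep_lap (contDiff_comp_shear hη (hv i j)) (CS_shear hη1 (hs i j)) hx M

theorem ev_d2 {x : ι → ℝ} (hx : ‖x‖ < 1 / 2) (P Q i j : ι) :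
    ev x (d2 (conc η x₀ J0) (fun L => (y L : ℂ))
      (fun i j => rep 0 (lap fun x => v i j (shear η y x))) P Q i j)
      = dx P (dx Q (v i j)) (shear η y x) := by
  have hV := contDiff_comp_shear (y := y) hη (hv i j)
  have hC := CS_shear (y := y) hη1 (hs i j)
  rw [d2, map_sum, ← sum_sK_mul_dx_dx hη ((hv i j).of_le (by norm_cast; omega))
    (sjac_ne_zero hη hη1 hu hx) P Q]
  refine Finset.sum_congr rfl fun M _ => ?_
  rw [map_mul, ev_KK hη hη1 hu hx, map_sum]
  congr 1
  refine Finset.sum_congr rfl fun N _ => ?_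
  rw [map_add, map_mul, map_mul, ev_KK hη hη1 hu hx, ev_dK hη hη1 hu hx]
  congr 1
  · congr 1
    exact evL_R1_rep_lap hV hC hx N
  · congr 1
    exact evL_R2_rep_lap hV hC hx M N

omit hη hη1 hu hv hs in
/-- The defect of the elliptic equation. -/
noncomputable def defect (J0 : ι → ι → ℂ) (c : ι → ℂ) (v : ι → ι → (ι → ℝ) → ℂ) (N K : ι)
    (x : ι → ℝ) : ℂ :=
  lap (v N K) x - ellRhs (fun i j => J0 i j + v i j x) (fun i j => v i j x) c
    (fun M i j => dx M (v i j) x) (fun M P i j => dx M (dx P (v i j)) x) N K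

theorem ev_sub_nl (hx₀ : 1 / 3 < ‖x₀‖) (hx₀' : ‖x₀‖ < 1 / 2) (c : ι → ℂ) {x : ι → ℝ}
    (hx : ‖x‖ < 1 / 2) (N K : ι) :
    ev x (rep 0 (lap fun x => v N K (shear η y x)) - nl (conc η x₀ J0) (fun L => (y L : ℂ)) c
      (fun i j => rep 0 (lap fun x => v i j (shear η y x))) N K)
      = defect J0 c v N K (shear η y x) := by
  have hV := fun i j => contDiff_comp_shear (y := y) hη (hv i j)
  have hC := fun i j => CS_shear (y := y) hη1 (hs i j)
  have h1 : ev x (rep 0 (lap fun x => v N K (shear η y x)) : Wiener ι 0)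
      = lap (fun x => v N K (shear η y x)) x :=
    evL_rep (contDiff_lap (hV N K)) (hC N K).lap (mem_cube hx)
  have h2 : ∀ M, ev x ((conc η x₀ J0).R2 M M (rep 0 (lap fun x => v N K (shear η y x))))
      = dx M (dx M fun x => v N K (shear η y x)) x := fun M =>
    evL_R2_rep_lap (hV N K) (hC N K) hx M M
  have h3 : ev x (rhsY (conc η x₀ J0) (fun L => (y L : ℂ)) c
      (fun i j => rep 0 (lap fun x => v i j (shear η y x))) N K) = ellRhs
      (fun i j => J0 i j + v i j (shear η y x)) (fun i j => v i j (shear η y x)) c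
      (fun M i j => dx M (v i j) (shear η y x)) (fun M P i j => dx M (dx P (v i j)) (shear η y x))
      N K := by
    have e := map_ellRhs (ι := ι) (ev x : Wiener ι 0 →ₐ[ℂ] ℂ).toRingHom
    simp only [AlgHom.toRingHom_eq_coe, RingHom.coe_coe] at e
    rw [rhsY, e]
    have h4 : ∀ i j, ev x ((conc η x₀ J0).J0 i j) = J0 i j := fun i j =>
      AlgHom.commutes _ _
    simp only [ev_d1 hη hη1 hu hv hs hx, ev_d2 hη hη1 hu hv hs hx, map_add, h4,
      ev_S (hV _ _) (hC _ _) hx₀ hx₀' hx, AlgHom.commutes, Algebra.algebraMap_self, RingHom.id_apply]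
  rw [map_sub, h1, nl, map_add, h3, map_sum]
  simp only [map_sub, h2, ev_d2 hη hη1 hu hv hs hx, Finset.sum_sub_distrib]
  rw [defect]
  simp only [lap]
  ring
end KM
end NN

namespace NN
open scoped BigOperators Topology ContDiff
open Filter
open Wiener
set_option linter.unusedSectionVars false
namespace KM

variable {ι : Type*} [Fintype ι] [DecidableEq ι]

theorem dx_comp_smul {g : (ι → ℝ) → ℂ} {ε : ℝ} {x : ι → ℝ} (hg : DifferentiableAt ℝ g (ε • x))
    (M : ι) : dx M (fun x => g (ε • x)) x = ε * dx M g (ε • x) := by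
  have h : HasFDerivAt (fun x : ι → ℝ => ε • x) (ε • ContinuousLinearMap.id ℝ (ι → ℝ)) x :=
    (hasFDerivAt_id x).const_smul ε
  have h2 := hg.hasFDerivAt.comp x h
  rw [dx]
  change fderiv ℝ (g ∘ fun x => ε • x) x _ = _
  rw [h2.fderiv]
  simp [dx]

/-- Localisation and rescaling. -/
noncomputable def resc (χ : (ι → ℝ) → ℝ) (f : ι → ι → (ι → ℝ) → ℂ) (ε : ℝ) (i j : ι) (x : ι → ℝ) : ℂ :=
  cpx χ x * f i j (ε • x)

variable {χ : (ι → ℝ) → ℝ} (hχ : ContDiff ℝ ∞ χ) (hχ1 : ∀ x, ‖x‖ ≤ 1 / 4 → χ x = 1)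
  (hχ2 : ∀ x, 1 / 3 ≤ ‖x‖ → χ x = 0) {f : ι → ι → (ι → ℝ) → ℂ} {m : ℕ}
  (hf : ∀ i j, ContDiff ℝ m (f i j))

include hχ1 in
theorem resc_eq {ε : ℝ} {x : ι → ℝ} (hx : ‖x‖ < 1 / 4) (i j : ι) :
    resc χ f ε i j x = f i j (ε • x) := by
  simp [resc, cpx, hχ1 x hx.le]

include hχ2 in
theorem CS_resc (ε : ℝ) (i j : ι) : CS (resc χ f ε i j) := fun x hx => by
  simp [resc, cpx, hχ2 x hx.le]

include hχ hf in
theorem contDiff_resc : ∀ i j, ContDiff ℝ m fun q : ℝ × (ι → ℝ) => resc χ f q.1 i j q.2 :=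
  fun i j => ((contDiff_infty.1 (contDiff_cpx hχ) m).comp contDiff_snd).mul
    ((hf i j).comp (contDiff_fst.smul contDiff_snd))

include hχ1 hf in
theorem defect_resc (hm : 2 ≤ m) {J0 : ι → ι → ℂ} {c : ι → ℂ} {ε : ℝ} {x : ι → ℝ} (hx : ‖x‖ < 1 / 4)
    (N K : ι) : defect J0 (fun i => ε * c i) (resc χ f ε) N K x
      = ε ^ 2 * defect J0 c f N K (ε • x) := by
  have hf1 : ∀ i j, Differentiable ℝ (f i j) := fun i j =>
    (hf i j).differentiable (by norm_cast; omega)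
  have hf2 : ∀ P i j, Differentiable ℝ (dx P (f i j)) := fun P i j =>
    (contDiff_dx (m := 1) ((hf i j).of_le (by norm_cast)) P).differentiable (by norm_num)
  have h1 : ∀ i j M, ∀ z : ι → ℝ, ‖z‖ < 1 / 4 →
      dx M (resc χ f ε i j) z = ε * dx M (f i j) (ε • z) := fun i j M z hz => by
    rw [← dx_comp_smul (hf1 i j _)]
    refine dx_congr ?_ M
    filter_upwards [eventually_norm_lt hz] with w hw using resc_eq hχ1 hw i j
  have h2 : ∀ i j M P, dx M (dx P (resc χ f ε i j)) x = ε ^ 2 * dx M (dx P (f i j)) (ε • x) := by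
    intro i j M P
    have h3 : dx P (resc χ f ε i j) =ᶠ[𝓝 x] fun z => (ε : ℂ) * dx P (f i j) (ε • z) := by
      filter_upwards [eventually_norm_lt hx] with w hw using h1 i j P w hw
    have h4 : DifferentiableAt ℝ (fun z => dx P (f i j) (ε • z)) x :=
      (hf2 P i j _).comp x (differentiableAt_id.const_smul ε)
    rw [dx_congr h3, dx_mul (differentiableAt_const _) h4, dx_const, zero_mul, zero_add,
      dx_comp_smul (hf2 P i j _)]
    ring
  simp only [defect, lap, h2, h1 _ _ _ x hx, resc_eq hχ1 hx, ← Finset.mul_sum, ellRhs_smul]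
  ring

theorem tendsto_rep_lap {P : Type*} [NormedAddCommGroup P] [NormedSpace ℝ P] {s : ℕ}
    {V : P → (ι → ℝ) → ℂ} (hV : ContDiff ℝ (ord ι s + 2 : ℕ) fun q : P × (ι → ℝ) => V q.1 q.2)
    (hs : ∀ p, CS (V p)) (h0 : ∀ x, V 0 x = 0) :
    Tendsto (fun p => (rep s (lap (V p)) : Wiener ι s)) (𝓝 0) (𝓝 0) := by
  have h1 := contDiff_lap_param hV
  refine tendsto_rep (Θ := fun q : P × (ι → ℝ) => lap (V q.1) q.2) h1 (fun p => (hs p).lap) fun x => ?_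
  have h2 : V 0 = fun _ => 0 := funext h0
  change lap (V 0) x = 0
  rw [h2]
  refine Finset.sum_eq_zero fun M _ => ?_
  have : dx M (fun _ : ι → ℝ => (0 : ℂ)) = fun _ => 0 := funext fun x => dx_const M 0 x
  rw [this, dx_const]

include hχ hχ2 hf in
theorem tendsto_rep_resc {s : ℕ} (hm : m = ord ι s + 2) (hf0 : ∀ i j, f i j 0 = 0)
    {η : (ι → ℝ) → ℝ} (hη : ContDiff ℝ ∞ η) (hη2 : ∀ x, 1 / 8 ≤ ‖x‖ → η x = 0) (i j : ι) :
    Tendsto (fun p : ℝ × (ι → ℝ) =>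
      (rep s (lap fun x => resc χ f p.1 i j (shear η p.2 x)) : Wiener ι s)) (𝓝 0) (𝓝 0) := by
  subst hm
  have hsh : ContDiff ℝ (ord ι s + 2 : ℕ) fun q : (ℝ × (ι → ℝ)) × (ι → ℝ) => shear η q.1.2 q.2 :=
    contDiff_pi.2 fun A => ((contDiff_apply ℝ ℝ A).comp contDiff_snd).add
      (((contDiff_infty.1 hη _).comp contDiff_snd).mul
        ((contDiff_apply ℝ ℝ A).comp (contDiff_snd.comp contDiff_fst)))
  have hV : ContDiff ℝ (ord ι s + 2 : ℕ) fun q : (ℝ × (ι → ℝ)) × (ι → ℝ) =>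
      resc χ f q.1.1 i j (shear η q.1.2 q.2) :=
    (contDiff_resc hχ hf i j).comp ((contDiff_fst.comp contDiff_fst).prodMk hsh)
  exact tendsto_rep_lap (V := fun (p : ℝ × (ι → ℝ)) x => resc χ f p.1 i j (shear η p.2 x)) hV
    (fun p => CS_shear hη2 (CS_resc hχ2 p.1 i j)) fun x => by simp [resc, hf0]

/-- Real analyticity of solutions of the elliptic equation, in the form of a holomorphic
extension. -/
theorem exists_holomorphic_extension [Nonempty ι] {J0 : ι → ι → ℂ} {c : ι → ℂ}
    {f : ι → ι → (ι → ℝ) → ℂ}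
    (hf : ∀ i j, ContDiff ℝ (ord ι 0 + 2 : ℕ) (f i j)) (hf0 : ∀ i j, f i j 0 = 0)
    (hpde : ∀ᶠ x in 𝓝 0, ∀ N K, defect J0 c f N K x = 0) :
    ∃ F : (ι → ℂ) → ι → ι → ℂ, ContDiffAt ℂ 1 F 0 ∧
      ∀ᶠ y : ι → ℝ in 𝓝 0, ∀ i j, F (fun k => (y k : ℂ)) i j = f i j y := by
  obtain ⟨χ, hχ, hχ1, hχ2⟩ := exists_cutoff ι (r := 1 / 4) (R := 1 / 3) (by norm_num) (by norm_num)
  obtain ⟨η, hη, hη1, hη2⟩ := exists_cutoff ι (r := 1 / 16) (R := 1 / 8) (by norm_num) (by norm_num)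
  set x₀ : ι → ℝ := fun _ => 5 / 12 with hx₀
  have hx₀n : ‖x₀‖ = 5 / 12 := by
    rw [hx₀, pi_norm_const]; norm_num
  have hx1 : 1 / 3 < ‖x₀‖ := by rw [hx₀n]; norm_num
  have hx2 : ‖x₀‖ < 1 / 2 := by rw [hx₀n]; norm_num
  set D := conc η x₀ J0 with hD
  obtain ⟨φ, hφ, hφ0, hnl, hnl0, huniq⟩ := exists_solution D
  -- the family
  set h : ℝ × (ι → ℝ) → ι → ι → Wiener ι 0 := fun p i j =>
    rep 0 (lap fun x => resc χ f p.1 i j (shear η p.2 x)) with hh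
  have hh0 : Tendsto h (𝓝 0) (𝓝 0) :=
    tendsto_pi_nhds.2 fun i => tendsto_pi_nhds.2 fun j =>
      tendsto_rep_resc hχ hχ2 hf rfl hf0 hη hη2 i j
  set g : ℝ → ι → ι → Wiener ι 0 := fun ε i j =>
    h (ε, 0) i j - nl D 0 (fun k => ε * c k) (h (ε, 0)) i j with hg
  have hcε : Tendsto (fun ε : ℝ => fun k => (ε : ℂ) * c k) (𝓝 0) (𝓝 0) := by
    have : Continuous fun ε : ℝ => fun k => (ε : ℂ) * c k := by fun_prop
    refine (this.tendsto 0).trans_eq ?_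
    congr 1; funext k; simp
  have hg0 : Tendsto g (𝓝 0) (𝓝 0) := by
    have h1 : Tendsto (fun ε : ℝ => h (ε, 0)) (𝓝 0) (𝓝 0) :=
      hh0.comp ((continuous_id.prodMk continuous_const).tendsto' 0 0 rfl)
    have h2 : Tendsto (fun ε : ℝ => (((0, (fun k => (ε : ℂ) * c k), 0), h (ε, 0)) :
        Par ι (Wiener ι 0) × (ι → ι → Wiener ι 0))) (𝓝 0) (𝓝 0) :=
      (tendsto_const_nhds.prodMk_nhds (hcε.prodMk_nhds tendsto_const_nhds)).prodMk_nhds h1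
    have h3 := h1.sub (hnl.continuousAt.tendsto.comp h2)
    have h4 : (0 : ι → ι → Wiener ι 0) - nl D (0 : Par ι (Wiener ι 0) × (ι → ι → Wiener ι 0)).1.1
      (0 : Par ι (Wiener ι 0) × (ι → ι → Wiener ι 0)).1.2.1
      (0 : Par ι (Wiener ι 0) × (ι → ι → Wiener ι 0)).2 = 0 := by
      rw [zero_sub, neg_eq_zero]; exact hnl0
    rw [h4] at h3
    exact h3
  -- the parameter of the solution map
  have hq : Tendsto (fun r : ℝ × (ι → ℂ) => ((r.2, (fun k => (r.1 : ℂ) * c k), g r.1) :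
      Par ι (Wiener ι 0))) (𝓝 0) (𝓝 0) := by
    have hf1 : Tendsto (fun r : ℝ × (ι → ℂ) => r.1) (𝓝 0) (𝓝 0) := continuous_fst.tendsto' 0 0 rfl
    have hf2 : Tendsto (fun r : ℝ × (ι → ℂ) => r.2) (𝓝 0) (𝓝 0) := continuous_snd.tendsto' 0 0 rfl
    exact hf2.prodMk_nhds ((hcε.comp hf1).prodMk_nhds (hg0.comp hf1))
  have hco : Continuous fun p : ℝ × (ι → ℝ) => ((p.1, fun k => (p.2 k : ℂ)) : ℝ × (ι → ℂ)) := by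
    fun_prop
  have hco0 : Tendsto (fun p : ℝ × (ι → ℝ) => ((p.1, fun k => (p.2 k : ℂ)) : ℝ × (ι → ℂ)))
      (𝓝 0) (𝓝 0) := hco.tendsto' 0 0 (by ext <;> simp)
  have hdiff : ∀ᶠ r : ℝ × (ι → ℂ) in 𝓝 0,
      ContDiffAt ℂ 1 φ (r.2, (fun k => (r.1 : ℂ) * c k), g r.1) :=
    hq.eventually (hφ.eventually (by simp))
  have hunit : ∀ᶠ p : ℝ × (ι → ℝ) in 𝓝 0, IsUnit (1 + ∑ L, (p.2 L : ℂ) • D.e1 L) := by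
    have h1 : Continuous fun p : ℝ × (ι → ℝ) => 1 + ∑ L, (p.2 L : ℂ) • D.e1 L :=
      continuous_const.add (continuous_finsetSum _ fun L _ => by fun_prop)
    refine h1.continuousAt.eventually (Units.isOpen.mem_nhds ?_)
    simp
  obtain ⟨δ, hδ, hpde⟩ := Metric.eventually_nhds_iff.1 hpde
  have hfix : ∀ᶠ p : ℝ × (ι → ℝ) in 𝓝 0,
      h p = φ ((fun k => (p.2 k : ℂ)), (fun k => (p.1 : ℂ) * c k), g p.1) := by
    have hη3 : ∃ B, ∀ x, ‖η x‖ ≤ B := by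
      refine (HasCompactSupport.of_support_subset_isCompact (isCompact_closedBall (0 : ι → ℝ) (1 / 8))
        fun x hx => ?_).exists_bound_of_continuous hη.continuous
      by_contra hx'
      rw [mem_closedBall_zero_iff, not_le] at hx'
      exact hx (hη2 x hx'.le)
    obtain ⟨B, hB⟩ := hη3
    have hB0 : 0 ≤ B := (norm_nonneg _).trans (hB 0)
    have e1 : ∀ᶠ p : ℝ × (ι → ℝ) in 𝓝 0, ‖p.2‖ < 1 / (8 * (B + 1)) :=
      (continuous_snd.norm.continuousAt (x := (0 : ℝ × (ι → ℝ)))).eventually_lt continuousAt_const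
        (by simp; positivity)
    have e2 : ∀ᶠ p : ℝ × (ι → ℝ) in 𝓝 0, ‖p.1‖ < δ :=
      (continuous_fst.norm.continuousAt (x := (0 : ℝ × (ι → ℝ)))).eventually_lt continuousAt_const
        (by simpa using hδ)
    have e3 := (((hq.comp hco0).prodMk_nhds hh0).eventually huniq)
    filter_upwards [e1, e2, e3, hunit] with p h1 h2 h3 hu
    refine h3 ?_
    have hdef : ∀ z : ι → ℝ, ‖z‖ < 1 / 4 → ∀ N K,
        defect J0 (fun k => (p.1 : ℂ) * c k) (resc χ f p.1) N K z = 0 := fun z hz N K => by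
      rw [defect_resc hχ1 hf (by omega) hz, hpde, mul_zero]
      rw [dist_zero_right, norm_smul]
      nlinarith [norm_nonneg p.1, norm_nonneg z]
    have hv : ∀ i j, ContDiff ℝ (ord ι 0 + 2 : ℕ) (resc χ f p.1 i j) := fun i j =>
      (contDiff_resc hχ hf i j).comp (contDiff_const.prodMk contDiff_id)
    have hu0 : IsUnit (1 + ∑ L, (((0 : ι → ℝ) L : ℝ) : ℂ) • D.e1 L) := by simp
    have key : ∀ N K, h p N K - nl D (fun k => (p.2 k : ℂ)) (fun k => (p.1 : ℂ) * c k) (h p) N K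
        = g p.1 N K := fun N K => by
      refine ext_evL_ball fun x hx => ?_
      have k1 := ev_sub_nl hη hη2 hu hv (CS_resc hχ2 p.1) hx1 hx2 (fun k => (p.1 : ℂ) * c k) hx N K
      have k2 := ev_sub_nl hη hη2 hu0 hv (CS_resc hχ2 p.1) hx1 hx2 (fun k => (p.1 : ℂ) * c k) hx N K
      have hz : (fun L => (((0 : ι → ℝ) L : ℝ) : ℂ)) = 0 := by funext L; simp
      rw [hz] at k2
      refine k1.trans (Eq.trans ?_ k2.symm)
      have hs0 : shear η 0 x = x := by funext A; simp [shear]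
      rw [hs0]
      by_cases hx8 : ‖x‖ < 1 / 8
      · rw [hdef x (by linarith), hdef]
        have : shear η p.2 x = x + η x • p.2 := rfl
        rw [this]
        have h5 : ‖η x • p.2‖ ≤ 1 / 8 := by
          rw [norm_smul]
          have := mul_le_mul (hB x) h1.le (norm_nonneg _) hB0
          refine this.trans ?_
          rw [mul_one_div, div_le_div_iff₀ (by positivity) (by norm_num)]
          linarith
        linarith [norm_add_le x (η x • p.2)]
      · have : shear η p.2 x = x := by
          funext A; simp [shear, hη2 x (not_lt.1 hx8)]
        rw [this]
    funext i j
    change nl D _ _ (h p) i j + g p.1 i j = h p i j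
    rw [← key i j]
    exact add_sub_cancel _ _
  have hcurry : ∀ᶠ ε : ℝ in 𝓝 0, (∀ᶠ z : ι → ℂ in 𝓝 0,
      ContDiffAt ℂ 1 φ (z, (fun k => (ε : ℂ) * c k), g ε)) ∧
      ∀ᶠ y : ι → ℝ in 𝓝 0, h (ε, y) = φ ((fun k => (y k : ℂ)), (fun k => (ε : ℂ) * c k), g ε) := by
    have d1 : ∀ᶠ r in 𝓝 (0 : ℝ) ×ˢ 𝓝 (0 : ι → ℂ),
        ContDiffAt ℂ 1 φ (r.2, (fun k => (r.1 : ℂ) * c k), g r.1) := by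
      rw [← nhds_prod_eq]; exact hdiff
    have d2 : ∀ᶠ p in 𝓝 (0 : ℝ) ×ˢ 𝓝 (0 : ι → ℝ),
        h p = φ ((fun k => (p.2 k : ℂ)), (fun k => (p.1 : ℂ) * c k), g p.1) := by
      rw [← nhds_prod_eq]; exact hfix
    exact d1.curry.and d2.curry
  obtain ⟨ε, ⟨hd, hy⟩, hε⟩ := ((hcurry.filter_mono nhdsWithin_le_nhds).and
    (self_mem_nhdsWithin : ∀ᶠ ε in 𝓝[>] (0 : ℝ), ε ∈ Set.Ioi (0 : ℝ))).exists
  have hε : 0 < ε := hε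
  refine ⟨fun z i j => ((evL 0).comp D.S)
    (φ ((ε : ℂ)⁻¹ • z, (fun k => (ε : ℂ) * c k), g ε) i j), ?_, ?_⟩
  · have hd0 := hd.self_of_nhds
    refine contDiffAt_pi.2 fun i => contDiffAt_pi.2 fun j => ?_
    have h1 : ContDiffAt ℂ 1 (fun z : ι → ℂ =>
        φ ((ε : ℂ)⁻¹ • z, (fun k => (ε : ℂ) * c k), g ε)) 0 := by
      refine ContDiffAt.comp (f := fun z : ι → ℂ => (((ε : ℂ)⁻¹ • z, (fun k => (ε : ℂ) * c k), g ε) :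
        Par ι (Wiener ι 0))) 0 ?_ (ContDiffAt.prodMk (f := fun z : ι → ℂ => (ε : ℂ)⁻¹ • z)
        (contDiffAt_id.const_smul _) contDiffAt_const)
      simpa using hd0
    exact ((evL 0).comp D.S).contDiff.contDiffAt.comp 0
      (contDiffAt_pi.1 (contDiffAt_pi.1 h1 i) j)
  · have hsc : Tendsto (fun y : ι → ℝ => ε⁻¹ • y) (𝓝 0) (𝓝 0) :=
      (continuous_const_smul _).tendsto' 0 0 (smul_zero _)
    filter_upwards [hsc.eventually hy, hsc.eventually
      (eventually_norm_lt (x := (0 : ι → ℝ)) (r := 1 / 4) (by simp))] with y h1 h2 i j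
    have h3 : (ε : ℂ)⁻¹ • (fun k => (y k : ℂ)) = fun k => (((ε⁻¹ • y) k : ℝ) : ℂ) := by
      funext k; simp
    change ev 0 (D.S (φ ((ε : ℂ)⁻¹ • (fun k => (y k : ℂ)), _, _) i j)) = _
    rw [h3, ← h1]
    have hv : ContDiff ℝ (ord ι 0 + 2 : ℕ) (resc χ f ε i j) :=
      (contDiff_resc hχ hf i j).comp (contDiff_const.prodMk contDiff_id)
    have h4 := ev_S (η := η) (J0 := J0) (contDiff_comp_shear (y := ε⁻¹ • y) hη hv)
      (CS_shear hη2 (CS_resc hχ2 ε i j)) hx1 hx2 (x := 0) (by simp)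
    refine h4.trans ?_
    have h5 : shear η (ε⁻¹ • y) 0 = ε⁻¹ • y := by
      funext A; simp [shear, hη1 0 (by simp)]
    rw [h5, resc_eq hχ1 h2, smul_smul, mul_inv_cancel₀ hε.ne', one_smul]
end KM
end NN

namespace NN
open scoped BigOperators Topology ContDiff
open Filter
open Wiener
set_option linter.unusedSectionVars false
namespace KM

variable {ι : Type*} [Fintype ι] [DecidableEq ι]

theorem exists_contDiff_eventuallyEq {F : Type*} [NormedAddCommGroup F] [NormedSpace ℝ F] {n : ℕ}
    {g : (ι → ℝ) → F} (hg : ContDiffAt ℝ n g 0) :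
    ∃ G : (ι → ℝ) → F, ContDiff ℝ n G ∧ G =ᶠ[𝓝 0] g := by
  obtain ⟨r, hr, hr'⟩ := Metric.eventually_nhds_iff_ball.1 (hg.eventually (natCast_ne_infty n))
  obtain ⟨χ, hχ, hχ1, hχ2⟩ := exists_cutoff ι (r := r / 4) (R := r / 2) (by positivity)
    (by linarith)
  refine ⟨fun x => χ x • g x, contDiff_iff_contDiffAt.2 fun x => ?_, ?_⟩
  · by_cases hx : ‖x‖ < r
    · exact (contDiff_infty.1 hχ n).contDiffAt.smul (hr' x (by simpa using hx))
    · have : (fun x => χ x • g x) =ᶠ[𝓝 x] fun _ => 0 := by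
        have h1 : ∀ᶠ y in 𝓝 x, r / 2 < ‖y‖ :=
          (continuous_norm.tendsto x).eventually_const_lt (by linarith [not_lt.1 hx])
        filter_upwards [h1] with y hy
        rw [hχ2 y hy.le, zero_smul]
      exact contDiffAt_const.congr_of_eventuallyEq this
  · filter_upwards [eventually_norm_lt (x := (0 : ι → ℝ)) (r := r / 4) (by simpa using by linarith)]
      with x hx
    rw [hχ1 x hx.le, one_smul]

theorem dx_ofReal {g : (ι → ℝ) → ℝ} {x : ι → ℝ} (hg : DifferentiableAt ℝ g x) (j : ι) :
    dx j (fun y => (g y : ℂ)) x = (dx j g x : ℝ) :=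
  by
  have h : HasFDerivAt (fun y => (g y : ℂ)) (Complex.ofRealCLM.comp (fderiv ℝ g x)) x :=
    Complex.ofRealCLM.hasFDerivAt.comp x hg.hasFDerivAt
  simp only [dx, h.fderiv]
  rfl

theorem dx_sub_const {g : (ι → ℝ) → ℂ} (c : ℂ) (j : ι) (x : ι → ℝ) :
    dx j (fun y => g y - c) x = dx j g x := by
  simp only [dx, fderiv_sub_const]

/-- A divergence-normalised integrable structure extends to a holomorphic matrix field. -/
theorem exists_holomorphic_structure [Nonempty ι] {J : (ι → ℝ) → Matrix ι ι ℝ} {I₀ : Matrix ι ι ℝ}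
    {c : ι → ℝ} (hI : ∀ i j, I₀ i j = -I₀ j i)
    (hJ : ∀ i j, ContDiffAt ℝ (ord ι 0 + 2 : ℕ) (fun y => J y i j) 0) (hJ0 : J 0 = I₀)
    (hsq : ∀ᶠ y in 𝓝 0, J y * J y = -1) (hinteg : ∀ᶠ y in 𝓝 0, Integ J y)
    (hdiv : ∀ᶠ y in 𝓝 0, ∀ C, ∑ A, dx A (fun y => J y A C) y = c C) :
    ∃ F : (ι → ℂ) → Matrix ι ι ℂ, (∀ i j, ContDiffAt ℂ 1 (fun z => F z i j) 0) ∧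
      ∀ᶠ y : ι → ℝ in 𝓝 0, F (fun k => (y k : ℂ)) = (J y).map ((↑) : ℝ → ℂ) := by
  have hJ' : ∀ᶠ y in 𝓝 0, ∀ i j, ContDiffAt ℝ 2 (fun y => J y i j) y :=
    eventually_all.2 fun i => eventually_all.2 fun j =>
      ((hJ i j).eventually (natCast_ne_infty _)).mono fun y hy => hy.of_le (by norm_cast; omega)
  have hJc : ∀ i j, ContDiffAt ℝ (ord ι 0 + 2 : ℕ) (fun y => ((J y i j : ℝ) : ℂ) - (I₀ i j : ℝ)) 0 :=
    fun i j => (Complex.ofRealCLM.contDiff.contDiffAt.comp (0 : ι → ℝ) (hJ i j)).sub contDiffAt_const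
  choose f hf hfe using fun i j => exists_contDiff_eventuallyEq (hJc i j)
  have hfe' : ∀ᶠ x in 𝓝 0, ∀ i j, f i j =ᶠ[𝓝 x] fun y => ((J y i j : ℝ) : ℂ) - (I₀ i j : ℝ) :=
    eventually_all.2 fun i => eventually_all.2 fun j => (hfe i j).eventuallyEq_nhds
  have hpde : ∀ᶠ x in 𝓝 0, ∀ N K, defect (fun i j => (I₀ i j : ℂ)) (fun i => (c i : ℂ)) f N K x = 0 := by
    filter_upwards [hfe', hJ', hJ'.eventually_nhds, hsq.eventually_nhds, hinteg.eventually_nhds,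
      hdiv.eventually_nhds] with x hx hJx hJx' h1 h2 h3 N K
    have key := laplacian_eq hI hJx h1 h2 h3 N K
    have hd : ∀ᶠ y in 𝓝 x, ∀ i j, DifferentiableAt ℝ (fun y => J y i j) y :=
      hJx'.mono fun y hy i j => (hy i j).differentiableAt (by norm_num)
    have hd1 : ∀ M i j, dx M (f i j) =ᶠ[𝓝 x] fun y => ((dx M (fun y => J y i j) y : ℝ) : ℂ) := by
      intro M i j
      filter_upwards [(hx i j).eventuallyEq_nhds, hd] with y hy hdy
      rw [dx_congr hy, dx_sub_const, dx_ofReal (hdy i j)]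
    have hd2 : ∀ M P i j, dx M (dx P (f i j)) x = ((dx M (dx P fun y => J y i j) x : ℝ) : ℂ) := by
      intro M P i j
      rw [dx_congr (hd1 P i j), dx_ofReal]
      exact (contDiffAt_dx (m := 1) (hJx i j) P).differentiableAt (by norm_num)
    have e0 : ∀ i j, f i j x = ((J x i j - I₀ i j : ℝ) : ℂ) := fun i j => by
      rw [(hx i j).self_of_nhds]; push_cast; rfl
    have e1 : ∀ M i j, dx M (f i j) x = ((dx M (fun y => J y i j) x : ℝ) : ℂ) :=
      fun M i j => (hd1 M i j).self_of_nhds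
    have h5 := congrArg (Complex.ofRealHom) key
    rw [map_ellRhs, map_sum] at h5
    simp only [defect, lap, hd2, e1, e0]
    simp only [Complex.ofRealHom_eq_coe] at h5
    rw [h5, sub_eq_zero]
    congr 1
    funext i j
    push_cast; ring
  obtain ⟨F, hF, hFe⟩ := exists_holomorphic_extension (J0 := fun i j => (I₀ i j : ℂ))
    (c := fun i => (c i : ℂ)) hf (fun i j => by
      rw [(hfe i j).self_of_nhds]
      change ((J 0 i j : ℝ) : ℂ) - (I₀ i j : ℝ) = 0
      rw [hJ0, sub_self]) hpde
  refine ⟨fun z i j => F z i j + (I₀ i j : ℝ), fun i j => ?_, ?_⟩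
  · have h1 := contDiffAt_pi.1 (contDiffAt_pi.1 hF i) j
    exact h1.add contDiffAt_const
  · filter_upwards [hFe, hfe'] with y hy hy'
    ext i j
    change F _ i j + _ = ((J y i j : ℝ) : ℂ)
    rw [hy, (hy' i j).self_of_nhds]
    ring
end KM
end NN

namespace NN
open scoped BigOperators Topology ContDiff
open Filter
open Wiener
set_option linter.unusedSectionVars false

section Nemytskii
variable {K E F : Type*} [TopologicalSpace K] [CompactSpace K] [NormedAddCommGroup E]
  [NormedSpace ℂ E] [NormedAddCommGroup F] [NormedSpace ℂ F]

/-- Pointwise application of a continuous family of operators. -/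
noncomputable def applyL (K E F : Type*) [TopologicalSpace K] [CompactSpace K]
    [NormedAddCommGroup E] [NormedSpace ℂ E] [NormedAddCommGroup F] [NormedSpace ℂ F] :
    C(K, E →L[ℂ] F) →L[ℂ] C(K, E) →L[ℂ] C(K, F) :=
  LinearMap.mkContinuous₂
    (LinearMap.mk₂ ℂ (fun (A : C(K, E →L[ℂ] F)) (u : C(K, E)) =>
      (⟨fun k => A k (u k), A.continuous.clm_apply u.continuous⟩ : C(K, F)))
      (fun A B u => by ext; simp) (fun c A u => by ext; simp) (fun A u v => by ext; simp)
      (fun c A u => by ext; simp)) 1 fun A u => by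
    rw [one_mul, ContinuousMap.norm_le _ (by positivity)]
    intro k
    exact ((A k).le_opNorm _).trans (mul_le_mul (A.norm_coe_le_norm k) (u.norm_coe_le_norm k)
      (norm_nonneg _) ((norm_nonneg _).trans (A.norm_coe_le_norm k)))

@[simp] theorem applyL_apply (A : C(K, E →L[ℂ] F)) (u : C(K, E)) (k : K) :
    applyL K E F A u k = A k (u k) := rfl

/-- Constant functions, as a continuous linear map. -/
noncomputable def constL (K E : Type*) [TopologicalSpace K] [CompactSpace K]
    [NormedAddCommGroup E] [NormedSpace ℂ E] : E →L[ℂ] C(K, E) :=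
  LinearMap.mkContinuous
    { toFun := fun x => ContinuousMap.const K x
      map_add' := fun _ _ => rfl
      map_smul' := fun _ _ => rfl } 1 fun x => by
    rw [one_mul]
    exact (ContinuousMap.norm_le _ (norm_nonneg _)).2 fun k => le_rfl

@[simp] theorem constL_apply (x : E) (k : K) : constL K E x k = x := rfl

/-- A global continuous representative of a continuously differentiable germ at the origin,
together with a global continuous representative of its derivative. -/
structure Germ (f : E → F) (r : ℝ) (g : C(E, F)) (D : C(E, E →L[ℂ] F)) : Prop where
  pos : 0 < r
  eq : ∀ x, ‖x‖ < r → g x = f x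
  deriv : ∀ x, ‖x‖ < r → HasFDerivAt f (D x) x

theorem continuous_cutoff_smul {G : Type*} [NormedAddCommGroup G] [NormedSpace ℂ G] {χ : E → ℝ}
    {h : E → G} {q r : ℝ} (hχ : Continuous χ) (hqr : q < r) (hχ0 : ∀ x, q ≤ ‖x‖ → χ x = 0)
    (hh : ∀ x, ‖x‖ < r → ContinuousAt h x) : Continuous fun x => (χ x : ℂ) • h x := by
  refine continuous_iff_continuousAt.2 fun x => ?_
  by_cases hx : ‖x‖ < r
  · exact (Complex.continuous_ofReal.comp hχ).continuousAt.smul (hh x hx)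
  · have : (fun x => (χ x : ℂ) • h x) =ᶠ[𝓝 x] fun _ => 0 := by
      have h1 : ∀ᶠ y in 𝓝 x, q < ‖y‖ :=
        (continuous_norm.tendsto x).eventually_const_lt (by linarith [not_lt.1 hx])
      filter_upwards [h1] with y hy
      rw [hχ0 y hy.le, Complex.ofReal_zero, zero_smul]
    exact continuousAt_const.congr this.symm

theorem exists_germ {f : E → F} (hf : ContDiffAt ℂ 1 f 0) : ∃ r g D, Germ f r g D := by
  obtain ⟨f', s, hs, hc, hd⟩ := contDiffAt_one_iff.1 hf
  obtain ⟨r, hr, hrs⟩ := Metric.mem_nhds_iff.1 hs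
  set χ : E → ℝ := fun x => max 0 (min 1 (2 - ‖x‖ * (4 / r))) with hχ
  have hχc : Continuous χ := by fun_prop
  have hχ1 : ∀ x, ‖x‖ < r / 4 → χ x = 1 := fun x hx => by
    have : ‖x‖ * (4 / r) ≤ 1 := by
      rw [← mul_div_assoc, div_le_one hr]; linarith
    simp only [hχ]
    rw [min_eq_left (by linarith), max_eq_right (by norm_num)]
  have hχ0 : ∀ x, r / 2 ≤ ‖x‖ → χ x = 0 := fun x hx => by
    have : 2 ≤ ‖x‖ * (4 / r) := by
      rw [← mul_div_assoc, le_div_iff₀ hr]; linarith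
    simp only [hχ]
    exact max_eq_left ((min_le_right _ _).trans (by linarith))
  have hball : ∀ x, ‖x‖ < r → s ∈ 𝓝 x := fun x hx =>
    Filter.mem_of_superset (Metric.isOpen_ball.mem_nhds (by simpa using hx)) hrs
  refine ⟨r / 4, ⟨fun x => (χ x : ℂ) • f x, continuous_cutoff_smul hχc (half_lt_self hr) hχ0 fun x hx => ?_⟩,
    ⟨fun x => (χ x : ℂ) • f' x, continuous_cutoff_smul (h := f') hχc (half_lt_self hr) hχ0 fun x hx => ?_⟩, by positivity, fun x hx => ?_, fun x hx => ?_⟩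
  · exact (hd x (mem_of_mem_nhds (hball x hx))).continuousAt
  · exact hc.continuousAt (hball x hx)
  · change (χ x : ℂ) • f x = f x
    rw [hχ1 x hx, Complex.ofReal_one, one_smul]
  · change HasFDerivAt f ((χ x : ℂ) • f' x) x
    rw [hχ1 x hx, Complex.ofReal_one, one_smul]
    exact hd x (mem_of_mem_nhds (hball x (by linarith)))

variable {f : E → F} {r : ℝ} {g : C(E, F)} {D : C(E, E →L[ℂ] F)}

theorem Germ.hasFDerivAt (h : Germ f r g D) {x : E} (hx : ‖x‖ < r) : HasFDerivAt g (D x) x := by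
  refine (h.deriv x hx).congr_of_eventuallyEq ?_
  filter_upwards [(continuous_norm.tendsto x).eventually_lt_const hx] with y hy
  exact h.eq y hy

/-- The superposition operator is differentiable. -/
theorem Germ.hasFDerivAt_comp (h : Germ f r g D) {u : C(K, E)} (hu : ‖u‖ < r) :
    HasFDerivAt (fun v : C(K, E) => g.comp v) (applyL K E F (D.comp u)) u := by
  rw [hasFDerivAt_iff_isLittleO_nhds_zero, Asymptotics.isLittleO_iff]
  intro ε hε
  have h1 : Tendsto (fun w : C(K, E) => D.comp (u + w)) (𝓝 0) (𝓝 (D.comp u)) := by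
    have h2 : Continuous fun w : C(K, E) => D.comp (u + w) :=
      (ContinuousMap.continuous_postcomp D).comp (continuous_const.add continuous_id)
    simpa using h2.tendsto 0
  have h2 : ∀ᶠ w : C(K, E) in 𝓝 0, ∀ k, ‖D (u k + w k) - D (u k)‖ < ε := by
    filter_upwards [Metric.tendstoUniformly_iff.1
      (ContinuousMap.tendsto_iff_tendstoUniformly.1 h1) ε hε] with w hw k
    rw [← dist_eq_norm, dist_comm]
    exact hw k
  obtain ⟨δ, hδ, hδ'⟩ := Metric.eventually_nhds_iff_ball.1 h2
  filter_upwards [Metric.ball_mem_nhds (0 : C(K, E)) (lt_min hδ (sub_pos.2 hu))] with w hw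
  have hw1 : ‖w‖ < δ := (by simpa using hw : ‖w‖ < _).trans_le (min_le_left _ _)
  have hw2 : ‖w‖ < r - ‖u‖ := (by simpa using hw : ‖w‖ < _).trans_le (min_le_right _ _)
  rw [ContinuousMap.norm_le _ (by positivity)]
  intro k
  change ‖g (u k + w k) - g (u k) - D (u k) (w k)‖ ≤ _
  have hseg : ∀ y ∈ segment ℝ (u k) (u k + w k), HasFDerivAt g (D y) y ∧ ‖D y - D (u k)‖ ≤ ε := by
    intro y hy
    rw [segment_eq_image'] at hy
    obtain ⟨t, ht, rfl⟩ := hy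
    rw [add_sub_cancel_left]
    have htw : ‖t • w‖ ≤ ‖w‖ := by
      rw [norm_smul, Real.norm_of_nonneg ht.1]
      exact mul_le_of_le_one_left (norm_nonneg _) ht.2
    constructor
    · refine h.hasFDerivAt ?_
      calc ‖u k + t • w k‖ = ‖(u + t • w) k‖ := rfl
        _ ≤ ‖u + t • w‖ := ContinuousMap.norm_coe_le_norm _ _
        _ ≤ ‖u‖ + ‖t • w‖ := norm_add_le _ _
        _ < r := by linarith
    · exact (hδ' (t • w) (by simpa using htw.trans_lt hw1) k).le
  have h4 := (convex_segment (u k) (u k + w k)).norm_image_sub_le_of_norm_hasFDerivWithin_le'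
    (𝕜 := ℂ) (fun y hy => (hseg y hy).1.hasFDerivWithinAt) (fun y hy => (hseg y hy).2)
    (left_mem_segment ℝ _ _) (right_mem_segment ℝ _ _)
  rw [add_sub_cancel_left] at h4
  exact h4.trans (mul_le_mul_of_nonneg_left (w.norm_coe_le_norm k) hε.le)

/-- The superposition operator is continuously differentiable. -/
theorem Germ.contDiffAt_comp (h : Germ f r g D) {u : C(K, E)} (hu : ‖u‖ < r) :
    ContDiffAt ℂ 1 (fun v : C(K, E) => g.comp v) u :=
  contDiffAt_one_iff.2 ⟨fun u => applyL K E F (D.comp u), Metric.ball 0 r,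
    Metric.isOpen_ball.mem_nhds (by simpa using hu),
    ((applyL K E F).continuous.comp (ContinuousMap.continuous_postcomp D)).continuousOn,
    fun _ hu => h.hasFDerivAt_comp (by simpa using hu)⟩
end Nemytskii

section Integral
variable {F : Type*} [NormedAddCommGroup F] [NormedSpace ℂ F] [CompleteSpace F]

/-- Integration against a continuous weight on an interval. -/
noncomputable def weightL (F : Type*) [NormedAddCommGroup F] [NormedSpace ℂ F]
    {a b : ℝ} (hab : a ≤ b) (ρ : C(ℝ, ℂ)) : C(Set.Icc a b, F) →L[ℂ] F :=
  LinearMap.mkContinuousOfExistsBound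
    { toFun := fun φ => ∫ t in a..b, ρ t • φ (Set.projIcc a b hab t)
      map_add' := fun φ ψ => by
        simp only [ContinuousMap.add_apply, smul_add]
        exact intervalIntegral.integral_add
          (by apply Continuous.intervalIntegrable; fun_prop)
          (by apply Continuous.intervalIntegrable; fun_prop)
      map_smul' := fun c φ => by
        simp only [ContinuousMap.smul_apply, smul_comm _ c, RingHom.id_apply]
        exact intervalIntegral.integral_smul c _ } <| by
    obtain ⟨C, hC⟩ := (isCompact_Icc (a := a) (b := b)).exists_bound_of_continuousOn
      ρ.continuous.continuousOn
    refine ⟨C * |b - a|, fun φ => ?_⟩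
    change ‖∫ t in a..b, ρ t • φ (Set.projIcc a b hab t)‖ ≤ _
    rw [mul_right_comm]
    refine intervalIntegral.norm_integral_le_of_norm_le_const fun t ht => ?_
    rw [norm_smul]
    rw [Set.uIoc_of_le hab] at ht
    exact mul_le_mul (hC t ⟨ht.1.le, ht.2⟩) (φ.norm_coe_le_norm _) (norm_nonneg _)
      ((norm_nonneg _).trans (hC t ⟨ht.1.le, ht.2⟩))

theorem weightL_apply {a b : ℝ} (hab : a ≤ b) (ρ : C(ℝ, ℂ)) (φ : C(Set.Icc a b, F)) :
    weightL F hab ρ φ = ∫ t in a..b, ρ t • φ (Set.projIcc a b hab t) := rfl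
end Integral
end NN

namespace NN
open scoped BigOperators Topology ContDiff
open Filter
open Wiener
set_option linter.unusedSectionVars false

section Holomorphic
variable {E F : Type*} [NormedAddCommGroup E] [NormedSpace ℂ E] [NormedAddCommGroup F]
  [NormedSpace ℂ F]

/-- The weight of the Cauchy formula for the first derivative. -/
noncomputable def cauchyWeight : C(ℝ, ℂ) :=
  ⟨fun θ => deriv (circleMap 0 1) θ * (1 / (circleMap 0 1 θ - 0) ^ 2), by
    simp only [deriv_circleMap, sub_zero]
    refine Continuous.mul (by fun_prop) (continuous_const.div (by fun_prop) fun θ => ?_)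
    exact pow_ne_zero _ (circleMap_ne_center one_ne_zero)⟩

theorem deriv_eq_weightL [CompleteSpace F] {h : ℂ → F} (hh : DiffContOnCl ℂ h (Metric.ball 0 1))
    {φ : C(Set.Icc 0 (2 * Real.pi), F)} (hφ : ∀ θ, φ θ = h (circleMap 0 1 θ)) :
    deriv h 0 = (2 * Real.pi * Complex.I : ℂ)⁻¹ • weightL F Real.two_pi_pos.le cauchyWeight φ := by
  have h1 := hh.deriv_eq_smul_circleIntegral one_pos
  have h2 := hh.circleIntegral_one_div_sub_center_pow_smul one_pos 1
  simp only [Nat.factorial_one, Nat.cast_one, div_one, iteratedDeriv_one] at h2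
  have h3 : weightL F Real.two_pi_pos.le cauchyWeight φ = (2 * Real.pi * Complex.I : ℂ) • deriv h 0 := by
    rw [← h2, weightL_apply, circleIntegral]
    refine intervalIntegral.integral_congr fun θ hθ => ?_
    rw [Set.uIcc_of_le Real.two_pi_pos.le] at hθ
    change (deriv (circleMap 0 1) θ * (1 / (circleMap 0 1 θ - 0) ^ 2)) • φ _ = _
    rw [hφ, Set.projIcc_of_mem _ hθ, mul_smul]
  rw [h3, inv_smul_smul₀]
  exact Complex.two_pi_I_ne_zero

theorem contDiffAt_fderiv_apply_zero [CompleteSpace F] {f : E → F} (hf : ContDiffAt ℂ 1 f 0) (v : E) :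
    ContDiffAt ℂ 1 (fun x => fderiv ℂ f x v) 0 := by
  obtain ⟨r, g, D, hg⟩ := exists_germ hf
  have hr := hg.pos
  set c : ℝ := r / (2 * (‖v‖ + 1)) with hc
  have hc0 : 0 < c := by positivity
  have hcv : ‖(c : ℂ) • v‖ < r / 2 := by
    rw [norm_smul, Complex.norm_real, Real.norm_of_nonneg hc0.le, hc, div_mul_eq_mul_div,
      div_lt_div_iff₀ (by positivity) two_pos]
    nlinarith [norm_nonneg v]
  suffices h : ContDiffAt ℂ 1 (fun x => fderiv ℂ f x ((c : ℂ) • v)) 0 by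
    have h2 : (fun x => fderiv ℂ f x v) = fun x => (c : ℂ)⁻¹ • fderiv ℂ f x ((c : ℂ) • v) := by
      funext x
      rw [map_smul, inv_smul_smul₀]
      exact_mod_cast hc0.ne'
    rw [h2]
    exact h.const_smul _
  generalize (c : ℂ) • v = w at hcv
  set u : C(Set.Icc 0 (2 * Real.pi), E) := ⟨fun θ => circleMap 0 1 θ • w, by fun_prop⟩ with hu
  have hun : ‖u‖ < r := by
    refine lt_of_le_of_lt ((ContinuousMap.norm_le _ (norm_nonneg w)).2 fun θ => ?_) (by linarith)
    change ‖circleMap 0 1 θ • w‖ ≤ _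
    rw [norm_smul, norm_circleMap_zero, abs_one, one_mul]
  have h1 : ContDiffAt ℂ 1 (fun x : E => (2 * Real.pi * Complex.I : ℂ)⁻¹ •
      weightL F Real.two_pi_pos.le cauchyWeight
        (g.comp (constL (Set.Icc 0 (2 * Real.pi)) E x + u))) 0 := by
    refine ContDiffAt.const_smul _ ((weightL F Real.two_pi_pos.le cauchyWeight).contDiff.contDiffAt.comp
      (0 : E) ?_)
    refine ContDiffAt.comp (g := fun v : C(Set.Icc 0 (2 * Real.pi), E) => g.comp v)
      (f := fun x : E => (constL (Set.Icc 0 (2 * Real.pi)) E x + u)) (0 : E) ?_ ?_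
    · rw [map_zero, zero_add]
      exact hg.contDiffAt_comp hun
    · exact ((constL (Set.Icc 0 (2 * Real.pi)) E).contDiff.add
        contDiff_const).contDiffAt
  refine h1.congr_of_eventuallyEq ?_
  filter_upwards [(continuous_norm.tendsto (0 : E)).eventually_lt_const
    (by simpa using half_pos hr : ‖(0 : E)‖ < r / 2)] with x hx
  have hb : ∀ ζ : ℂ, ‖ζ‖ ≤ 1 → ‖x + ζ • w‖ < r := fun ζ hζ => by
    refine (norm_add_le _ _).trans_lt ?_
    rw [norm_smul]
    nlinarith [norm_nonneg w, norm_nonneg ζ]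
  have hline : ∀ ζ : ℂ, ‖ζ‖ ≤ 1 → HasDerivAt (fun ζ : ℂ => f (x + ζ • w)) (D (x + ζ • w) w) ζ := by
    intro ζ hζ
    have h2 : HasDerivAt (fun ζ : ℂ => x + ζ • w) w ζ := by
      simpa using ((hasDerivAt_id ζ).smul_const w).const_add x
    exact (hg.deriv _ (hb ζ hζ)).comp_hasDerivAt ζ h2
  have h3 : DiffContOnCl ℂ (fun ζ : ℂ => f (x + ζ • w)) (Metric.ball 0 1) := by
    refine DifferentiableOn.diffContOnCl fun ζ hζ => ?_
    rw [closure_ball _ one_ne_zero] at hζ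
    exact (hline ζ (by simpa using hζ)).differentiableAt.differentiableWithinAt
  rw [← deriv_eq_weightL h3, (hline 0 (by simp)).deriv, zero_smul, add_zero,
    (hg.deriv x (by linarith)).fderiv]
  intro θ
  change g (x + circleMap 0 1 θ • w) = _
  exact hg.eq _ (hb _ (by simp))

theorem contDiffAt_fderiv_apply [CompleteSpace F] {f : E → F} {a : E} (hf : ContDiffAt ℂ 1 f a) (v : E) :
    ContDiffAt ℂ 1 (fun x => fderiv ℂ f x v) a := by
  have h1 : ContDiffAt ℂ 1 (fun x => f (a + x)) 0 :=
    ContDiffAt.comp (0 : E) (by simpa using hf) (contDiff_const.add contDiff_id).contDiffAt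
  have h2 := contDiffAt_fderiv_apply_zero h1 v
  have h3 : ContDiffAt ℂ 1 (fun x => fderiv ℂ (fun x => f (a + x)) (x - a) v) a :=
    ContDiffAt.comp (g := fun x => fderiv ℂ (fun x => f (a + x)) x v) a (by simpa using h2)
      (contDiff_id.sub contDiff_const).contDiffAt
  refine h3.congr_of_eventuallyEq (Eventually.of_forall fun x => ?_)
  change _ = fderiv ℂ (fun x => f (a + x)) (x - a) v
  rw [fderiv_comp_add_left, add_sub_cancel]

theorem contDiffAt_clm [FiniteDimensional ℂ E] {G : Type*} [NormedAddCommGroup G] [NormedSpace ℂ G]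
    {f : G → E →L[ℂ] F} {a : G} {n : ℕ} (h : ∀ v, ContDiffAt ℂ n (fun x => f x v) a) :
    ContDiffAt ℂ n f a := by
  simp only [← contDiffWithinAt_univ] at h ⊢
  let d := Module.finrank ℂ E
  have hd : d = Module.finrank ℂ (Fin d → ℂ) := (Module.finrank_fin_fun ℂ).symm
  let e₁ := ContinuousLinearEquiv.ofFinrankEq hd
  let e₂ := (e₁.arrowCongr (1 : F ≃L[ℂ] F)).trans (ContinuousLinearEquiv.piRing (Fin d))
  rw [← Function.id_comp f, ← e₂.symm_comp_self]
  exact e₂.symm.contDiff.comp_contDiffWithinAt (contDiffWithinAt_pi.mpr fun i => h _)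

/-- Complex differentiability implies smoothness of every finite order. -/
theorem contDiffAt_of_one [FiniteDimensional ℂ E] [CompleteSpace F] {f : E → F} {a : E}
    (hf : ContDiffAt ℂ 1 f a) (n : ℕ) : ContDiffAt ℂ n f a := by
  induction n generalizing f with
  | zero => exact hf.of_le (by norm_cast)
  | succ n ih =>
    obtain ⟨f', s, hs, hc, hd⟩ := contDiffAt_one_iff.1 hf
    refine (contDiffAt_succ_iff_hasFDerivAt (n := n)).2 ⟨fderiv ℂ f, ⟨s, hs, fun x hx =>
      (hd x hx).differentiableAt.hasFDerivAt⟩, contDiffAt_clm fun v => ih ?_⟩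
    exact contDiffAt_fderiv_apply hf v
end Holomorphic
end NN

namespace NN
open scoped BigOperators Topology ContDiff
open Filter
open Wiener
set_option linter.unusedSectionVars false

section Identity
variable {ι F : Type*} [Fintype ι] [NormedAddCommGroup F] [NormedSpace ℂ F] [CompleteSpace F]

/-- A holomorphic function vanishing at the real points vanishes. -/
theorem eventually_eq_zero_of_real {H : (ι → ℂ) → F} (hH : ContDiffAt ℂ 1 H 0)
    (h0 : ∀ᶠ y : ι → ℝ in 𝓝 0, H (fun k => (y k : ℂ)) = 0) : ∀ᶠ z in 𝓝 0, H z = 0 := by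
  have hd : ∀ᶠ z in 𝓝 0, DifferentiableAt ℂ H z :=
    (hH.eventually (natCast_ne_infty 1)).mono fun z hz => hz.differentiableAt (by norm_num)
  obtain ⟨r, hr, hr'⟩ := Metric.eventually_nhds_iff_ball.1 hd
  obtain ⟨q, hq, hq'⟩ := Metric.eventually_nhds_iff_ball.1 h0
  simp only [mem_ball_zero_iff] at hr' hq'
  filter_upwards [Metric.ball_mem_nhds (0 : ι → ℂ) (show 0 < min r q / 3 by positivity)] with z hz
  rw [mem_ball_zero_iff] at hz
  have hzr : 3 * ‖z‖ < r := by linarith [min_le_left r q]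
  have hzq : 3 * ‖z‖ < q := by linarith [min_le_right r q]
  have hb : ∀ t : ℂ, ‖t‖ < 2 → ‖fun k => ((z k).re : ℂ) + t * ((z k).im : ℂ)‖ ≤ 3 * ‖z‖ := by
    intro t ht
    refine (pi_norm_le_iff_of_nonneg (by positivity)).2 fun k => ?_
    refine (norm_add_le _ _).trans ?_
    rw [norm_mul, Complex.norm_real, Complex.norm_real, Real.norm_eq_abs, Real.norm_eq_abs]
    have h1 := (Complex.abs_re_le_norm (z k)).trans (norm_le_pi_norm z k)
    have h2 := (Complex.abs_im_le_norm (z k)).trans (norm_le_pi_norm z k)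
    nlinarith [norm_nonneg t, abs_nonneg (z k).im]
  set h : ℂ → F := fun t => H fun k => ((z k).re : ℂ) + t * ((z k).im : ℂ) with hh
  have hdiff : DifferentiableOn ℂ h (Metric.ball 0 2) := fun t ht => by
    rw [mem_ball_zero_iff] at ht
    refine DifferentiableAt.differentiableWithinAt (DifferentiableAt.comp t
      (hr' _ ((hb t ht).trans_lt hzr)) ?_)
    fun_prop
  have hreal : ∀ s : ℝ, |s| < 2 → h (s : ℂ) = 0 := by
    intro s hs
    have h1 := hb s (by simpa using hs)
    have h2 : (fun k => ((z k).re : ℂ) + (s : ℂ) * ((z k).im : ℂ)) =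
        fun k => (((z k).re + s * (z k).im : ℝ) : ℂ) := by
      funext k; push_cast; rfl
    rw [h2] at h1
    simp only [hh]
    rw [h2]
    refine hq' (fun k => (z k).re + s * (z k).im) (lt_of_le_of_lt ?_ hzq)
    refine (pi_norm_le_iff_of_nonneg (by positivity)).2 fun k => ?_
    have h3 := (norm_le_pi_norm _ k).trans h1
    rwa [Complex.norm_real] at h3
  have hfreq : ∃ᶠ t in 𝓝[≠] (0 : ℂ), h t = 0 := by
    have h1 : Tendsto (fun s : ℝ => (s : ℂ)) (𝓝[≠] 0) (𝓝[≠] 0) := by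
      refine tendsto_nhdsWithin_iff.2 ⟨?_, ?_⟩
      · exact (Complex.continuous_ofReal.tendsto' 0 0 (by simp)).mono_left nhdsWithin_le_nhds
      · filter_upwards [self_mem_nhdsWithin] with s hs
        simpa using hs
    refine h1.frequently (Eventually.frequently ?_)
    refine Filter.Eventually.filter_mono nhdsWithin_le_nhds ?_
    filter_upwards [Metric.ball_mem_nhds (0 : ℝ) two_pos] with s hs
    exact hreal s (by simpa using hs)
  have h1 := (hdiff.analyticOnNhd Metric.isOpen_ball).eqOn_zero_of_preconnected_of_frequently_eq_zero
    (convex_ball (0 : ℂ) 2).isPreconnected (Metric.mem_ball_self two_pos) hfreq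
  have h2 := h1 (show Complex.I ∈ Metric.ball (0 : ℂ) 2 by simp)
  simp only [hh, Pi.zero_apply] at h2
  convert h2 using 2
  funext k
  rw [mul_comm]
  exact (Complex.re_add_im (z k)).symm
end Identity

section Primitive
variable {E : Type*} [NormedAddCommGroup E] [NormedSpace ℂ E] [CompleteSpace E]

/-- The primitive of a continuous function on the unit interval, extended to the line. -/
noncomputable def prim (u : C(Set.Icc (0 : ℝ) 1, E)) (s : ℝ) : E :=
  ∫ t in (0 : ℝ)..s, u (Set.projIcc 0 1 zero_le_one t)

theorem hasDerivAt_prim (u : C(Set.Icc (0 : ℝ) 1, E)) (s : ℝ) :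
    HasDerivAt (prim u) (u (Set.projIcc 0 1 zero_le_one s)) s := by
  have h : Continuous fun t : ℝ => u (Set.projIcc 0 1 zero_le_one t) := by fun_prop
  exact intervalIntegral.integral_hasDerivAt_right (h.intervalIntegrable _ _)
    (h.stronglyMeasurableAtFilter _ _) h.continuousAt

@[simp] theorem prim_zero (u : C(Set.Icc (0 : ℝ) 1, E)) : prim u 0 = 0 :=
  intervalIntegral.integral_same

/-- The primitive operator on continuous functions on the unit interval. -/
noncomputable def primL (E : Type*) [NormedAddCommGroup E] [NormedSpace ℂ E] [CompleteSpace E] :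
    C(Set.Icc (0 : ℝ) 1, E) →L[ℂ] C(Set.Icc (0 : ℝ) 1, E) :=
  LinearMap.mkContinuous
    { toFun := fun u => ⟨fun s => prim u s, (continuous_iff_continuousAt.2 fun s =>
        (hasDerivAt_prim u s).continuousAt).comp continuous_subtype_val⟩
      map_add' := fun u v => by
        ext s
        exact intervalIntegral.integral_add
          (by apply Continuous.intervalIntegrable; fun_prop)
          (by apply Continuous.intervalIntegrable; fun_prop)
      map_smul' := fun c u => by
        ext s
        exact intervalIntegral.integral_smul c _ } 1 fun u => by
    rw [one_mul]
    refine (ContinuousMap.norm_le _ (norm_nonneg _)).2 fun s => ?_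
    change ‖prim u s‖ ≤ _
    refine (intervalIntegral.norm_integral_le_of_norm_le_const fun t _ =>
      u.norm_coe_le_norm _).trans ?_
    rw [sub_zero, abs_of_nonneg s.2.1]
    exact mul_le_of_le_one_right (norm_nonneg _) s.2.2

theorem prim_const (v : E) (s : ℝ) : prim (constL _ E v) s = s • v := by
  simp [prim]
end Primitive
end NN

namespace NN
open scoped BigOperators Topology ContDiff
open Filter
open Wiener
set_option linter.unusedSectionVars false

section Frobenius
variable {E : Type*} [NormedAddCommGroup E] [NormedSpace ℂ E]

/-- The projection onto the `i`-eigenspace of a complex structure. -/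
noncomputable def mns (A : E →L[ℂ] E) : E →L[ℂ] E :=
  (2 : ℂ)⁻¹ • (ContinuousLinearMap.id ℂ E - Complex.I • A)

/-- The projection onto the `-i`-eigenspace of a complex structure. -/
noncomputable def pls (A : E →L[ℂ] E) : E →L[ℂ] E :=
  (2 : ℂ)⁻¹ • (ContinuousLinearMap.id ℂ E + Complex.I • A)

theorem mns_apply (A : E →L[ℂ] E) (v : E) : mns A v = (2 : ℂ)⁻¹ • (v - Complex.I • A v) := rfl

theorem pls_apply (A : E →L[ℂ] E) (v : E) : pls A v = (2 : ℂ)⁻¹ • (v + Complex.I • A v) := rfl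

theorem I_smul_I_smul (v : E) : Complex.I • Complex.I • v = -v := by
  rw [smul_smul, Complex.I_mul_I, neg_one_smul]

theorem pls_add_mns (A : E →L[ℂ] E) (v : E) : pls A v + mns A v = v := by
  rw [pls_apply, mns_apply]; module

theorem apply_mns {A : E →L[ℂ] E} (hA : ∀ v, A (A v) = -v) (v : E) :
    A (mns A v) = Complex.I • mns A v := by
  have e : Complex.I • (2 : ℂ)⁻¹ • (v - Complex.I • A v) =
    (2 : ℂ)⁻¹ • (Complex.I • v - Complex.I • Complex.I • A v) := by module
  rw [mns_apply, e, I_smul_I_smul, map_smul, map_sub, map_smul, hA]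
  module

theorem pls_eq_zero_iff {A : E →L[ℂ] E} {v : E} : pls A v = 0 ↔ A v = Complex.I • v := by
  rw [pls_apply, smul_eq_zero, or_iff_right (by norm_num : (2 : ℂ)⁻¹ ≠ 0)]
  constructor
  · intro h
    have h1 : Complex.I • v + Complex.I • Complex.I • A v = 0 := by
      rw [← smul_add, h, smul_zero]
    rw [I_smul_I_smul, add_neg_eq_zero] at h1
    exact h1.symm
  · intro h
    rw [h, I_smul_I_smul, add_neg_cancel]

theorem pls_pls {A : E →L[ℂ] E} (hA : ∀ v, A (A v) = -v) (v : E) : pls A (pls A v) = pls A v := by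
  have h : pls A (mns A v) = 0 := pls_eq_zero_iff.2 (apply_mns hA v)
  have h2 := congrArg (pls A) (pls_add_mns A v)
  rwa [map_add, h, add_zero] at h2

theorem mns_mns {A : E →L[ℂ] E} (hA : ∀ v, A (A v) = -v) (v : E) : mns A (mns A v) = mns A v := by
  have h : pls A (mns A v) = 0 := pls_eq_zero_iff.2 (apply_mns hA v)
  have h2 := pls_add_mns A (mns A v)
  rwa [h, zero_add] at h2

theorem frobenius_algebra {t : E →L[ℂ] E} {D : E →L[ℂ] E →L[ℂ] E} (ht : ∀ v, t (t v) = -v)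
    (hD : ∀ b v, D b (t v) = -t (D b v))
    (hω : ∀ a b, D a b - D b a = D (t a) (t b) - D (t b) (t a)) {ζ η δ a δ' : E}
    (ha : a = mns t ζ) (hδ : δ' = (2 : ℂ)⁻¹ • (η - Complex.I • (D δ ζ + t η))) :
    δ' + Complex.I • (D a δ + t δ') = ((2 : ℂ)⁻¹ * Complex.I) •
      (D a (δ + Complex.I • t δ) - D (δ + Complex.I • t δ) a) := by
  have h1 : t a = Complex.I • a := by rw [ha]; exact apply_mns ht ζ
  have h2 : D a δ - D δ a = Complex.I • (D a (t δ) - D (t δ) a) := by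
    rw [hω a δ, h1]
    simp only [map_smul, _root_.smul_apply, smul_sub]
  have h3 : D a (δ + Complex.I • t δ) - D (δ + Complex.I • t δ) a = (2 : ℂ) • (D a δ - D δ a) := by
    have : D a (δ + Complex.I • t δ) - D (δ + Complex.I • t δ) a =
        (D a δ - D δ a) + Complex.I • (D a (t δ) - D (t δ) a) := by
      simp only [map_add, map_smul, _root_.add_apply, _root_.smul_apply, smul_sub]
      abel
    rw [this, ← h2, two_smul]
  have h4 : D δ a = (2 : ℂ)⁻¹ • (D δ ζ + Complex.I • t (D δ ζ)) := by
    rw [ha, mns_apply]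
    simp only [map_smul, map_sub, hD]
    module
  have h5 : t δ' = (2 : ℂ)⁻¹ • (t η - Complex.I • t (D δ ζ) + Complex.I • η) := by
    rw [hδ]
    simp only [map_smul, map_sub, map_add, ht]
    module
  have h6 : δ' + Complex.I • t δ' = -(Complex.I • D δ a) := by
    rw [h5, h4, hδ]
    have e1 := I_smul_I_smul (t (D δ ζ))
    have e2 := I_smul_I_smul η
    have e3 : Complex.I • (2 : ℂ)⁻¹ • (t η - Complex.I • t (D δ ζ) + Complex.I • η) =
      (2 : ℂ)⁻¹ • (Complex.I • t η - Complex.I • Complex.I • t (D δ ζ)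
        + Complex.I • Complex.I • η) := by module
    have e4 : Complex.I • (2 : ℂ)⁻¹ • (D δ ζ + Complex.I • t (D δ ζ)) =
      (2 : ℂ)⁻¹ • (Complex.I • D δ ζ + Complex.I • Complex.I • t (D δ ζ)) := by module
    rw [e3, e4, e1, e2]
    module
  rw [h3, smul_smul, smul_add, add_left_comm, h6, mul_right_comm, inv_mul_cancel₀ two_ne_zero,
    one_mul, smul_sub]
  abel

end Frobenius
end NN

namespace NN
open scoped BigOperators Topology ContDiff
open Filter
open Wiener
set_option linter.unusedSectionVars false

section Leaves
variable {E : Type*} [NormedAddCommGroup E] [NormedSpace ℂ E]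

/-- Pairing a curve with a constant, as a continuous linear map. -/
noncomputable def pairL (K E : Type*) [TopologicalSpace K] [CompactSpace K]
    [NormedAddCommGroup E] [NormedSpace ℂ E] : E × C(K, E) →L[ℂ] C(K, E × E) :=
  LinearMap.mkContinuous
    { toFun := fun q => ⟨fun k => (q.2 k, q.1), by fun_prop⟩
      map_add' := fun _ _ => rfl
      map_smul' := fun _ _ => rfl } 1 fun q => by
    rw [one_mul]
    refine (ContinuousMap.norm_le _ (norm_nonneg _)).2 fun k => ?_
    exact max_le ((q.2.norm_coe_le_norm k).trans (norm_snd_le q)) (norm_fst_le q)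

@[simp] theorem pairL_apply {K : Type*} [TopologicalSpace K] [CompactSpace K]
    (q : E × C(K, E)) (k : K) : pairL K E q k = (q.2 k, q.1) := rfl

theorem eventually_forall_pairL {φ : E → C(Set.Icc (0 : ℝ) 1, E)} (hφ : ContinuousAt φ 0)
    (h0 : φ 0 = 0) {Q : E × E → Prop} (hQ : ∀ᶠ q in 𝓝 0, Q q) :
    ∀ᶠ p in 𝓝 0, ∀ k, Q (φ p k, p) := by
  obtain ⟨r, hr, hrQ⟩ := Metric.eventually_nhds_iff_ball.1 hQ
  have h1 : ContinuousAt (fun p => ‖φ p‖) 0 := hφ.norm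
  have h2 : ∀ᶠ p in 𝓝 (0 : E), ‖φ p‖ < r := by
    refine Tendsto.eventually_lt_const ?_ h1
    change ‖φ 0‖ < r
    rwa [h0, norm_zero]
  filter_upwards [h2, Metric.ball_mem_nhds 0 hr] with p hp hp2 k
  refine hrQ _ ?_
  rw [mem_ball_zero_iff] at hp2 ⊢
  exact max_lt (((φ p).norm_coe_le_norm k).trans_lt hp) hp2

variable [CompleteSpace E]

/-- The integral equation of a family of curves. -/
noncomputable def leafMap (P : E →L[ℂ] E) (g : C(E × E, E)) (q : E × C(Set.Icc (0 : ℝ) 1, E)) :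
    C(Set.Icc (0 : ℝ) 1, E) :=
  constL _ E (P q.1) + primL E (g.comp (pairL _ E q))

theorem hasFDerivAt_leafMap (P : E →L[ℂ] E) {f : E × E → E} {r : ℝ} {g : C(E × E, E)}
    {D : C(E × E, E × E →L[ℂ] E)} (h : Germ f r g D) {q : E × C(Set.Icc (0 : ℝ) 1, E)}
    (hq : ‖pairL _ E q‖ < r) :
    HasFDerivAt (leafMap P g) ((constL _ E).comp (P.comp (ContinuousLinearMap.fst ℂ _ _)) +
      (primL E).comp ((applyL _ _ _ (D.comp (pairL _ E q))).comp (pairL _ E))) q := by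
  have h1 : HasFDerivAt (fun q => g.comp (pairL (Set.Icc (0 : ℝ) 1) E q))
      ((applyL _ _ _ (D.comp (pairL _ E q))).comp (pairL _ E)) q :=
    (h.hasFDerivAt_comp hq).comp q (pairL (Set.Icc (0 : ℝ) 1) E).hasFDerivAt
  exact ((constL _ E).comp (P.comp (ContinuousLinearMap.fst ℂ _ _))).hasFDerivAt.add
    ((primL E).hasFDerivAt.comp q h1)

theorem contDiffAt_leafMap (P : E →L[ℂ] E) {f : E × E → E} {r : ℝ} {g : C(E × E, E)}
    {D : C(E × E, E × E →L[ℂ] E)} (h : Germ f r g D) : ContDiffAt ℂ 1 (leafMap P g) 0 := by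
  have h1 : ContDiffAt ℂ 1 (fun q => g.comp (pairL (Set.Icc (0 : ℝ) 1) E q)) 0 :=
    (h.contDiffAt_comp (by simpa using h.pos)).comp (0 : E × C(Set.Icc (0 : ℝ) 1, E))
      (pairL (Set.Icc (0 : ℝ) 1) E).contDiff.contDiffAt
  exact ((constL _ E).comp (P.comp (ContinuousLinearMap.fst ℂ _ _))).contDiff.contDiffAt.add
    ((primL E).contDiff.contDiffAt.comp (0 : E × C(Set.Icc (0 : ℝ) 1, E)) h1)

/-- Solutions of the initial value problem `x' = f (x, p)`, `x 0 = P p` depending differentiably on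
the parameter `p`. -/
theorem exists_leaves (P : E →L[ℂ] E) {f : E × E → E} (hf : ContDiffAt ℂ 1 f 0)
    (hf0 : ∀ᶠ x in 𝓝 0, f (x, 0) = 0) :
    ∃ φ : E → C(Set.Icc (0 : ℝ) 1, E), ContDiffAt ℂ 1 φ 0 ∧ φ 0 = 0 ∧
      ∀ᶠ p in 𝓝 0, ∃ u : C(Set.Icc (0 : ℝ) 1, E), (∀ k, u k = f (φ p k, p)) ∧
        (∀ s, φ p s = P p + prim u s) ∧
        ∃ φ' : E →L[ℂ] C(Set.Icc (0 : ℝ) 1, E), HasFDerivAt φ φ' p ∧ ∀ v,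
          ∃ u' : C(Set.Icc (0 : ℝ) 1, E), (∀ k, u' k = fderiv ℂ f (φ p k, p) (φ' v k, v)) ∧
            ∀ s, φ' v s = P v + prim u' s := by
  obtain ⟨r, g, D, h⟩ := exists_germ hf
  have hr0 : ∀ᶠ q : E × E in 𝓝 0, ‖q‖ < r := by
    filter_upwards [Metric.ball_mem_nhds (0 : E × E) h.pos] with q hq
    rwa [mem_ball_zero_iff] at hq
  have hlm : ∀ᶠ y : C(Set.Icc (0 : ℝ) 1, E) in 𝓝 0, leafMap P g (0, y) = 0 := by
    have h1 : ∀ᶠ x : E in 𝓝 0, g (x, 0) = 0 := by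
      have h2 : Tendsto (fun x : E => (x, (0 : E))) (𝓝 0) (𝓝 0) :=
        (Continuous.prodMk_left (0 : E)).tendsto' _ _ rfl
      filter_upwards [hf0, h2.eventually hr0] with x hx hx2
      rw [h.eq _ hx2, hx]
    obtain ⟨ρ, hρ, h3⟩ := Metric.eventually_nhds_iff_ball.1 h1
    filter_upwards [Metric.ball_mem_nhds 0 hρ] with y hy
    have : g.comp (pairL _ E (0, y)) = 0 := by
      ext k
      refine h3 _ ?_
      rw [mem_ball_zero_iff] at hy ⊢
      exact (y.norm_coe_le_norm k).trans_lt hy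
    rw [leafMap, this]
    simp
  have hc := contDiffAt_leafMap P h
  have h0 : leafMap P g 0 = 0 := hlm.self_of_nhds
  obtain ⟨φ, hφ, hφ0, hfix, -⟩ := exists_fixedPoint (leafMap P g) hc h0 fun y => by
    have h1 : HasFDerivAt (fun y => leafMap P g (0, y))
        ((fderiv ℂ (leafMap P g) 0).comp (ContinuousLinearMap.inr ℂ _ _)) 0 :=
      HasFDerivAt.comp (g := leafMap P g) (f := fun y => ((0 : E), y)) 0
        (hc.differentiableAt one_ne_zero).hasFDerivAt (ContinuousLinearMap.inr ℂ E (C(Set.Icc (0 : ℝ) 1, E))).hasFDerivAt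
    have h2 := h1.unique ((hasFDerivAt_const 0 _).congr_of_eventuallyEq hlm)
    exact congrArg (fun L => L y) h2
  refine ⟨φ, hφ, hφ0, ?_⟩
  have hdiff : ∀ᶠ p in 𝓝 0, ContDiffAt ℂ 1 φ p := hφ.eventually (by simp)
  filter_upwards [eventually_forall_pairL hφ.continuousAt hφ0 hr0, hfix.eventually_nhds, hdiff]
    with p hp hfp hdp
  have hnorm : ‖pairL _ E (p, φ p)‖ < r :=
    (ContinuousMap.norm_lt_iff _ h.pos).2 hp
  have hder := (hdp.differentiableAt one_ne_zero).hasFDerivAt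
  refine ⟨g.comp (pairL _ E (p, φ p)), fun k => h.eq _ (hp k), fun s => ?_, fderiv ℂ φ p, hder,
    fun v => ⟨applyL _ _ _ (D.comp (pairL _ E (p, φ p))) (pairL _ E (v, fderiv ℂ φ p v)),
      fun k => ?_, fun s => ?_⟩⟩
  · have h2 := congrArg (fun y => y s) hfp.self_of_nhds
    exact h2.symm
  · change D (φ p k, p) _ = _
    rw [(h.deriv _ (hp k)).fderiv]
    rfl
  · have h2 := HasFDerivAt.comp (g := leafMap P g) (f := fun p => (p, φ p)) p
      (hasFDerivAt_leafMap P h hnorm) ((hasFDerivAt_id p).prodMk hder)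
    have h3 := h2.unique (hder.congr_of_eventuallyEq hfp)
    have h4 := congrArg (fun L : E →L[ℂ] C(Set.Icc (0 : ℝ) 1, E) => L v s) h3
    exact h4.symm
end Leaves
end NN

namespace NN
open scoped BigOperators Topology ContDiff
open Filter
open Wiener
set_option linter.unusedSectionVars false

section Frobenius
variable {E : Type*} [NormedAddCommGroup E] [NormedSpace ℂ E]

/-- The operator-valued form of a complex structure that squares to minus the identity and whose
antiholomorphic distribution is involutive. -/
structure IsInvolutive (T : E → E →L[ℂ] E) (z : E) : Prop where
  differentiable : DifferentiableAt ℂ T z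
  sq : ∀ v, T z (T z v) = -v
  anticomm : ∀ b v, fderiv ℂ T z b (T z v) = -T z (fderiv ℂ T z b v)
  curl : ∀ a b, fderiv ℂ T z a b - fderiv ℂ T z b a =
    fderiv ℂ T z (T z a) (T z b) - fderiv ℂ T z (T z b) (T z a)

theorem eventually_isInvolutive {T : E → E →L[ℂ] E} (hT : ContDiffAt ℂ 1 T 0)
    (hsq : ∀ᶠ z in 𝓝 0, ∀ v, T z (T z v) = -v)
    (hω : ∀ᶠ z in 𝓝 0, ∀ a b, fderiv ℂ T z a b - fderiv ℂ T z b a =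
      fderiv ℂ T z (T z a) (T z b) - fderiv ℂ T z (T z b) (T z a)) :
    ∀ᶠ z in 𝓝 0, IsInvolutive T z := by
  filter_upwards [hsq.eventually_nhds, hω, hT.eventually (by simp)] with z h1 h2 h3
  have hd := h3.differentiableAt one_ne_zero
  refine ⟨hd, h1.self_of_nhds, fun b v => ?_, h2⟩
  have h4 : HasFDerivAt (fun z => T z (T z v)) _ z :=
    hd.hasFDerivAt.clm_apply (hd.hasFDerivAt.clm_apply (hasFDerivAt_const v z))
  have h5 : HasFDerivAt (fun z => T z (T z v)) (0 : E →L[ℂ] E) z :=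
    (hasFDerivAt_const (-v) z).congr_of_eventuallyEq (h1.mono fun z hz => hz v)
  have h6 := congrArg (fun L : E →L[ℂ] E => L b) (h4.unique h5)
  simp at h6
  exact eq_neg_of_add_eq_zero_right h6

/-- The velocity of the leafwise curves with parameter. -/
noncomputable def leafField (T : E → E →L[ℂ] E) (q : E × E) : E := mns (T q.1) (mns (T 0) q.2)

theorem contDiffAt_leafField {T : E → E →L[ℂ] E} (hT : ContDiffAt ℂ 1 T 0) :
    ContDiffAt ℂ 1 (leafField T) 0 := by
  have h1 : ContDiffAt ℂ 1 (fun q : E × E => T q.1) 0 :=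
    ContDiffAt.comp (g := T) (0 : E × E) hT contDiffAt_fst
  have h2 : ContDiffAt ℂ 1 (fun q : E × E => mns (T 0) q.2) 0 :=
    (mns (T 0)).contDiff.contDiffAt.comp (0 : E × E) contDiffAt_snd
  exact (h2.sub ((h1.clm_apply h2).const_smul Complex.I)).const_smul _

theorem fderiv_leafField {T : E → E →L[ℂ] E} {x p : E} (hT : DifferentiableAt ℂ T x) (δ v : E) :
    fderiv ℂ (leafField T) (x, p) (δ, v) = (2 : ℂ)⁻¹ • (mns (T 0) v - Complex.I •
      (fderiv ℂ T x δ (mns (T 0) p) + T x (mns (T 0) v))) := by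
  have h1 : HasFDerivAt (fun q : E × E => T q.1)
      ((fderiv ℂ T x).comp (ContinuousLinearMap.fst ℂ E E)) (x, p) :=
    HasFDerivAt.comp (g := T) (f := Prod.fst) (x, p) hT.hasFDerivAt hasFDerivAt_fst
  have h2 : HasFDerivAt (fun q : E × E => mns (T 0) q.2)
      ((mns (T 0)).comp (ContinuousLinearMap.snd ℂ E E)) (x, p) :=
    HasFDerivAt.comp (g := mns (T 0)) (f := Prod.snd) (x, p) (mns (T 0)).hasFDerivAt hasFDerivAt_snd
  have h3 : HasFDerivAt (leafField T) _ (x, p) :=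
    (h2.fun_sub ((h1.clm_apply h2).fun_const_smul Complex.I)).fun_const_smul ((2 : ℂ)⁻¹)
  rw [h3.fderiv]
  simp [add_comm]

variable [CompleteSpace E]

theorem apply_leaf_eq {T : E → E →L[ℂ] E} {C : ℝ} {x δ : ℝ → E} {u u' : ℝ → E} {p v : E}
    (hT : ∀ s ∈ Set.Icc (0 : ℝ) 1, IsInvolutive T (x s)) (hC : ∀ s ∈ Set.Icc (0 : ℝ) 1,
      ‖fderiv ℂ T (x s)‖ ≤ C) {M : ℝ} (hM : ∀ s ∈ Set.Icc (0 : ℝ) 1, ‖u s‖ ≤ M)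
    (hx : ∀ s, HasDerivAt x (u s) s) (hδ : ∀ s, HasDerivAt δ (u' s) s)
    (hu : ∀ s ∈ Set.Icc (0 : ℝ) 1, u s = leafField T (x s, p))
    (hu' : ∀ s ∈ Set.Icc (0 : ℝ) 1, u' s = fderiv ℂ (leafField T) (x s, p) (δ s, v))
    (h0 : δ 0 = 0) : ∀ s ∈ Set.Icc (0 : ℝ) 1, T (x s) (δ s) = Complex.I • δ s := by
  set Y : ℝ → E := fun s => δ s + Complex.I • T (x s) (δ s) with hY
  have hYd : ∀ s ∈ Set.Icc (0 : ℝ) 1, HasDerivAt Y (((2 : ℂ)⁻¹ * Complex.I) •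
      (fderiv ℂ T (x s) (u s) (Y s) - fderiv ℂ T (x s) (Y s) (u s))) s := by
    intro s hs
    have h1 : HasDerivAt (fun s => T (x s)) (fderiv ℂ T (x s) (u s)) s :=
      HasFDerivAt.comp_hasDerivAt (l := T) (f := x) s
        ((hT s hs).differentiable.hasFDerivAt.restrictScalars ℝ) (hx s)
    have h2 : HasDerivAt (fun s => T (x s) (δ s)) (fderiv ℂ T (x s) (u s) (δ s) + T (x s) (u' s)) s := by
      have e1 : HasDerivAt (fun s => (T (x s)).restrictScalars ℝ)
          ((fderiv ℂ T (x s) (u s)).restrictScalars ℝ) s :=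
        HasFDerivAt.comp_hasDerivAt (l := ContinuousLinearMap.restrictScalarsL ℂ E E ℝ ℝ)
          (f := fun s => T (x s)) s
          (ContinuousLinearMap.restrictScalarsL ℂ E E ℝ ℝ).hasFDerivAt h1
      exact e1.clm_apply (hδ s)
    have h3 : HasDerivAt Y (u' s + Complex.I • (fderiv ℂ T (x s) (u s) (δ s) + T (x s) (u' s))) s :=
      (hδ s).fun_add (h2.fun_const_smul Complex.I)
    have h4 := frobenius_algebra (hT s hs).sq (hT s hs).anticomm (hT s hs).curl (hu s hs)
      ((hu' s hs).trans (fderiv_leafField (hT s hs).differentiable (δ s) v))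
    rwa [h4] at h3
  have hb : ∀ s ∈ Set.Ico (0 : ℝ) 1, ‖((2 : ℂ)⁻¹ * Complex.I) •
      (fderiv ℂ T (x s) (u s) (Y s) - fderiv ℂ T (x s) (Y s) (u s))‖ ≤ (C * M) * ‖Y s‖ := by
    intro s hs
    have hs' := Set.Ico_subset_Icc_self hs
    have e1 : ‖fderiv ℂ T (x s) (u s) (Y s)‖ ≤ C * M * ‖Y s‖ := by
      refine ((fderiv ℂ T (x s)).le_opNorm₂ _ _).trans ?_
      have := (norm_nonneg (fderiv ℂ T (x s))).trans (hC s hs')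
      exact mul_le_mul_of_nonneg_right (mul_le_mul (hC s hs') (hM s hs') (norm_nonneg _) this)
        (norm_nonneg _)
    have e2 : ‖fderiv ℂ T (x s) (Y s) (u s)‖ ≤ C * M * ‖Y s‖ := by
      refine ((fderiv ℂ T (x s)).le_opNorm₂ _ _).trans ?_
      have := (norm_nonneg (fderiv ℂ T (x s))).trans (hC s hs')
      rw [mul_right_comm]
      exact mul_le_mul_of_nonneg_right (mul_le_mul (hC s hs') (hM s hs') (norm_nonneg _) this)
        (norm_nonneg _)
    rw [norm_smul, norm_mul, Complex.norm_I, mul_one, norm_inv, Complex.norm_ofNat]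
    linarith [norm_sub_le (fderiv ℂ T (x s) (u s) (Y s)) (fderiv ℂ T (x s) (Y s) (u s))]
  intro s hs
  have h5 := eq_zero_of_abs_deriv_le_mul_abs_self_of_eq_zero_right (f := Y)
    (fun s hs => (hYd s hs).continuousAt.continuousWithinAt)
    (fun s hs => (hYd s (Set.Ico_subset_Icc_self hs)).hasDerivWithinAt) (by simp [hY, h0]) hb s hs
  have h6 : Complex.I • Y s = 0 := by rw [h5, smul_zero]
  rw [hY] at h6
  change Complex.I • (δ s + Complex.I • T (x s) (δ s)) = 0 at h6
  rw [smul_add, I_smul_I_smul, add_neg_eq_zero] at h6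
  exact h6.symm

theorem exists_leaf_chart {T : E → E →L[ℂ] E} (hT : ContDiffAt ℂ 1 T 0)
    (hinv : ∀ᶠ z in 𝓝 0, IsInvolutive T z) :
    ∃ G : E → E, ContDiffAt ℂ 1 G 0 ∧ G 0 = 0 ∧ HasFDerivAt G (ContinuousLinearMap.id ℂ E) 0 ∧
      ∀ᶠ p in 𝓝 0, ∀ v, pls (T 0) v = 0 →
        T (G p) (fderiv ℂ G p v) = Complex.I • fderiv ℂ G p v := by
  obtain ⟨φ, hφ, hφ0, h⟩ := exists_leaves (pls (T 0)) (contDiffAt_leafField hT)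
    (Eventually.of_forall fun x => by simp [leafField])
  have hsq := hinv.self_of_nhds.sq
  set e : C(Set.Icc (0 : ℝ) 1, E) →L[ℂ] E := ContinuousMap.evalCLM ℂ (1 : Set.Icc (0 : ℝ) 1)
  refine ⟨fun p => e (φ p), e.contDiff.contDiffAt.comp 0 hφ, by simp [hφ0], ?_, ?_⟩
  · obtain ⟨-, -, -, φ', hφ', h1⟩ := h.self_of_nhds
    refine (e.hasFDerivAt.comp 0 hφ').congr_fderiv ?_
    ext v
    obtain ⟨u', hu', h2⟩ := h1 v
    have h3 : u' = constL _ E (mns (T 0) v) := by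
      ext k
      rw [hu', hφ0]
      refine (fderiv_leafField hinv.self_of_nhds.differentiable _ _).trans ?_
      rw [map_zero, map_zero, zero_add]
      exact mns_mns hsq v
    have h4 := h2 1
    rw [h3, prim_const] at h4
    refine h4.trans ?_
    simp [pls_add_mns]
  · have hC : ∀ᶠ z in 𝓝 0, ‖fderiv ℂ T z‖ < ‖fderiv ℂ T 0‖ + 1 :=
      ((hT.continuousAt_fderiv one_ne_zero).norm).eventually_lt_const (lt_add_one _)
    have h2 : Tendsto (fun q : E × E => q.1) (𝓝 0) (𝓝 0) := continuous_fst.tendsto' _ _ rfl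
    filter_upwards [h, eventually_forall_pairL hφ.continuousAt hφ0 (h2.eventually hC),
      eventually_forall_pairL hφ.continuousAt hφ0 (h2.eventually hinv)] with p hp hC hinv v hv
    obtain ⟨u, hu, hφu, φ', hφ', h1⟩ := hp
    obtain ⟨u', hu', h2⟩ := h1 v
    have hd : HasFDerivAt (fun p => e (φ p)) (e.comp φ') p := e.hasFDerivAt.comp p hφ'
    rw [hd.fderiv]
    have hproj : ∀ s (hs : s ∈ Set.Icc (0 : ℝ) 1), Set.projIcc 0 1 zero_le_one s = ⟨s, hs⟩ :=
      fun s hs => Set.projIcc_of_mem _ hs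
    have h3 := apply_leaf_eq (T := T) (C := ‖fderiv ℂ T 0‖ + 1) (x := fun s => pls (T 0) p + prim u s)
      (δ := fun s => pls (T 0) v + prim u' s) (p := p) (v := v)
      (u := fun s => u (Set.projIcc 0 1 zero_le_one s))
      (u' := fun s => u' (Set.projIcc 0 1 zero_le_one s))
      (fun s hs => (hφu ⟨s, hs⟩) ▸ hinv ⟨s, hs⟩)
      (fun s hs => (hφu ⟨s, hs⟩) ▸ (hC ⟨s, hs⟩).le) (M := ‖u‖)
      (fun s _ => u.norm_coe_le_norm _)
      (fun s => (hasDerivAt_prim u s).const_add _) (fun s => (hasDerivAt_prim u' s).const_add _)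
      (fun s hs => by
        rw [hproj s hs, hu ⟨s, hs⟩, hφu ⟨s, hs⟩])
      (fun s hs => by
        rw [hproj s hs, hu' ⟨s, hs⟩, hφu ⟨s, hs⟩, h2 ⟨s, hs⟩]) (by simp [hv]) 1
      (Set.right_mem_Icc.2 zero_le_one)
    have e1 := hφu 1
    have e2 := h2 1
    change T (φ p 1) (φ' v 1) = Complex.I • φ' v 1
    rw [e1, e2]
    exact h3
end Frobenius
end NN

namespace NN
open scoped BigOperators Topology ContDiff
open Filter
open Wiener
set_option linter.unusedSectionVars false

section Frobenius
variable {E : Type*} [NormedAddCommGroup E] [NormedSpace ℂ E] [CompleteSpace E]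

/-- Holomorphic Frobenius theorem: the eigenspaces of an involutive holomorphic complex structure
are straightened by a holomorphic change of coordinates. -/
theorem exists_frobenius_chart {T : E → E →L[ℂ] E} (hT : ContDiffAt ℂ 1 T 0)
    (hsq : ∀ᶠ z in 𝓝 0, ∀ v, T z (T z v) = -v)
    (hω : ∀ᶠ z in 𝓝 0, ∀ a b, fderiv ℂ T z a b - fderiv ℂ T z b a =
      fderiv ℂ T z (T z a) (T z b) - fderiv ℂ T z (T z b) (T z a)) :
    ∃ u : E → E, ContDiffAt ℂ 1 u 0 ∧ HasFDerivAt u (ContinuousLinearMap.id ℂ E) 0 ∧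
      ∀ᶠ z in 𝓝 0, ∀ v, T z v = Complex.I • v →
        T 0 (fderiv ℂ u z v) = Complex.I • fderiv ℂ u z v := by
  obtain ⟨G, hG, hG0, hGd, hGT⟩ := exists_leaf_chart hT (eventually_isInvolutive hT hsq hω)
  obtain ⟨u, hu, hu0, huG, hGu⟩ := exists_local_inverse (f' := ContinuousLinearEquiv.refl ℂ E)
    hG hGd one_ne_zero
  rw [hG0] at hu hu0 hGu
  have hut : Tendsto u (𝓝 0) (𝓝 0) := by
    have := hu.continuousAt.tendsto
    rwa [hu0] at this
  have hGud : ∀ᶠ z in 𝓝 0, ∀ v, fderiv ℂ G (u z) (fderiv ℂ u z v) = v := by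
    filter_upwards [hGu.eventually_nhds, hu.eventually (by simp), hut.eventually
      (hG.eventually (by simp))] with z h1 h2 h3 v
    have h4 : HasFDerivAt (fun z => G (u z)) ((fderiv ℂ G (u z)).comp (fderiv ℂ u z)) z :=
      HasFDerivAt.comp (g := G) (f := u) z (h3.differentiableAt one_ne_zero).hasFDerivAt
        (h2.differentiableAt one_ne_zero).hasFDerivAt
    have h5 := h4.unique ((hasFDerivAt_id z).congr_of_eventuallyEq h1)
    exact congrArg (fun L : E →L[ℂ] E => L v) h5
  have hud : HasFDerivAt u (ContinuousLinearMap.id ℂ E) 0 := by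
    have h6 := (hu.differentiableAt one_ne_zero).hasFDerivAt
    refine h6.congr_fderiv ?_
    ext v
    have h7 := hGud.self_of_nhds v
    rw [hu0, hGd.fderiv] at h7
    exact h7
  refine ⟨u, hu, hud, ?_⟩
  have hsmall : ∀ᶠ z in 𝓝 0, ‖pls (T 0) - (pls (T z)).comp (fderiv ℂ G (u z))‖ < 1 := by
    have c1 : ContinuousAt (fun z => fderiv ℂ G (u z)) 0 :=
      ContinuousAt.comp (g := fderiv ℂ G) (f := u)
        (by rw [hu0]; exact hG.continuousAt_fderiv one_ne_zero) hu.continuousAt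
    have c2 : ContinuousAt (fun z => pls (T z)) 0 :=
      (continuousAt_const.add (hT.continuousAt.const_smul Complex.I)).const_smul ((2 : ℂ)⁻¹)
    have c3 : ContinuousAt (fun z => ‖pls (T 0) - (pls (T z)).comp (fderiv ℂ G (u z))‖) 0 :=
      (continuousAt_const.sub (c2.clm_comp c1)).norm
    have c4 : ‖pls (T 0) - (pls (T 0)).comp (fderiv ℂ G (u 0))‖ = 0 := by
      rw [hu0, hGd.fderiv, ContinuousLinearMap.comp_id, sub_self, norm_zero]
    refine Tendsto.eventually_lt_const (v := ‖pls (T 0) - (pls (T 0)).comp (fderiv ℂ G (u 0))‖)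
      (by rw [c4]; exact one_pos) c3
  filter_upwards [hGud, hsmall, hut.eventually hGT, hGu] with z h1 h2 h3 h4 v hv
  set w := fderiv ℂ u z v with hw
  have hA := hsq.self_of_nhds
  rw [← pls_eq_zero_iff]
  set q := pls (T 0) w with hq
  have h5 : pls (T z) (fderiv ℂ G (u z) (mns (T 0) w)) = 0 := by
    have h6 := h3 (mns (T 0) w) (pls_eq_zero_iff.2 (apply_mns hA w))
    rw [h4] at h6
    exact pls_eq_zero_iff.2 h6
  have h7 : pls (T z) (fderiv ℂ G (u z) q) = 0 := by
    have h8 := congrArg (fun x => pls (T z) (fderiv ℂ G (u z) x)) (pls_add_mns (T 0) w)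
    simp only [map_add] at h8
    rw [h5, add_zero, hw, h1 v, pls_eq_zero_iff.2 hv] at h8
    exact h8
  have h9 : (pls (T 0) - (pls (T z)).comp (fderiv ℂ G (u z))) q = q := by
    change pls (T 0) q - pls (T z) (fderiv ℂ G (u z) q) = q
    rw [h7, sub_zero, hq, pls_pls hA]
  by_contra hne
  have h10 := (pls (T 0) - (pls (T z)).comp (fderiv ℂ G (u z))).le_opNorm q
  rw [h9] at h10
  nlinarith [norm_pos_iff.2 hne]
end Frobenius
end NN

namespace NN
open scoped BigOperators Topology ContDiff
open Filter
open Wiener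
set_option linter.unusedSectionVars false

section Coordinates
variable {ι : Type*} [Fintype ι] [DecidableEq ι]

/-- The curl of a column of a matrix field on complex space. -/
noncomputable def curlC (F : (ι → ℂ) → Matrix ι ι ℂ) (K : ι) (z : ι → ℂ) : Matrix ι ι ℂ :=
  Matrix.of fun M N => fderiv ℂ (fun z => F z N K) z (Pi.single M 1) -
    fderiv ℂ (fun z => F z M K) z (Pi.single N 1)

/-- The inclusion of real space in complex space. -/
noncomputable def realL (ι : Type*) [Fintype ι] : (ι → ℝ) →L[ℝ] (ι → ℂ) :=
  ContinuousLinearMap.pi fun k => Complex.ofRealCLM.comp (ContinuousLinearMap.proj k)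

theorem realL_apply (y : ι → ℝ) : realL ι y = fun k => (y k : ℂ) := rfl

theorem realL_single (M : ι) : realL ι (Pi.single M 1) = Pi.single M 1 := by
  ext k
  change ((Pi.single M (1 : ℝ) : ι → ℝ) k : ℂ) = _
  rw [Pi.single_apply, Pi.single_apply]
  split_ifs <;> simp

theorem fderiv_real {f : (ι → ℂ) → ℂ} {g : (ι → ℝ) → ℝ} {y : ι → ℝ}
    (hf : DifferentiableAt ℂ f (realL ι y)) (hg : DifferentiableAt ℝ g y)
    (h : ∀ᶠ y in 𝓝 y, f (realL ι y) = g y) (M : ι) :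
    fderiv ℂ f (realL ι y) (Pi.single M 1) = (dx M g y : ℝ) := by
  have h1 : HasFDerivAt (fun y => f (realL ι y))
      (((fderiv ℂ f (realL ι y)).restrictScalars ℝ).comp (realL ι)) y :=
    HasFDerivAt.comp (g := f) (f := realL ι) y (hf.hasFDerivAt.restrictScalars ℝ)
      (realL ι).hasFDerivAt
  have h2 := (h1.congr_of_eventuallyEq (h.mono fun y hy => hy.symm)).fderiv
  rw [← KM.dx_ofReal hg, dx, h2]
  change _ = fderiv ℂ f (realL ι y) (realL ι (Pi.single M 1))
  rw [realL_single]

theorem curlC_real {F : (ι → ℂ) → Matrix ι ι ℂ} {J : (ι → ℝ) → Matrix ι ι ℝ} {y : ι → ℝ}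
    (hF : ∀ i j, DifferentiableAt ℂ (fun z => F z i j) (realL ι y))
    (hJ : ∀ i j, DifferentiableAt ℝ (fun y => J y i j) y)
    (h : ∀ᶠ y in 𝓝 y, F (realL ι y) = (J y).map ((↑) : ℝ → ℂ)) (K : ι) :
    curlC F K (realL ι y) = (curl J K y).map ((↑) : ℝ → ℂ) := by
  have h1 : ∀ i j, ∀ᶠ y in 𝓝 y, F (realL ι y) i j = (J y i j : ℝ) := fun i j =>
    h.mono fun y hy => congrFun (congrFun hy i) j
  ext M N
  simp only [curlC, curl, ext1, Matrix.of_apply, Matrix.map_apply, Complex.ofReal_sub]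
  rw [fderiv_real (hF _ _) (hJ N K) (h1 N K), fderiv_real (hF _ _) (hJ M K) (h1 M K)]

/-- The identity theorem for polynomial relations between a matrix field and its curl. -/
theorem eventually_integ {F : (ι → ℂ) → Matrix ι ι ℂ} {J : (ι → ℝ) → Matrix ι ι ℝ}
    (hF : ∀ i j, ContDiffAt ℂ 1 (fun z => F z i j) 0)
    (hJ : ∀ᶠ y in 𝓝 0, ∀ i j, DifferentiableAt ℝ (fun y => J y i j) y)
    (h : ∀ᶠ y : ι → ℝ in 𝓝 0, F (realL ι y) = (J y).map ((↑) : ℝ → ℂ))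
    (hsq : ∀ᶠ y in 𝓝 0, J y * J y = -1) (hinteg : ∀ᶠ y in 𝓝 0, Integ J y) :
    ∀ᶠ z in 𝓝 0, F z * F z = -1 ∧ ∀ K, curlC F K z = F z * curlC F K z * (F z).transpose := by
  have hre : Tendsto (realL ι) (𝓝 0) (𝓝 0) := (realL ι).continuous.tendsto' _ _ (map_zero _)
  have hcurl : ∀ K M N, ContDiffAt ℂ 1 (fun z => curlC F K z M N) 0 := fun K M N =>
    (contDiffAt_fderiv_apply (hF N K) _).sub (contDiffAt_fderiv_apply (hF M K) _)
  refine Eventually.and ?_ (eventually_all.2 fun K => ?_)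
  · have h1 : ∀ i j, ∀ᶠ z in 𝓝 0, (F z * F z + 1) i j = 0 := fun i j => by
      refine eventually_eq_zero_of_real (H := fun z => (F z * F z + 1) i j) ?_ ?_
      · simp only [Matrix.add_apply, Matrix.mul_apply]
        exact (ContDiffAt.sum fun k _ => (hF i k).mul (hF k j)).add contDiffAt_const
      · filter_upwards [h, hsq] with y h2 h3
        have e : (J y).map ((↑) : ℝ → ℂ) * (J y).map ((↑) : ℝ → ℂ) = (J y * J y).map ((↑) : ℝ → ℂ) :=
          (Matrix.map_mul (f := Complex.ofRealHom)).symm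
        rw [realL_apply] at h2
        simp only [h2]
        rw [e, h3]
        by_cases hij : i = j <;> simp [hij]
    filter_upwards [eventually_all.2 fun i => eventually_all.2 (h1 i)] with z hz
    exact eq_neg_of_add_eq_zero_left (Matrix.ext hz)
  · have h1 : ∀ i j, ∀ᶠ z in 𝓝 0, (curlC F K z - F z * curlC F K z * (F z).transpose) i j = 0 := by
      intro i j
      refine eventually_eq_zero_of_real
        (H := fun z => (curlC F K z - F z * curlC F K z * (F z).transpose) i j) ?_ ?_
      · simp only [Matrix.sub_apply, Matrix.mul_apply, Matrix.transpose_apply]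
        exact (hcurl K i j).sub (ContDiffAt.sum fun k _ =>
          (ContDiffAt.sum fun l _ => (hF i l).mul (hcurl K l k)).mul (hF j k))
      · filter_upwards [h.eventually_nhds, hinteg, hJ, hre.eventually (eventually_all.2 fun i =>
          eventually_all.2 fun j => (hF i j).eventually (by simp))] with y h2 h3 h4 h5
        have e : F (realL ι y) = (J y).map ((↑) : ℝ → ℂ) := h2.self_of_nhds
        have e2 := curlC_real (fun i j => (h5 i j).differentiableAt one_ne_zero) h4 h2 K
        have e3 : (J y).map ((↑) : ℝ → ℂ) * (curl J K y).map ((↑) : ℝ → ℂ) *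
            ((J y).map ((↑) : ℝ → ℂ)).transpose = (J y * curl J K y * (J y).transpose).map
              ((↑) : ℝ → ℂ) := by
          have m1 : ((J y * curl J K y) * (J y).transpose).map ((↑) : ℝ → ℂ) = (J y * curl J K y).map
            ((↑) : ℝ → ℂ) * _ := Matrix.map_mul (f := Complex.ofRealHom)
          have m2 : (J y * curl J K y).map ((↑) : ℝ → ℂ) = _ := Matrix.map_mul (f := Complex.ofRealHom)
          rw [m1, m2]
          rfl
        rw [← realL_apply, e2, e, e3, ← h3 K, sub_self]
        rfl
    filter_upwards [eventually_all.2 fun i => eventually_all.2 (h1 i)] with z hz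
    exact sub_eq_zero.1 (Matrix.ext hz)

/-- The row action of a matrix as a continuous linear map. -/
noncomputable def rowL (A : Matrix ι ι ℂ) : (ι → ℂ) →L[ℂ] (ι → ℂ) :=
  LinearMap.toContinuousLinearMap A.vecMulLinear

theorem rowL_apply (A : Matrix ι ι ℂ) (v : ι → ℂ) : rowL A v = Matrix.vecMul v A := rfl

theorem contDiffAt_rowL {F : (ι → ℂ) → Matrix ι ι ℂ} {z : ι → ℂ}
    (hF : ∀ i j, ContDiffAt ℂ 1 (fun z => F z i j) z) : ContDiffAt ℂ 1 (fun z => rowL (F z)) z := by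
  refine contDiffAt_clm (n := 1) fun v => contDiffAt_pi.2 fun K => ?_
  simp only [rowL_apply, Matrix.vecMul, dotProduct]
  exact ContDiffAt.sum fun M _ => contDiffAt_const.mul (hF M K)

theorem fderiv_rowL {F : (ι → ℂ) → Matrix ι ι ℂ} {z : ι → ℂ}
    (hF : ∀ i j, ContDiffAt ℂ 1 (fun z => F z i j) z) (a b : ι → ℂ) (K : ι) :
    fderiv ℂ (fun z => rowL (F z)) z a b K =
      ∑ M, ∑ N, b M * a N * fderiv ℂ (fun z => F z M K) z (Pi.single N 1) := by
  have h1 := ((contDiffAt_rowL hF).differentiableAt one_ne_zero).hasFDerivAt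
  have h2 : HasFDerivAt (fun z => rowL (F z) b K) _ z :=
    hasFDerivAt_pi'.1 (h1.clm_apply (hasFDerivAt_const b z)) K
  have h3 : HasFDerivAt (fun z => rowL (F z) b K) (∑ M, b M • fderiv ℂ (fun z => F z M K) z) z := by
    simp only [rowL_apply, Matrix.vecMul, dotProduct]
    exact HasFDerivAt.fun_sum fun M _ =>
      ((hF M K).differentiableAt one_ne_zero).hasFDerivAt.const_mul (b M)
  have h4 := congrArg (fun L : (ι → ℂ) →L[ℂ] ℂ => L a) (h2.unique h3)
  have h5 : fderiv ℂ (fun z => rowL (F z)) z a b K =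
      ∑ M, b M * fderiv ℂ (fun z => F z M K) z a := by
    simpa using h4
  rw [h5]
  refine Finset.sum_congr rfl fun M _ => ?_
  conv_lhs => rw [pi_eq_sum_univ' a, map_sum]
  rw [Finset.mul_sum]
  refine Finset.sum_congr rfl fun N _ => ?_
  rw [map_smul, smul_eq_mul, mul_assoc]

theorem curl_rowL {F : (ι → ℂ) → Matrix ι ι ℂ} {z : ι → ℂ}
    (hF : ∀ i j, ContDiffAt ℂ 1 (fun z => F z i j) z) (a b : ι → ℂ) (K : ι) :
    (fderiv ℂ (fun z => rowL (F z)) z a b - fderiv ℂ (fun z => rowL (F z)) z b a) K =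
      a ⬝ᵥ (curlC F K z).mulVec b := by
  rw [Pi.sub_apply, fderiv_rowL hF, fderiv_rowL hF, Finset.sum_comm, ← Finset.sum_sub_distrib]
  refine Finset.sum_congr rfl fun M _ => ?_
  rw [Matrix.mulVec, dotProduct, Finset.mul_sum, ← Finset.sum_sub_distrib]
  refine Finset.sum_congr rfl fun N _ => ?_
  simp only [curlC, Matrix.of_apply]
  ring

theorem dotProduct_conj (A C : Matrix ι ι ℂ) (a b : ι → ℂ) :
    Matrix.vecMul a A ⬝ᵥ C.mulVec (Matrix.vecMul b A) = a ⬝ᵥ (A * C * A.transpose).mulVec b := by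
  rw [← Matrix.dotProduct_mulVec, ← Matrix.mulVec_transpose A b, Matrix.mulVec_mulVec,
    Matrix.mulVec_mulVec, mul_assoc]

/-- Holomorphic straightening of the eigenspaces of an integrable structure in gauge. -/
theorem exists_straightening [Nonempty ι] {J : (ι → ℝ) → Matrix ι ι ℝ} {I₀ : Matrix ι ι ℝ}
    {c : ι → ℝ} (hI : ∀ i j, I₀ i j = -I₀ j i)
    (hJ : ∀ i j, ContDiffAt ℝ (ord ι 0 + 2 : ℕ) (fun y => J y i j) 0) (hJ0 : J 0 = I₀)
    (hsq : ∀ᶠ y in 𝓝 0, J y * J y = -1) (hinteg : ∀ᶠ y in 𝓝 0, Integ J y)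
    (hdiv : ∀ᶠ y in 𝓝 0, ∀ C, ∑ A, dx A (fun y => J y A C) y = c C) :
    ∃ u : (ι → ℂ) → (ι → ℂ), ContDiffAt ℂ 1 u 0 ∧
      HasFDerivAt u (ContinuousLinearMap.id ℂ (ι → ℂ)) 0 ∧
      ∀ᶠ y in 𝓝 0, ∀ v, Matrix.vecMul v ((J y).map ((↑) : ℝ → ℂ)) = Complex.I • v →
        Matrix.vecMul (fderiv ℂ u (realL ι y) v) (I₀.map ((↑) : ℝ → ℂ)) =
          Complex.I • fderiv ℂ u (realL ι y) v := by
  obtain ⟨F, hF, hFJ⟩ := KM.exists_holomorphic_structure hI hJ hJ0 hsq hinteg hdiv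
  have hJd : ∀ᶠ y in 𝓝 0, ∀ i j, DifferentiableAt ℝ (fun y => J y i j) y :=
    eventually_all.2 fun i => eventually_all.2 fun j =>
      ((hJ i j).eventually (natCast_ne_infty _)).mono fun y hy =>
        hy.differentiableAt (by norm_cast)
  have hFe : ∀ᶠ z in 𝓝 0, ∀ i j, ContDiffAt ℂ 1 (fun z => F z i j) z :=
    eventually_all.2 fun i => eventually_all.2 fun j => (hF i j).eventually (by simp)
  have hre : Tendsto (realL ι) (𝓝 0) (𝓝 0) := (realL ι).continuous.tendsto' _ _ (map_zero _)
  have hi := eventually_integ hF hJd hFJ hsq hinteg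
  have hF0 : F 0 = I₀.map ((↑) : ℝ → ℂ) := by
    have := hFJ.self_of_nhds
    rw [hJ0] at this
    rw [← this]
    exact congrArg F (map_zero (realL ι)).symm
  obtain ⟨u, hu, hu0, hT⟩ := exists_frobenius_chart (contDiffAt_rowL hF)
    (by
      filter_upwards [hi] with z hz v
      rw [rowL_apply, rowL_apply, Matrix.vecMul_vecMul, hz.1, Matrix.vecMul_neg, Matrix.vecMul_one])
    (by
      filter_upwards [hi, hFe] with z hz hFz a b
      ext K
      rw [curl_rowL hFz, curl_rowL hFz, rowL_apply, rowL_apply, dotProduct_conj, ← hz.2 K])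
  refine ⟨u, hu, hu0, ?_⟩
  filter_upwards [hFJ, hre.eventually hT] with y hy hz v hv
  rw [← hF0]
  refine hz v ?_
  rw [rowL_apply, realL_apply, hy]
  exact hv
end Coordinates
end NN

namespace NN
open scoped BigOperators Topology ContDiff
open Filter
open Wiener
set_option linter.unusedSectionVars false

section Charts
variable {ι : Type*} [Fintype ι] [DecidableEq ι]
variable {F : Type*} [NormedAddCommGroup F] [NormedSpace ℂ F]

/-- The complex-coordinate equations in terms of the derivative. -/
def CoordEq (J : (ι → ℝ) → Matrix ι ι ℝ) (z : (ι → ℝ) → F) (x : ι → ℝ) : Prop :=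
  ∀ v, fderiv ℝ z x v = Complex.I • fderiv ℝ z x (Matrix.vecMul v (J x))

variable (F) in
/-- Existence of a germ of complex coordinates of given regularity. -/
def HasChart (J : (ι → ℝ) → Matrix ι ι ℝ) (m : ℕ) (x₀ : ι → ℝ) : Prop :=
  ∃ z : (ι → ℝ) → F, ContDiffAt ℝ m z x₀ ∧ (∀ᶠ x in 𝓝 x₀, CoordEq J z x) ∧
    Function.Bijective (fderiv ℝ z x₀)

theorem HasChart.comp {I J : (ι → ℝ) → Matrix ι ι ℝ} {m : ℕ} (hm : 1 ≤ m) {w : (ι → ℝ) → ι → ℝ}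
    {x₀ : ι → ℝ} (h : HasChart F J m (w x₀)) (hw : ContDiffAt ℝ m w x₀)
    (hb : Function.Bijective (fderiv ℝ w x₀))
    (hIJ : ∀ᶠ x in 𝓝 x₀, ∀ v, fderiv ℝ w x (Matrix.vecMul v (I x)) =
      Matrix.vecMul (fderiv ℝ w x v) (J (w x))) : HasChart F I m x₀ := by
  obtain ⟨z, hz, hzJ, hzb⟩ := h
  have hm0 : (m : WithTop ℕ∞) ≠ 0 := by norm_cast; omega
  have hd : ∀ᶠ x in 𝓝 x₀, fderiv ℝ (fun x => z (w x)) x = (fderiv ℝ z (w x)).comp (fderiv ℝ w x) := by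
    filter_upwards [hw.eventually (natCast_ne_infty m),
      hw.continuousAt.eventually (hz.eventually (natCast_ne_infty m))] with x h1 h2
    exact fderiv_comp (g := z) (f := w) x (h2.differentiableAt hm0) (h1.differentiableAt hm0)
  refine ⟨fun x => z (w x), hz.comp x₀ hw, ?_, ?_⟩
  · filter_upwards [hd, hIJ, hw.continuousAt.eventually hzJ] with x h1 h2 h3 v
    rw [h1]
    change fderiv ℝ z (w x) (fderiv ℝ w x v) = Complex.I • fderiv ℝ z (w x) (fderiv ℝ w x _)
    rw [h2, h3]
  · rw [hd.self_of_nhds]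
    exact hzb.comp hb

theorem HasChart.congr {I J : (ι → ℝ) → Matrix ι ι ℝ} {m : ℕ} {x₀ : ι → ℝ} (h : HasChart F J m x₀)
    (hIJ : ∀ᶠ x in 𝓝 x₀, I x = J x) : HasChart F I m x₀ := by
  obtain ⟨z, hz, hzJ, hzb⟩ := h
  refine ⟨z, hz, ?_, hzb⟩
  filter_upwards [hzJ, hIJ] with x h1 h2 v
  rw [h2, h1]

theorem realL_vecMul (v : ι → ℝ) (A : Matrix ι ι ℝ) :
    realL ι (Matrix.vecMul v A) = Matrix.vecMul (realL ι v) (A.map ((↑) : ℝ → ℂ)) := by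
  ext k
  simp [realL_apply, Matrix.vecMul, dotProduct]

/-- Complex coordinates for an integrable structure in gauge. -/
theorem hasChart_of_gauge [Nonempty ι] {J : (ι → ℝ) → Matrix ι ι ℝ} {I₀ : Matrix ι ι ℝ}
    {c : ι → ℝ} (L : (ι → ℂ) →L[ℂ] F)
    (hL : ∀ v, L (Matrix.vecMul v (I₀.map ((↑) : ℝ → ℂ))) = -(Complex.I • L v))
    (hLb : Function.Bijective fun v => L (realL ι v)) (hI : ∀ i j, I₀ i j = -I₀ j i)
    (hJ : ∀ i j, ContDiffAt ℝ (ord ι 0 + 2 : ℕ) (fun y => J y i j) 0) (hJ0 : J 0 = I₀)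
    (hsq : ∀ᶠ y in 𝓝 0, J y * J y = -1) (hinteg : ∀ᶠ y in 𝓝 0, Integ J y)
    (hdiv : ∀ᶠ y in 𝓝 0, ∀ C, ∑ A, dx A (fun y => J y A C) y = c C) (m : ℕ) :
    HasChart F J m 0 := by
  obtain ⟨u, hu, hu0, h⟩ := exists_straightening hI hJ hJ0 hsq hinteg hdiv
  have hre : Tendsto (realL ι) (𝓝 0) (𝓝 0) := (realL ι).continuous.tendsto' _ _ (map_zero _)
  have hd : ∀ y, DifferentiableAt ℂ u (realL ι y) → HasFDerivAt (fun y => L (u (realL ι y)))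
      ((L.restrictScalars ℝ).comp (((fderiv ℂ u (realL ι y)).restrictScalars ℝ).comp (realL ι))) y :=
    fun y hy => (L.restrictScalars ℝ).hasFDerivAt.comp y
      (HasFDerivAt.comp (g := u) (f := realL ι) y (hy.hasFDerivAt.restrictScalars ℝ)
      (realL ι).hasFDerivAt)
  refine ⟨fun y => L (u (realL ι y)), ?_, ?_, ?_⟩
  · have h1 : ContDiffAt ℂ m (fun z => L (u z)) (realL ι 0) :=
      L.contDiff.contDiffAt.comp _ (by rw [map_zero]; exact contDiffAt_of_one hu m)
    exact ContDiffAt.comp (g := fun z => L (u z)) (0 : ι → ℝ) (h1.restrict_scalars ℝ)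
      (realL ι).contDiff.contDiffAt
  · filter_upwards [h, hsq, hre.eventually (hu.eventually (by simp))] with y h1 h2 h3 v
    rw [(hd y (h3.differentiableAt one_ne_zero)).fderiv]
    change L (fderiv ℂ u (realL ι y) (realL ι v)) =
      Complex.I • L (fderiv ℂ u (realL ι y) (realL ι (Matrix.vecMul v (J y))))
    set q : ι → ℂ := realL ι v - Complex.I • realL ι (Matrix.vecMul v (J y)) with hq
    have h4 : Matrix.vecMul q ((J y).map ((↑) : ℝ → ℂ)) = Complex.I • q := by
      have e : realL ι (Matrix.vecMul (Matrix.vecMul v (J y)) (J y)) = -realL ι v := by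
        rw [Matrix.vecMul_vecMul, h2, Matrix.vecMul_neg, Matrix.vecMul_one, map_neg]
      rw [hq, Matrix.sub_vecMul, Matrix.smul_vecMul, ← realL_vecMul, ← realL_vecMul, e, smul_sub,
        I_smul_I_smul]
      module
    have h5 := h1 q h4
    have h6 := hL (fderiv ℂ u (realL ι y) q)
    rw [h5, map_smul, eq_neg_iff_add_eq_zero, ← two_smul ℂ, smul_smul] at h6
    have h7 := (smul_eq_zero.1 h6).resolve_left (by simp)
    rw [hq, map_sub, map_sub, map_smul, map_smul, sub_eq_zero] at h7
    exact h7
  · rw [(hd 0 (by rw [map_zero]; exact hu0.differentiableAt)).fderiv, map_zero, hu0.fderiv]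
    exact hLb

theorem fderiv_eq_vecMul {w : (ι → ℝ) → ι → ℝ} {x : ι → ℝ} (hw : DifferentiableAt ℝ w x)
    (v : ι → ℝ) : fderiv ℝ w x v = Matrix.vecMul v (Matrix.of fun M A => dx M (fun y => w y A) x) := by
  ext A
  rw [fderiv_eq_sum_dx w x v, Finset.sum_apply]
  refine Finset.sum_congr rfl fun M _ => ?_
  change v M * dx M w x A = v M * dx M (fun y => w y A) x
  congr 1
  have h : HasFDerivAt (fun y => w y A) _ x := hasFDerivAt_pi'.1 hw.hasFDerivAt A
  rw [dx, dx, h.fderiv]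
  rfl

/-- Complex coordinates for a smooth integrable structure in normal form at the origin. -/
theorem hasChart_of_normal [Nonempty ι] {I₀ : Matrix ι ι ℝ} (L : (ι → ℂ) →L[ℂ] F)
    (hL : ∀ v, L (Matrix.vecMul v (I₀.map ((↑) : ℝ → ℂ))) = -(Complex.I • L v))
    (hLb : Function.Bijective fun v => L (realL ι v)) (hI : ∀ i j, I₀ i j = -I₀ j i)
    (hI2 : I₀ * I₀ = -1) {Jo : (ι → ℝ) → Matrix ι ι ℝ}
    (hJo : ∀ i j, ContDiff ℝ ∞ fun x => Jo x i j) (hJ0 : Jo 0 = I₀)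
    (hJsq : ∀ᶠ x in 𝓝 0, Jo x * Jo x = -1) (hinteg : ∀ᶠ x in 𝓝 0, Integ Jo x) {m : ℕ} (hm : 1 ≤ m) :
    HasChart F Jo m 0 := by
  obtain ⟨ε, hε, w, J, c, hw, hw0, hwd, hJ, hJ0, hsq, hinteg, hdiv, hW⟩ :=
    exists_divergence_const (m + (ord ι 0 + 2)) hI hI2 hJo hJ0 hJsq hinteg
  have h1 : HasChart F J m (w 0) := by
    rw [hw0]
    exact hasChart_of_gauge L hL hLb hI (fun i j => (hJ i j).of_le (by norm_cast; omega)) hJ0 hsq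
      hinteg hdiv m
  have h2 : HasChart F (fun x => Jo (ε • x)) m 0 := by
    refine h1.comp hm (hw.contDiffAt.of_le (by norm_cast; omega)) ?_ ?_
    · rw [hwd.fderiv]
      exact Function.bijective_id
    · filter_upwards [hW] with x hx v
      have hd : DifferentiableAt ℝ w x := hw.contDiffAt.differentiableAt (by norm_cast)
      rw [fderiv_eq_vecMul hd, fderiv_eq_vecMul hd, Matrix.vecMul_vecMul, Matrix.vecMul_vecMul, hx]
  set S : (ι → ℝ) →L[ℝ] (ι → ℝ) := ε⁻¹ • ContinuousLinearMap.id ℝ (ι → ℝ) with hS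
  have hSx : ∀ x, S x = ε⁻¹ • x := fun x => rfl
  have h3 : HasChart F (fun x => Jo (ε • x)) m (S 0) := by rwa [map_zero]
  refine h3.comp hm S.contDiff.contDiffAt ?_ (Eventually.of_forall fun x v => ?_)
  · rw [S.fderiv]
    exact ⟨fun x y hxy => smul_right_injective _ (inv_ne_zero hε.ne') hxy,
      fun y => ⟨ε • y, by rw [hSx, inv_smul_smul₀ hε.ne']⟩⟩
  · rw [S.fderiv, hSx, hSx, hSx, smul_inv_smul₀ hε.ne', Matrix.smul_vecMul]
end Charts
end NN

namespace NN
open scoped BigOperators Topology ContDiff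
open Filter
open Wiener
set_option linter.unusedSectionVars false

/-- A real vector space with a complex structure is a complex coordinate space. -/
theorem exists_complex_equiv {E : Type*} [AddCommGroup E] [Module ℝ E] [FiniteDimensional ℝ E]
    (J : Module.End ℝ E) (hJ : J * J = -1) {d : ℕ} (hd : Module.finrank ℝ E = 2 * d) :
    ∃ L : E ≃ₗ[ℝ] (Fin d → ℂ), ∀ v, L (J v) = Complex.I • L v := by
  let ρ : ℂ →ₐ[ℝ] Module.End ℝ E := Complex.lift ⟨J, hJ⟩
  let _ : Module ℂ E := Module.compHom E ρ.toRingHom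
  have hsm : ∀ (c : ℂ) (v : E), c • v = ρ c v := fun _ _ => rfl
  have : IsScalarTower ℝ ℂ E := ⟨fun r c v => by
    rw [hsm, hsm, map_smul]; rfl⟩
  have : FiniteDimensional ℂ E := FiniteDimensional.right ℝ ℂ E
  have h1 : Module.finrank ℂ E = d := by
    have := Module.finrank_mul_finrank ℝ ℂ E
    rw [Complex.finrank_real_complex, hd] at this
    omega
  let L : E ≃ₗ[ℂ] (Fin d → ℂ) := LinearEquiv.ofFinrankEq E (Fin d → ℂ) (by simp [h1])
  refine ⟨L.restrictScalars ℝ, fun v => ?_⟩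
  have h2 : Complex.I • v = J v := by
    rw [hsm]
    simp [ρ]
  rw [← h2]
  exact L.map_smul _ _

section Model
variable {ι : Type*} [Fintype ι] [DecidableEq ι] {d : ℕ}

/-- The standard complex structure. -/
def stdI (R : Type*) [Ring R] (e : Fin d × Fin 2 ≃ ι) : Matrix ι ι R :=
  Matrix.of fun i j => if (e.symm i).1 = (e.symm j).1 then
    (if (e.symm i).2 = 0 then (if (e.symm j).2 = 1 then -1 else 0)
      else (if (e.symm j).2 = 0 then 1 else 0)) else 0

theorem vecMul_stdI {R : Type*} [CommRing R] (e : Fin d × Fin 2 ≃ ι) (v : ι → R) (n : Fin d) :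
    Matrix.vecMul v (stdI R e) (e (n, 0)) = v (e (n, 1)) ∧
      Matrix.vecMul v (stdI R e) (e (n, 1)) = -v (e (n, 0)) := by
  simp only [Matrix.vecMul, dotProduct, ← e.sum_comp, stdI, Matrix.of_apply, e.symm_apply_apply,
    Fintype.sum_prod_type, Fin.sum_univ_two]
  constructor <;> simp

theorem stdI_antisymm (e : Fin d × Fin 2 ≃ ι) (i j : ι) : stdI ℝ e i j = -stdI ℝ e j i := by
  obtain ⟨⟨n, a⟩, rfl⟩ := e.surjective i
  obtain ⟨⟨k, b⟩, rfl⟩ := e.surjective j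
  simp only [stdI, Matrix.of_apply, e.symm_apply_apply, eq_comm (a := k)]
  fin_cases a <;> fin_cases b <;> by_cases h : n = k <;> simp [h]

theorem stdI_map (e : Fin d × Fin 2 ≃ ι) : (stdI ℝ e).map ((↑) : ℝ → ℂ) = stdI ℂ e := by
  ext i j
  simp only [stdI, Matrix.map_apply, Matrix.of_apply]
  split_ifs <;> simp

/-- The standard complex coordinates. -/
noncomputable def stdL (e : Fin d × Fin 2 ≃ ι) : (ι → ℂ) →L[ℂ] (Fin d → ℂ) :=
  ContinuousLinearMap.pi fun n => ContinuousLinearMap.proj (e (n, 0)) +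
    Complex.I • ContinuousLinearMap.proj (e (n, 1))

theorem stdL_apply (e : Fin d × Fin 2 ≃ ι) (v : ι → ℂ) (n : Fin d) :
    stdL e v n = v (e (n, 0)) + Complex.I * v (e (n, 1)) := rfl

theorem stdL_vecMul (e : Fin d × Fin 2 ≃ ι) (v : ι → ℂ) :
    stdL e (Matrix.vecMul v (stdI ℂ e)) = -(Complex.I • stdL e v) := by
  ext n
  rw [stdL_apply, (vecMul_stdI e v n).1, (vecMul_stdI e v n).2, Pi.neg_apply, Pi.smul_apply,
    stdL_apply, smul_eq_mul]
  linear_combination v (e (n, 1)) * Complex.I_mul_I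

theorem stdI_sq (e : Fin d × Fin 2 ≃ ι) : stdI ℝ e * stdI ℝ e = -1 := by
  have h : ∀ v : ι → ℝ, Matrix.vecMul v (stdI ℝ e * stdI ℝ e) = -v := fun v => by
    rw [← Matrix.vecMul_vecMul]
    ext i
    obtain ⟨⟨n, a⟩, rfl⟩ := e.surjective i
    fin_cases a
    · exact ((vecMul_stdI e _ n).1.trans (vecMul_stdI e v n).2)
    · exact ((vecMul_stdI e _ n).2.trans (congrArg Neg.neg (vecMul_stdI e v n).1))
  ext i j
  have h1 := congrFun (h (Pi.single i 1)) j
  rw [Matrix.single_one_vecMul] at h1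
  rw [← Matrix.row_apply (stdI ℝ e * stdI ℝ e), h1, Pi.neg_apply, Matrix.neg_apply,
    Matrix.one_apply, Pi.single_apply]
  simp only [eq_comm]

/-- The standard complex coordinates on real points. -/
noncomputable def stdR (e : Fin d × Fin 2 ≃ ι) : (ι → ℝ) ≃ₗ[ℝ] (Fin d → ℂ) :=
  LinearEquiv.ofBijective ((stdL e).restrictScalars ℝ ∘L realL ι : (ι → ℝ) →L[ℝ] (Fin d → ℂ)).toLinearMap (by
    constructor
    · refine (injective_iff_map_eq_zero _).2 fun v hv => ?_
      ext i
      obtain ⟨⟨n, a⟩, rfl⟩ := e.surjective i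
      have h : (v (e (n, 0)) : ℂ) + Complex.I * v (e (n, 1)) = 0 := congrFun hv n
      have h0 := congrArg Complex.re h
      have h1 := congrArg Complex.im h
      simp at h0 h1
      fin_cases a
      · exact h0
      · exact h1
    · intro z
      refine ⟨fun i => if (e.symm i).2 = 0 then (z (e.symm i).1).re else (z (e.symm i).1).im, ?_⟩
      ext n
      change ((if (e.symm (e (n, 0))).2 = 0 then _ else _ : ℝ) : ℂ) + Complex.I *
        ((if (e.symm (e (n, 1))).2 = 0 then _ else _ : ℝ) : ℂ) = z n
      simp only [e.symm_apply_apply]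
      simp [mul_comm Complex.I, Complex.re_add_im])

theorem stdR_apply (e : Fin d × Fin 2 ≃ ι) (v : ι → ℝ) : stdR e v = stdL e (realL ι v) := rfl

theorem stdR_vecMul (e : Fin d × Fin 2 ≃ ι) (v : ι → ℝ) :
    stdR e (Matrix.vecMul v (stdI ℝ e)) = -(Complex.I • stdR e v) := by
  rw [stdR_apply, realL_vecMul, stdI_map, stdL_vecMul, stdR_apply]

/-- Every constant complex structure is linearly conjugate to the standard one. -/
theorem exists_normal_form (e : Fin d × Fin 2 ≃ ι) {A : Matrix ι ι ℝ} (hA : A * A = -1) :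
    ∃ S B : Matrix ι ι ℝ, B * S = 1 ∧ S * stdI ℝ e = A * S := by
  have hcard : Fintype.card ι = 2 * d := by
    rw [← Fintype.card_congr e]
    simp [mul_comm]
  obtain ⟨L, hL⟩ := exists_complex_equiv (-A.vecMulLinear) (LinearMap.ext fun v => by
    change -(Matrix.vecMul (-(Matrix.vecMul v A)) A) = -v
    rw [Matrix.neg_vecMul, neg_neg, Matrix.vecMul_vecMul, hA, Matrix.vecMul_neg,
      Matrix.vecMul_one]) (d := d) (by simp [hcard])
  have hL' : ∀ v, L (Matrix.vecMul v A) = -(Complex.I • L v) := fun v => by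
    rw [← hL, ← map_neg]
    simp
  let φ : (ι → ℝ) ≃ₗ[ℝ] (ι → ℝ) := L.trans (stdR e).symm
  have hφ : ∀ v, φ (Matrix.vecMul v A) = Matrix.vecMul (φ v) (stdI ℝ e) := fun v => by
    apply (stdR e).injective
    rw [stdR_vecMul]
    simp [φ, hL']
  have hM : ∀ (f : (ι → ℝ) →ₗ[ℝ] (ι → ℝ)) v, Matrix.vecMul v (LinearMap.toMatrix' f).transpose = f v :=
    fun f v => by rw [Matrix.vecMul_transpose, LinearMap.toMatrix'_mulVec]
  have hext : ∀ P Q : Matrix ι ι ℝ, (∀ v, Matrix.vecMul v P = Matrix.vecMul v Q) → P = Q :=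
    fun P Q h => by
      ext i j
      simpa using congrFun (h (Pi.single i 1)) j
  refine ⟨(LinearMap.toMatrix' φ.toLinearMap).transpose,
    (LinearMap.toMatrix' φ.symm.toLinearMap).transpose, hext _ _ fun v => ?_, hext _ _ fun v => ?_⟩
  · rw [← Matrix.vecMul_vecMul, hM, hM, Matrix.vecMul_one]
    exact φ.apply_symm_apply v
  · rw [← Matrix.vecMul_vecMul, ← Matrix.vecMul_vecMul, hM, hM]
    exact (hφ v).symm
end Model
end NN

namespace NN
open scoped BigOperators Topology ContDiff
open Filter
open Wiener
set_option linter.unusedSectionVars false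

section Chart
variable {ι : Type*} [Fintype ι] [DecidableEq ι]

/-- A smooth function on a neighbourhood of the origin can be extended, after shrinking the
neighbourhood, to a globally smooth function. -/
theorem exists_contDiff_extension {κ : Type*} {s : Set (ι → ℝ)} (hs : IsOpen s) (h0 : 0 ∈ s)
    {f : κ → (ι → ℝ) → ℝ} (hf : ∀ k, ContDiffOn ℝ ∞ (f k) s) :
    ∃ g : κ → (ι → ℝ) → ℝ, (∀ k, ContDiff ℝ ∞ (g k)) ∧ ∀ᶠ x in 𝓝 0, ∀ k, g k x = f k x := by
  obtain ⟨R, hR, hRs⟩ := Metric.isOpen_iff.1 hs 0 h0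
  obtain ⟨χ, hχ, hχ1, hχ0⟩ := exists_cutoff ι (r := R / 3) (R := R / 2) (by linarith) (by linarith)
  refine ⟨fun k x => χ x * f k x, fun k => contDiff_iff_contDiffAt.2 fun x => ?_, ?_⟩
  · by_cases hx : ‖x‖ < R
    · exact hχ.contDiffAt.mul ((hf k).contDiffAt (hs.mem_nhds (hRs (by simpa using hx))))
    · refine (contDiffAt_const (c := (0 : ℝ))).congr_of_eventuallyEq ?_
      have h1 : ∀ᶠ y in 𝓝 x, R / 2 < ‖y‖ :=
        continuous_norm.continuousAt.eventually (lt_mem_nhds (by linarith))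
      filter_upwards [h1] with y hy
      rw [hχ0 y hy.le, zero_mul]
  · filter_upwards [Metric.ball_mem_nhds (0 : ι → ℝ) (show 0 < R / 3 by linarith)] with x hx k
    rw [hχ1 x (by simpa using (mem_ball_zero_iff.1 hx).le), one_mul]

theorem contDiff_vecMul (A : Matrix ι ι ℝ) {n : WithTop ℕ∞} :
    ContDiff ℝ n fun v : ι → ℝ => Matrix.vecMul v A :=
  A.vecMulLinear.toContinuousLinearMap.contDiff

theorem hasFDerivAt_vecMul_sub (A : Matrix ι ι ℝ) (x₀ x : ι → ℝ) :
    HasFDerivAt (fun x => Matrix.vecMul (x - x₀) A) A.vecMulLinear.toContinuousLinearMap x := by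
  have h := (A.vecMulLinear.toContinuousLinearMap.hasFDerivAt (x := x - x₀)).comp x
    ((hasFDerivAt_id x).sub_const x₀)
  exact h

/-- The matrix-valued map `y ↦ B I(x₀ + y B) S`. -/
def conj (B S : Matrix ι ι ℝ) (I : (ι → ℝ) → Matrix ι ι ℝ) (x₀ : ι → ℝ) (y : ι → ℝ) :
    Matrix ι ι ℝ := B * I (x₀ + Matrix.vecMul y B) * S

variable {d : ℕ}

theorem hasChart_of_integ [Nonempty ι] (e : Fin d × Fin 2 ≃ ι) {U : Set (ι → ℝ)} (hU : IsOpen U)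
    {I : (ι → ℝ) → Matrix ι ι ℝ} (hsm : ∀ i j, ContDiffOn ℝ ∞ (fun y => I y i j) U)
    (hI2 : ∀ x ∈ U, I x * I x = -1) (hinteg : ∀ x ∈ U, Integ I x) {x₀ : ι → ℝ} (hx₀ : x₀ ∈ U)
    {m : ℕ} (hm : 1 ≤ m) : HasChart (Fin d → ℂ) I m x₀ := by
  obtain ⟨S, B, hBS, hS⟩ := exists_normal_form e (hI2 x₀ hx₀)
  have hSB : S * B = 1 := mul_eq_one_comm.1 hBS
  let p : (ι → ℝ) → ι → ℝ := fun y => x₀ + Matrix.vecMul y B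
  have hp : ContDiff ℝ ∞ p := contDiff_const.add (contDiff_vecMul B)
  have hp0 : p 0 = x₀ := by simp [p]
  let w : (ι → ℝ) → ι → ℝ := fun x => Matrix.vecMul (x - x₀) S
  have hw0 : w x₀ = 0 := by simp [w]
  have hwp : ∀ y, w (p y) = y := fun y => by
    simp [w, p, Matrix.vecMul_vecMul, hBS]
  have hpw : ∀ x, p (w x) = x := fun y => by
    simp [w, p, Matrix.vecMul_vecMul, hSB]
  have hwd : ∀ x, HasFDerivAt w S.vecMulLinear.toContinuousLinearMap x :=
    fun x => hasFDerivAt_vecMul_sub S x₀ x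
  have hs : IsOpen (p ⁻¹' U) := hU.preimage hp.continuous
  have h0 : (0 : ι → ℝ) ∈ p ⁻¹' U := by rw [Set.mem_preimage, hp0]; exact hx₀
  let J := conj B S I x₀
  have hJp : ∀ y, J y = B * I (p y) * S := fun _ => rfl
  have hJ : ∀ k : ι × ι, ContDiffOn ℝ ∞ (fun y => J y k.1 k.2) (p ⁻¹' U) := fun k => by
    have : (fun y => J y k.1 k.2) = fun y => ∑ b, (∑ a, B k.1 a * I (p y) a b) * S b k.2 := by
      funext y
      simp only [hJp, Matrix.mul_apply]
    rw [this]
    exact ContDiffOn.sum fun b _ => (ContDiffOn.sum fun a _ => contDiffOn_const.mul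
      ((hsm a b).comp hp.contDiffOn fun _ h => h)).mul contDiffOn_const
  have hJ0 : J 0 = stdI ℝ e := by
    rw [hJp, hp0, mul_assoc, ← hS, ← mul_assoc, hBS, one_mul]
  have hJsq : ∀ y ∈ p ⁻¹' U, J y * J y = -1 := fun y hy => by
    rw [hJp]
    calc B * I (p y) * S * (B * I (p y) * S) = B * I (p y) * (S * B) * I (p y) * S := by
          simp only [mul_assoc]
      _ = B * (I (p y) * I (p y)) * S := by rw [hSB, mul_one]; simp only [mul_assoc]
      _ = -1 := by rw [hI2 _ hy]; simp [hBS]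
  have hJint : ∀ y ∈ p ⁻¹' U, Integ J y := fun y hy => by
    have := Integ.transport (w := w) (W := fun _ => S) (J := J) (hinteg (p y) hy)
      (fun i j => ((hsm i j).contDiffAt (hU.mem_nhds hy)).differentiableAt (by simp)) (hI2 _ hy)
      (hwd _).differentiableAt (fun M A => ?_) (fun _ _ => differentiableAt_const _)
      (fun M N A => by simp only [dx_const]) hBS
      (fun i j => ((hJ (i, j)).contDiffAt (by rw [hwp]; exact hs.mem_nhds hy)).differentiableAt
        (by simp))
      (Eventually.of_forall fun x => by
        rw [hJp, hpw, ← mul_assoc, ← mul_assoc, hSB, one_mul])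
    · rwa [hwp] at this
    · have h1 := ((hasFDerivAt_pi'.1 (hwd (p y))) A).fderiv
      rw [dx, h1]
      change Matrix.vecMul (Pi.single M 1) S A = S M A
      rw [Matrix.single_one_vecMul, Matrix.row_apply]
  obtain ⟨Jo, hg, hJo⟩ : ∃ Jo : (ι → ℝ) → Matrix ι ι ℝ,
      (∀ i j, ContDiff ℝ ∞ fun x => Jo x i j) ∧ ∀ᶠ x in 𝓝 0, Jo x = J x := by
    obtain ⟨g, hg, hgJ⟩ := exists_contDiff_extension hs h0 hJ
    exact ⟨fun x => Matrix.of fun i j => g (i, j) x, fun i j => hg (i, j), hgJ.mono fun x hx => by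
      ext i j
      exact hx (i, j)⟩
  have hc : HasChart (Fin d → ℂ) Jo m 0 := by
    refine hasChart_of_normal (I₀ := stdI ℝ e) (stdL e) (fun v => ?_) (stdR e).bijective
      (stdI_antisymm e) (stdI_sq e) hg (hJo.self_of_nhds.trans hJ0) ?_ ?_ hm
    · rw [stdI_map, stdL_vecMul]
    · filter_upwards [hJo, hs.mem_nhds h0] with x h1 h2
      rw [h1, hJsq x h2]
    · filter_upwards [hJo.eventually_nhds, hs.mem_nhds h0] with x h1 h2 K
      have h3 : curl Jo K x = curl J K x := by
        ext M N
        simp only [curl, ext1, Matrix.of_apply]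
        rw [dx_congr (h1.mono fun y hy => congrFun (congrFun hy N) K),
          dx_congr (h1.mono fun y hy => congrFun (congrFun hy M) K)]
      rw [h3, h1.self_of_nhds]
      exact hJint x h2 K
  have hc' : HasChart (Fin d → ℂ) J m (w x₀) := by
    rw [hw0]
    exact hc.congr (hJo.mono fun x h => h.symm)
  refine hc'.comp hm ?_ ?_ (Eventually.of_forall fun x v => ?_)
  · exact ((contDiff_vecMul S).comp (contDiff_id.sub contDiff_const)).contDiffAt
  · rw [(hwd x₀).fderiv]
    refine Function.bijective_iff_has_inverse.2 ⟨fun v => Matrix.vecMul v B, fun v => ?_,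
      fun v => ?_⟩
    · change Matrix.vecMul (Matrix.vecMul v S) B = v
      rw [Matrix.vecMul_vecMul, hSB, Matrix.vecMul_one]
    · change Matrix.vecMul (Matrix.vecMul v B) S = v
      rw [Matrix.vecMul_vecMul, hBS, Matrix.vecMul_one]
  · rw [(hwd x).fderiv]
    change Matrix.vecMul (Matrix.vecMul v (I x)) S = Matrix.vecMul (Matrix.vecMul v S) (J (w x))
    rw [hJp, hpw, Matrix.vecMul_vecMul, Matrix.vecMul_vecMul, ← mul_assoc, ← mul_assoc, hSB,
      one_mul]

end Chart
end NN

namespace NN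
open scoped BigOperators Topology ContDiff
open Filter
open Wiener
set_option linter.unusedSectionVars false

/-- A real `C¹` map with complex-linear derivative is a complex `C¹` map. -/
theorem contDiffAt_complex_of_real {E F : Type*} [NormedAddCommGroup E] [NormedSpace ℂ E]
    [NormedAddCommGroup F] [NormedSpace ℂ F] {h : E → F} {a : E} (hh : ContDiffAt ℝ 1 h a)
    (hI : ∀ᶠ y in 𝓝 a, ∀ v, fderiv ℝ h y (Complex.I • v) = Complex.I • fderiv ℝ h y v) :
    ContDiffAt ℂ 1 h a := by
  obtain ⟨f', u, hu, hf', hd⟩ := contDiffAt_one_iff.1 hh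
  have hc : ∀ y ∈ u ∩ {y | ∀ v, fderiv ℝ h y (Complex.I • v) = Complex.I • fderiv ℝ h y v},
      HasFDerivAt h (fderiv ℂ h y) y ∧ (fderiv ℂ h y).restrictScalars ℝ = f' y := by
    rintro y ⟨hy, hyI⟩
    have hr := hd y hy
    have hL : ∀ (c : ℂ) v, fderiv ℝ h y (c • v) = c • fderiv ℝ h y v := fun c v => by
      rw [← Complex.re_add_im c, add_smul, add_smul, map_add, mul_smul, mul_smul,
        Complex.coe_smul, Complex.coe_smul, Complex.coe_smul, Complex.coe_smul, map_smul, map_smul,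
        hyI]
    let g : E →L[ℂ] F :=
      { toFun := fderiv ℝ h y
        map_add' := map_add _
        map_smul' := hL
        cont := (fderiv ℝ h y).continuous }
    have hg : DifferentiableAt ℂ h y :=
      (differentiableAt_iff_restrictScalars ℝ hr.differentiableAt).2 ⟨g, by ext v; rfl⟩
    refine ⟨hg.hasFDerivAt, ?_⟩
    exact (hg.hasFDerivAt.restrictScalars ℝ).unique hr
  refine contDiffAt_one_iff.2 ⟨fderiv ℂ h, _, inter_mem hu hI, ?_, fun y hy => (hc y hy).1⟩
  refine ((ContinuousLinearMap.restrictScalarsIsometry ℂ E F ℝ ℝ).isometry.isEmbedding.isInducing.continuousOn_iff).2 ?_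
  exact (hf'.mono Set.inter_subset_left).congr fun y hy => (hc y hy).2

section Inverse
variable {E F : Type*} [NormedAddCommGroup E] [NormedSpace ℝ E] [CompleteSpace E]
  [NormedAddCommGroup F] [NormedSpace ℝ F] [CompleteSpace F]

theorem exists_inverse_chart {z : E → F} {x : E} {n : ℕ} (hz : ContDiffAt ℝ n z x) (hn : 1 ≤ n)
    (hb : Function.Bijective (fderiv ℝ z x)) :
    ∃ u : F → E, ContDiffAt ℝ n u (z x) ∧ u (z x) = x ∧
      (∀ᶠ y in 𝓝 x, u (z y) = y ∧ DifferentiableAt ℝ u (z y) ∧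
        (∀ v, fderiv ℝ u (z y) (fderiv ℝ z y v) = v) ∧
        ∀ v, fderiv ℝ z y (fderiv ℝ u (z y) v) = v) ∧
      ∀ᶠ q in 𝓝 (z x), z (u q) = q := by
  have hn0 : (n : WithTop ℕ∞) ≠ 0 := by norm_cast; omega
  have hn1 : ((1 : ℕ) : WithTop ℕ∞) ≤ n := by norm_cast
  let T : E ≃L[ℝ] F := ContinuousLinearEquiv.ofBijective (fderiv ℝ z x)
    (LinearMap.ker_eq_bot.2 hb.1) (LinearMap.range_eq_top.2 hb.2)
  obtain ⟨u, hu, hux, huz, hzu⟩ := exists_local_inverse (f' := T) hz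
    (hz.differentiableAt hn0).hasFDerivAt hn0
  refine ⟨u, hu, hux, ?_, hzu⟩
  have hd : ∀ᶠ y in 𝓝 x, DifferentiableAt ℝ z y :=
    ((hz.of_le hn1).eventually (natCast_ne_infty 1)).mono fun y h =>
      h.differentiableAt (by simp)
  have hud : ∀ᶠ q in 𝓝 (z x), DifferentiableAt ℝ u q :=
    ((hu.of_le hn1).eventually (natCast_ne_infty 1)).mono fun y h =>
      h.differentiableAt (by simp)
  filter_upwards [huz.eventually_nhds, hd, hz.continuousAt.eventually hud,
    hz.continuousAt.eventually hzu.eventually_nhds] with y h1 h2 h3 h4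
  refine ⟨h1.self_of_nhds, h3, fun v => ?_, fun v => ?_⟩
  · have e := (HasFDerivAt.comp (g := u) y h3.hasFDerivAt h2.hasFDerivAt).unique
      ((hasFDerivAt_id y).congr_of_eventuallyEq h1)
    exact congrArg (fun L : E →L[ℝ] E => L v) e
  · have h2' : DifferentiableAt ℝ z (u (z y)) := by rwa [h1.self_of_nhds]
    have e := (HasFDerivAt.comp (g := z) (z y) h2'.hasFDerivAt h3.hasFDerivAt).unique
      ((hasFDerivAt_id (z y)).congr_of_eventuallyEq h4)
    rw [h1.self_of_nhds] at e
    exact congrArg (fun L : F →L[ℝ] F => L v) e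

theorem eventually_bijective_fderiv {z : E → F} {x : E} (hz : ContDiffAt ℝ 1 z x)
    (hb : Function.Bijective (fderiv ℝ z x)) :
    ∀ᶠ y in 𝓝 x, Function.Bijective (fderiv ℝ z y) := by
  obtain ⟨u, -, -, h, -⟩ := exists_inverse_chart (n := 1) (by simpa using hz) le_rfl hb
  exact h.mono fun y hy => Function.bijective_iff_has_inverse.2 ⟨_, hy.2.2.1, hy.2.2.2⟩

end Inverse

section Smooth
variable {ι : Type*} [Fintype ι] [DecidableEq ι]
  {F : Type*} [NormedAddCommGroup F] [NormedSpace ℂ F] [FiniteDimensional ℂ F]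

/-- Complex coordinates are as smooth as the charts of the structure. -/
theorem CoordEq.contDiffAt {J : (ι → ℝ) → Matrix ι ι ℝ} {m : ℕ} (hm : 1 ≤ m) {x : ι → ℝ}
    {z : (ι → ℝ) → F} (hz : ContDiffAt ℝ 1 z x) (hzJ : ∀ᶠ y in 𝓝 x, CoordEq J z y)
    (hch : HasChart F J m x) : ContDiffAt ℝ m z x := by
  have : CompleteSpace F := FiniteDimensional.complete ℂ F
  have hm0 : (m : WithTop ℕ∞) ≠ 0 := by norm_cast; omega
  obtain ⟨w, hw, hwJ, hwb⟩ := hch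
  obtain ⟨u, hu, hux, huw, hwu⟩ := exists_inverse_chart hw hm hwb
  have hut : Tendsto u (𝓝 (w x)) (𝓝 x) := by
    have := hu.continuousAt
    rwa [ContinuousAt, hux] at this
  have hzd : ∀ᶠ y in 𝓝 x, DifferentiableAt ℝ z y :=
    (hz.eventually (by simp)).mono fun y h => h.differentiableAt one_ne_zero
  have hh : ContDiffAt ℝ 1 (fun q => z (u q)) (w x) := by
    refine ContDiffAt.comp (g := z) (f := u) (w x) ?_ (hu.of_le (by exact_mod_cast hm))
    rwa [hux]
  have hI : ∀ᶠ q in 𝓝 (w x), ∀ v, fderiv ℝ (fun q => z (u q)) q (Complex.I • v) =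
      Complex.I • fderiv ℝ (fun q => z (u q)) q v := by
    filter_upwards [hut.eventually huw, hut.eventually hzJ, hut.eventually hwJ,
      hut.eventually hzd, hwu] with q h1 h2 h3 h4 h5 v
    obtain ⟨-, hud, hl, hr⟩ := h1
    rw [h5] at hud hl hr
    have hd : fderiv ℝ (fun q => z (u q)) q = (fderiv ℝ z (u q)).comp (fderiv ℝ u q) :=
      (HasFDerivAt.comp (g := z) q h4.hasFDerivAt hud.hasFDerivAt).fderiv
    have e : fderiv ℝ u q (Complex.I • v) = -Matrix.vecMul (fderiv ℝ u q v) (J (u q)) := by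
      rw [← hl (-Matrix.vecMul (fderiv ℝ u q v) (J (u q))), map_neg]
      congr 1
      conv_lhs => rw [← hr v, h3, smul_smul, Complex.I_mul_I, neg_one_smul]
    rw [hd, ContinuousLinearMap.comp_apply, ContinuousLinearMap.comp_apply, e, map_neg, h2 (fderiv ℝ u q v),
      smul_smul, Complex.I_mul_I, neg_one_smul]
  have hm' : ContDiffAt ℝ m (fun q => z (u q)) (w x) :=
    (contDiffAt_of_one (contDiffAt_complex_of_real hh hI) m).restrict_scalars ℝ
  exact (ContDiffAt.comp (g := fun q => z (u q)) x hm' hw).congr_of_eventuallyEq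
    (huw.mono fun y hy => by simp [hy.1])

/-- Charts of every finite order give a smooth chart. -/
theorem exists_smooth_chart {J : (ι → ℝ) → Matrix ι ι ℝ} {U : Set (ι → ℝ)} (hU : IsOpen U)
    (hch : ∀ x ∈ U, ∀ m : ℕ, 1 ≤ m → HasChart F J m x) {x₀ : ι → ℝ} (hx₀ : x₀ ∈ U) :
    ∃ V, IsOpen V ∧ x₀ ∈ V ∧ V ⊆ U ∧ ∃ z : (ι → ℝ) → F, ContDiffOn ℝ ∞ z V ∧
      (∀ x ∈ V, CoordEq J z x) ∧ ∀ x ∈ V, Function.Bijective (fderiv ℝ z x) := by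
  have : CompleteSpace F := FiniteDimensional.complete ℂ F
  obtain ⟨z, hz, hzJ, hzb⟩ := hch x₀ hx₀ 1 le_rfl
  have hz : ContDiffAt ℝ 1 z x₀ := by simpa using hz
  obtain ⟨V, hV, hVo, hxV⟩ := eventually_nhds_iff.1
    (((hz.eventually (by simp)).and hzJ).and
      ((eventually_bijective_fderiv hz hzb).and (hU.mem_nhds hx₀)))
  refine ⟨V, hVo, hxV, fun x hx => (hV x hx).2.2, z, fun x hx => ?_,
    fun x hx => (hV x hx).1.2, fun x hx => (hV x hx).2.1⟩
  refine (contDiffAt_infty.2 fun m => ?_).contDiffWithinAt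
  have hJ : ∀ᶠ y in 𝓝 x, CoordEq J z y := by
    filter_upwards [hVo.mem_nhds hx] with y hy using (hV y hy).1.2
  exact (CoordEq.contDiffAt (m := m + 1) (by omega) (hV x hx).1.1 hJ
    (hch x (hV x hx).2.2 (m + 1) (by omega))).of_le (by norm_cast; omega)

end Smooth
end NN

namespace NN
open scoped BigOperators Topology ContDiff
open Filter
open Wiener
set_option linter.unusedSectionVars false

theorem nijenhuis_eq {D : ℕ} (I : (Fin D → ℝ) → Matrix (Fin D) (Fin D) ℝ) (x : Fin D → ℝ)
    (M N K : Fin D) :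
    nijenhuis I x M N K = (curl I K x - I x * curl I K x * (I x).transpose) M N := by
  have h : (I x * curl I K x * (I x).transpose) M N =
      ∑ P, ∑ Q, I x M P * I x N Q * curl I K x P Q := by
    simp only [Matrix.mul_apply, Matrix.transpose_apply, Finset.sum_mul]
    rw [Finset.sum_comm]
    exact Finset.sum_congr rfl fun P _ => Finset.sum_congr rfl fun Q _ => by ring
  rw [Matrix.sub_apply, h]
  rfl

theorem integ_of_nijenhuis {D : ℕ} {I : (Fin D → ℝ) → Matrix (Fin D) (Fin D) ℝ} {x : Fin D → ℝ}
    (h : ∀ M N K, nijenhuis I x M N K = 0) : Integ I x := fun K => by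
  refine sub_eq_zero.1 ?_
  ext M N
  rw [← nijenhuis_eq, h, Matrix.zero_apply]

theorem CoordEq.complexCoordEq {D d : ℕ} {I : (Fin D → ℝ) → Matrix (Fin D) (Fin D) ℝ}
    {z : (Fin D → ℝ) → Fin d → ℂ} {x : Fin D → ℝ} (h : CoordEq I z x)
    (hz : DifferentiableAt ℝ z x) (n : Fin d) : ComplexCoordEq I (fun y => z y n) x := fun M => by
  have hd : ∀ v, fderiv ℝ (fun y => z y n) x v = fderiv ℝ z x v n := fun v => by
    rw [((hasFDerivAt_pi'.1 hz.hasFDerivAt) n).fderiv]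
    rfl
  have h1 := congrFun (h (Pi.single M 1)) n
  rw [← hd, Pi.smul_apply, ← hd, Matrix.single_one_vecMul,
    fderiv_eq_sum_dx (fun y => z y n) x (Matrix.row (I x) M)] at h1
  rw [sub_eq_zero]
  refine h1.trans ?_
  rw [smul_eq_mul]
  refine congrArg _ (Finset.sum_congr rfl fun N _ => ?_)
  rw [Complex.real_smul]
  rfl

/-- The Jacobian matrix acting on a vector. -/
theorem realJacobian_mulVec {d : ℕ} (z : Fin d → (Fin (2 * d) → ℝ) → ℂ) (x c : Fin (2 * d) → ℝ)
    (p : Fin d × Fin 2) :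
    (realJacobian z x).mulVec
        (c ∘ (finProdFinEquiv.trans (finCongr (by ring : d * 2 = 2 * d)))) p =
      ∑ K, c K * dx K (fun y => if p.2 = 0 then (z p.1 y).re else (z p.1 y).im) x := by
  rw [← (finProdFinEquiv.trans (finCongr (by ring : d * 2 = 2 * d))).sum_comp]
  exact Finset.sum_congr rfl fun q _ => mul_comm _ _

theorem isUnit_realJacobian {d : ℕ} {z : (Fin (2 * d) → ℝ) → Fin d → ℂ} {x : Fin (2 * d) → ℝ}
    (hz : DifferentiableAt ℝ z x) (hb : Function.Injective (fderiv ℝ z x)) :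
    IsUnit (realJacobian (fun n y => z y n) x) := by
  rw [← Matrix.mulVec_injective_iff_isUnit]
  refine (injective_iff_map_eq_zero (Matrix.mulVecLin (realJacobian (fun n y => z y n) x))).2
    fun v hv => ?_
  set e := finProdFinEquiv.trans (finCongr (by ring : d * 2 = 2 * d)) with he
  obtain ⟨c, rfl⟩ : ∃ c : Fin (2 * d) → ℝ, v = c ∘ e :=
    ⟨v ∘ e.symm, by ext q; simp⟩
  have h1 : ∀ p : Fin d × Fin 2,
      fderiv ℝ (fun y => if p.2 = 0 then (z y p.1).re else (z y p.1).im) x c = 0 := fun p => by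
    rw [fderiv_eq_sum_dx (fun y => if p.2 = 0 then (z y p.1).re else (z y p.1).im)]
    exact (realJacobian_mulVec (fun n y => z y n) x c p).symm.trans (congrFun hv p)
  have h2 : fderiv ℝ z x c = 0 := by
    ext n
    have hn := (hasFDerivAt_pi'.1 hz.hasFDerivAt) n
    have hre := (Complex.reCLM.hasFDerivAt.comp x hn).fderiv
    have him := (Complex.imCLM.hasFDerivAt.comp x hn).fderiv
    refine Complex.ext ?_ ?_
    · exact (congrArg (fun L : (Fin (2 * d) → ℝ) →L[ℝ] ℝ => L c) hre).symm.trans (h1 (n, 0))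
    · exact (congrArg (fun L : (Fin (2 * d) → ℝ) →L[ℝ] ℝ => L c) him).symm.trans (h1 (n, 1))
  rw [(injective_iff_map_eq_zero _).1 hb c h2]
  rfl

theorem ComplexCoordEq.re_im {D : ℕ} {I : (Fin D → ℝ) → Matrix (Fin D) (Fin D) ℝ}
    {z : (Fin D → ℝ) → ℂ} {x : Fin D → ℝ} (h : ComplexCoordEq I z x)
    (hz : DifferentiableAt ℝ z x) (M : Fin D) :
    ∑ N, I x M N * dx N (fun y => (z y).re) x = dx M (fun y => (z y).im) x ∧
      ∑ N, I x M N * dx N (fun y => (z y).im) x = -dx M (fun y => (z y).re) x := by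
  have hre : ∀ N, dx N (fun y => (z y).re) x = (pdC z N x).re := fun N =>
    congrArg (fun L : (Fin D → ℝ) →L[ℝ] ℝ => L (Pi.single N 1))
      (Complex.reCLM.hasFDerivAt.comp x hz.hasFDerivAt).fderiv
  have him : ∀ N, dx N (fun y => (z y).im) x = (pdC z N x).im := fun N =>
    congrArg (fun L : (Fin D → ℝ) →L[ℝ] ℝ => L (Pi.single N 1))
      (Complex.imCLM.hasFDerivAt.comp x hz.hasFDerivAt).fderiv
  have h1 := sub_eq_zero.1 (h M)
  have h2 := congrArg Complex.re h1
  have h3 := congrArg Complex.im h1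
  simp only [Complex.mul_re, Complex.mul_im, Complex.I_re, Complex.I_im, Complex.re_sum,
    Complex.im_sum, Complex.ofReal_re, Complex.ofReal_im, zero_mul, one_mul, zero_sub, zero_add,
    sub_zero, add_zero] at h2 h3
  simp only [hre, him]
  exact ⟨h3.symm, by rw [h2, neg_neg]⟩

/-- If `I` maps the differential of `f` to the differential of `g`, then the differential of `f`
annihilates the Nijenhuis tensor of `I`. -/
theorem sum_dx_mul_nijenhuis {D : ℕ} {I : (Fin D → ℝ) → Matrix (Fin D) (Fin D) ℝ} {x : Fin D → ℝ}
    (hI : ∀ i j, DifferentiableAt ℝ (fun y => I y i j) x) (hI2 : I x * I x = -1)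
    {f g : (Fin D → ℝ) → ℝ} (hf : ContDiffAt ℝ 2 f x) (hg : ContDiffAt ℝ 2 g x)
    (hfg : ∀ᶠ y in 𝓝 x, ∀ M, ∑ N, I y M N * dx N f y = dx M g y) (M N : Fin D) :
    ∑ K, nijenhuis I x M N K * dx K f x = 0 := by
  have h1 := sum_smul_curl (a := fun K => dx K f) hI hI2
    (fun K => (contDiffAt_dx (m := 1) hf K).differentiableAt (by simp)) (fun M K => dx_comm hf M K)
  have h2 : ext1 (fun N y => ∑ K, I y N K * dx K f y) x = 0 := by
    ext M N
    have h3 : ∀ N, (fun y => ∑ K, I y N K * dx K f y) =ᶠ[𝓝 x] dx N g :=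
      fun N => hfg.mono fun y hy => hy N
    rw [ext1, Matrix.of_apply, dx_congr (h3 N), dx_congr (h3 M), dx_comm hg M N, sub_self,
      Matrix.zero_apply]
  rw [h2, mul_zero, zero_mul, sub_zero] at h1
  have h3 := congrFun (congrFun h1 M) N
  rw [Matrix.sum_apply, Matrix.zero_apply] at h3
  rw [← h3]
  refine Finset.sum_congr rfl fun K _ => ?_
  rw [Matrix.smul_apply, ← nijenhuis_eq, smul_eq_mul, mul_comm]

theorem nijenhuis_eq_zero {d : ℕ} {I : (Fin (2 * d) → ℝ) → Matrix (Fin (2 * d)) (Fin (2 * d)) ℝ}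
    {x : Fin (2 * d) → ℝ} (hI : ∀ i j, DifferentiableAt ℝ (fun y => I y i j) x)
    (hI2 : I x * I x = -1) {z : Fin d → (Fin (2 * d) → ℝ) → ℂ} (hz : ∀ n, ContDiffAt ℝ 2 (z n) x)
    (hzI : ∀ᶠ y in 𝓝 x, ∀ n, ComplexCoordEq I (z n) y) (hu : IsUnit (realJacobian z x))
    (M N K : Fin (2 * d)) : nijenhuis I x M N K = 0 := by
  have hre : ∀ n, ContDiffAt ℝ 2 (fun y => (z n y).re) x := fun n =>
    Complex.reCLM.contDiff.contDiffAt.comp x (hz n)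
  have him : ∀ n, ContDiffAt ℝ 2 (fun y => (z n y).im) x := fun n =>
    Complex.imCLM.contDiff.contDiffAt.comp x (hz n)
  have hzd : ∀ n, ∀ᶠ y in 𝓝 x, DifferentiableAt ℝ (z n) y := fun n =>
    ((hz n).eventually (by simp)).mono fun y h => h.differentiableAt two_ne_zero
  have key : ∀ p : Fin d × Fin 2, ∑ K, nijenhuis I x M N K *
      dx K (fun y => if p.2 = 0 then (z p.1 y).re else (z p.1 y).im) x = 0 := by
    rintro ⟨n, a⟩
    fin_cases a
    · exact sum_dx_mul_nijenhuis hI hI2 (hre n) (him n) (by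
        filter_upwards [hzI, hzd n] with y h1 h2 M using (ComplexCoordEq.re_im (h1 n) h2 M).1) M N
    · exact sum_dx_mul_nijenhuis hI hI2 (him n) (hre n).neg (by
        filter_upwards [hzI, hzd n] with y h1 h2 M
        rw [(ComplexCoordEq.re_im (h1 n) h2 M).2, dx, dx]
        exact (congrArg (fun L : (Fin (2 * d) → ℝ) →L[ℝ] ℝ => L (Pi.single M 1))
          (fderiv_neg (f := fun y => (z n y).re))).symm) M N
  have h0 : (fun K => nijenhuis I x M N K) ∘
      (finProdFinEquiv.trans (finCongr (by ring : d * 2 = 2 * d))) = 0 := by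
    refine Matrix.mulVec_injective_iff_isUnit.2 hu ?_
    rw [Matrix.mulVec_zero]
    exact funext fun p => (realJacobian_mulVec z x (fun K => nijenhuis I x M N K) p).trans (key p)
  have h1 := congrFun h0 ((finProdFinEquiv.trans (finCongr (by ring : d * 2 = 2 * d))).symm K)
  rwa [Function.comp_apply, Equiv.apply_symm_apply] at h1

end NN

/-- The Newlander–Nirenberg theorem (local version, in a chart): for a smooth almost complex
structure on an open set `U ⊆ ℝ^{2d}`, the Nijenhuis tensor vanishes identically on `U` iff
around every point of `U` there exist smooth local complex coordinates `z^1, …, z^d` solving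
the complex-coordinate equations, with everywhere invertible real Jacobian. -/
theorem newlander_nirenberg (d : ℕ) (hd : 1 ≤ d)
    (U : Set (Fin (2 * d) → ℝ)) (hU : IsOpen U)
    (I : (Fin (2 * d) → ℝ) → Matrix (Fin (2 * d)) (Fin (2 * d)) ℝ)
    (hIsmooth : ∀ N K : Fin (2 * d), ContDiffOn ℝ (⊤ : ℕ∞) (fun y => I y N K) U)
    (hI2 : ∀ x ∈ U, I x * I x = -1) :
    (∀ x ∈ U, ∀ M N K : Fin (2 * d), nijenhuis I x M N K = 0) ↔
      (∀ x₀ ∈ U, ∃ V : Set (Fin (2 * d) → ℝ), IsOpen V ∧ x₀ ∈ V ∧ V ⊆ U ∧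
        ∃ z : Fin d → ((Fin (2 * d) → ℝ) → ℂ),
          (∀ n, ContDiffOn ℝ (⊤ : ℕ∞) (z n) V) ∧
          (∀ n, ∀ x ∈ V, ComplexCoordEq I (z n) x) ∧
          (∀ x ∈ V, IsUnit (realJacobian z x))) := by
  constructor
  · intro h x₀ hx₀
    have : Nonempty (Fin (2 * d)) := ⟨⟨0, by omega⟩⟩
    obtain ⟨V, hV, hx, hVU, z, hz, hzI, hb⟩ := NN.exists_smooth_chart (F := Fin d → ℂ) hU
      (fun x hx m hm => NN.hasChart_of_integ
        (finProdFinEquiv.trans (finCongr (by ring : d * 2 = 2 * d))) hU hIsmooth hI2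
        (fun y hy => NN.integ_of_nijenhuis (h y hy)) hx hm) hx₀
    have hd : ∀ x ∈ V, DifferentiableAt ℝ z x := fun x hx =>
      (hz.contDiffAt (hV.mem_nhds hx)).differentiableAt (by simp)
    exact ⟨V, hV, hx, hVU, fun n y => z y n, contDiffOn_pi.1 hz,
      fun n x hx => NN.CoordEq.complexCoordEq (hzI x hx) (hd x hx) n,
      fun x hx => NN.isUnit_realJacobian (hd x hx) (hb x hx).1⟩
  · intro h x hx
    obtain ⟨V, hV, hxV, -, z, hz, hzI, hu⟩ := h x hx
    refine NN.nijenhuis_eq_zero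
      (fun i j => ((hIsmooth i j).contDiffAt (hU.mem_nhds hx)).differentiableAt (by simp))
      (hI2 x hx) (fun n => ((hz n).contDiffAt (hV.mem_nhds hxV)).of_le ?_) ?_ (hu x hxV)
    · exact WithTop.coe_le_coe.2 (le_top : (2 : ℕ∞) ≤ ⊤)
    · filter_upwards [hV.mem_nhds hxV] with y hy n using hzI n y hy
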